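/- Let G be a finite group. If δ(G) < 16, then G is solvable. -/

import Mathlib

/-- A maximal chain of `H` in the ambient group of length `r`: a chain
`H = c 0 < c 1 < ... < c r = ⊤` where each `c i` is a maximal subgroup of `c (i+1)`,
i.e. each step is a covering relation in the subgroup lattice. -/
def IsMaxChainOf {G : Type*} [Group G] (H : Subgroup G) (r : ℕ) (c : ℕ → Subgroup G) : Prop :=
  c 0 = H ∧ c r = ⊤ ∧ ∀ i < r, c i ⋖ c (i + 1)

/-- All maximal chains of `H` in the ambient group have the same length. -/
def AllMaxChainsSameLength {G : Type*} [Group G] (H : Subgroup G) : Prop :=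
  ∀ (r s : ℕ) (c d : ℕ → Subgroup G),
    IsMaxChainOf H r c → IsMaxChainOf H s d → r = s

/-- `delta G` is the number of subgroups of `G` not all of whose maximal chains
in `G` have the same length. -/
noncomputable def delta (G : Type*) [Group G] : ℕ :=
  Nat.card {H : Subgroup G // ¬ AllMaxChainsSameLength H}

universe u

/-- A chain of covering relations of length `n` from `a` to `b`. -/
inductive CovChain {α : Type*} [PartialOrder α] : α → α → ℕ → Prop
  | refl (a : α) : CovChain a a 0
  | step {a b c : α} {n : ℕ} : a ⋖ b → CovChain b c n → CovChain a c (n + 1)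

namespace CovChain

variable {α β : Type*} [PartialOrder α] [PartialOrder β]

theorem trans {a b c : α} {m n : ℕ} (h : CovChain a b m) (h' : CovChain b c n) :
    CovChain a c (m + n) := by
  induction h with
  | refl a => simpa using h'
  | step hab _ ih => rw [Nat.add_right_comm]; exact step hab (ih h')

theorem single {a b : α} (h : a ⋖ b) : CovChain a b 1 := step h (refl b)

theorem map (f : α ↪o β) (hf : (Set.range f).OrdConnected) {a b : α} {n : ℕ}
    (h : CovChain a b n) : CovChain (f a) (f b) n := by
  induction h with
  | refl a => exact refl _
  | step hab _ ih => exact step (hab.image f hf) ih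

theorem exists_of_le [Finite α] {a b : α} (h : a ≤ b) : ∃ n, CovChain a b n := by
  induction a using WellFoundedGT.induction with
  | ind a ih =>
    rcases h.eq_or_lt with rfl | hlt
    · exact ⟨0, refl a⟩
    · obtain ⟨c, hac, hcb⟩ := exists_covBy_le_of_lt hlt
      obtain ⟨n, hn⟩ := ih c hac.lt hcb
      exact ⟨n + 1, step hac hn⟩

end CovChain

section Chains

variable {G : Type*} [Group G]

theorem exists_isMaxChainOf_iff {H : Subgroup G} {r : ℕ} :
    (∃ c, IsMaxChainOf H r c) ↔ CovChain H ⊤ r := by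
  constructor
  · rintro ⟨c, h0, hr, hc⟩
    induction r generalizing H c with
    | zero => rw [← h0, hr]; exact CovChain.refl _
    | succ r ih =>
      rw [← h0]
      exact CovChain.step (hc 0 (by omega))
        (ih (fun i => c (i + 1)) rfl hr fun i hi => hc (i + 1) (by omega))
  · intro h
    generalize hT : (⊤ : Subgroup G) = T at h
    induction h with
    | refl a => exact ⟨fun _ => a, rfl, hT.symm, by simp⟩
    | @step a b _ n hab _ ih =>
      obtain ⟨c, h0, hr, hc⟩ := ih hT
      refine ⟨fun i => if i = 0 then a else c (i - 1), by simp, by simpa using hr, ?_⟩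
      rintro (_ | i) hi
      · simpa [h0] using hab
      · simpa using hc i (by omega)

theorem allMaxChainsSameLength_iff {H : Subgroup G} :
    AllMaxChainsSameLength H ↔
      ∀ r s, CovChain H ⊤ r → CovChain H ⊤ s → r = s := by
  constructor
  · intro h r s hr hs
    obtain ⟨c, hc⟩ := exists_isMaxChainOf_iff.2 hr
    obtain ⟨d, hd⟩ := exists_isMaxChainOf_iff.2 hs
    exact h r s c d hc hd
  · intro h r s c d hc hd
    exact h r s (exists_isMaxChainOf_iff.1 ⟨c, hc⟩) (exists_isMaxChainOf_iff.1 ⟨d, hd⟩)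

theorem AllMaxChainsSameLength.mono_of_covChain {H K : Subgroup G} {n : ℕ}
    (hHK : CovChain H K n) (h : AllMaxChainsSameLength H) : AllMaxChainsSameLength K := by
  rw [allMaxChainsSameLength_iff] at h ⊢
  intro r s hr hs
  have := h _ _ (hHK.trans hr) (hHK.trans hs)
  omega

theorem AllMaxChainsSameLength.mono [Finite G] {H K : Subgroup G}
    (hHK : H ≤ K) (h : AllMaxChainsSameLength H) : AllMaxChainsSameLength K := by
  obtain ⟨n, hn⟩ := CovChain.exists_of_le hHK
  exact h.mono_of_covChain hn

theorem CovChain.map_subtype {N : Subgroup G} {A B : Subgroup N} {n : ℕ} (h : CovChain A B n) :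
    CovChain (A.map N.subtype) (B.map N.subtype) n := by
  refine h.map ⟨⟨Subgroup.map N.subtype, Subgroup.map_injective N.subtype_injective⟩, ?_⟩ ?_
  · intro a b
    exact Subgroup.map_le_map_iff_of_injective N.subtype_injective
  · constructor
    rintro _ ⟨a, rfl⟩ _ ⟨b, rfl⟩ K ⟨_, hK⟩
    refine ⟨K.subgroupOf N, ?_⟩
    exact Subgroup.map_subgroupOf_eq_of_le (hK.trans (Subgroup.map_subtype_le b))

theorem CovChain.comap {G' : Type*} [Group G'] {f : G →* G'} (hf : Function.Surjective f)
    {A B : Subgroup G'} {n : ℕ} (h : CovChain A B n) :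
    CovChain (A.comap f) (B.comap f) n := by
  refine h.map ⟨⟨Subgroup.comap f, Subgroup.comap_injective hf⟩, ?_⟩ ?_
  · intro a b
    exact Subgroup.comap_le_comap_of_surjective hf
  · constructor
    rintro _ ⟨a, rfl⟩ _ ⟨b, rfl⟩ K ⟨hK, _⟩
    refine ⟨K.map f, ?_⟩
    refine Subgroup.comap_map_eq_self (le_trans ?_ hK)
    intro g hg
    change f g ∈ a
    rw [MonoidHom.mem_ker.1 hg]
    exact one_mem a

theorem delta_subgroup_le [Finite G] (N : Subgroup G) : delta N ≤ delta G := by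
  refine Nat.card_le_card_of_injective
    (fun H => ⟨H.1.map N.subtype, fun h => H.2 ?_⟩) ?_
  · rw [allMaxChainsSameLength_iff] at h ⊢
    intro r s hr hs
    obtain ⟨n, hn⟩ := CovChain.exists_of_le (le_top : N ≤ ⊤)
    have e : (⊤ : Subgroup N).map N.subtype = N := by
      rw [← MonoidHom.range_eq_map, Subgroup.range_subtype]
    have hr' := hr.map_subtype
    have hs' := hs.map_subtype
    rw [e] at hr' hs'
    have := h _ _ (hr'.trans hn) (hs'.trans hn)
    omega
  · intro H K hHK
    exact Subtype.ext (Subgroup.map_injective N.subtype_injective (congrArg Subtype.val hHK))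

theorem delta_quotient_le [Finite G] (N : Subgroup G) [N.Normal] : delta (G ⧸ N) ≤ delta G := by
  have hs := QuotientGroup.mk'_surjective N
  refine Nat.card_le_card_of_injective
    (fun H => ⟨H.1.comap (QuotientGroup.mk' N), fun h => H.2 ?_⟩) ?_
  · rw [allMaxChainsSameLength_iff] at h ⊢
    intro r s hr hs'
    exact h _ _ (hr.comap hs) (hs'.comap hs)
  · intro H K hHK
    exact Subtype.ext (Subgroup.comap_injective hs (congrArg Subtype.val hHK))

/-- Conjugation by `g` permutes chains of subgroups. -/
theorem CovChain.conj (g : G) {A B : Subgroup G} {n : ℕ} (h : CovChain A B n) :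
    CovChain (A.map (MulAut.conj g).toMonoidHom) (B.map (MulAut.conj g).toMonoidHom) n := by
  have := h.comap (f := (MulAut.conj g⁻¹).toMonoidHom) (MulAut.conj g⁻¹).surjective
  convert this using 1 <;>
  · ext x
    simp [Subgroup.mem_map, mul_assoc]
    constructor
    · rintro ⟨a, ha, rfl⟩; simpa [mul_assoc] using ha
    · intro hx; exact ⟨_, hx, by group⟩

theorem allMaxChainsSameLength_conj_iff (g : G) {H : Subgroup G} :
    AllMaxChainsSameLength (H.map (MulAut.conj g).toMonoidHom) ↔ AllMaxChainsSameLength H := by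
  have key : ∀ (g : G) (H : Subgroup G), AllMaxChainsSameLength (H.map (MulAut.conj g).toMonoidHom)
      → AllMaxChainsSameLength H := by
    intro g H h
    rw [allMaxChainsSameLength_iff] at h ⊢
    intro r s hr hs
    have e : (⊤ : Subgroup G).map (MulAut.conj g).toMonoidHom = ⊤ :=
      Subgroup.map_top_of_surjective _ (MulAut.conj g).surjective
    have h1 := hr.conj g
    have h2 := hs.conj g
    rw [e] at h1 h2
    exact h r s h1 h2
  refine ⟨key g H, fun h => key g⁻¹ _ ?_⟩
  rw [Subgroup.map_map]
  convert h
  ext x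
  simp [Subgroup.mem_map, mul_assoc]

theorem covBy_of_prime_relIndex {H K : Subgroup G} (hle : H ≤ K)
    (hp : (H.relIndex K).Prime) : H ⋖ K := by
  refine ⟨lt_of_le_of_ne hle ?_, ?_⟩
  · rintro rfl
    simp [Nat.not_prime_one] at hp
  · intro L hHL hLK
    have hm := Subgroup.relIndex_mul_relIndex H L K hHL.le hLK.le
    rcases (Nat.dvd_prime hp).1 (Dvd.intro _ hm) with h | h
    · exact hHL.not_ge (Subgroup.relIndex_eq_one.1 h)
    · rw [h] at hm
      have := Nat.eq_of_mul_eq_mul_left hp.pos (hm.trans (mul_one _).symm)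
      exact hLK.not_ge (Subgroup.relIndex_eq_one.1 this)

theorem covBy_of_card_eq_mul_prime [Finite G] {H K : Subgroup G} (hle : H ≤ K) {p : ℕ}
    (hp : p.Prime) (h : Nat.card K = Nat.card H * p) : H ⋖ K := by
  refine covBy_of_prime_relIndex hle ?_
  have := Subgroup.relIndex_mul_relIndex ⊥ H K bot_le hle
  rw [Subgroup.relIndex_bot_left, Subgroup.relIndex_bot_left, h] at this
  rwa [Nat.eq_of_mul_eq_mul_left Nat.card_pos this]

end Chains

/-- A smallest nonsolvable group with `delta G < 16` is simple. -/
theorem isSolvable_of_delta_lt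
    (main : ∀ (G : Type u) [Group G] [Finite G] [IsSimpleGroup G], ¬ Group.IsSolvable G →
      16 ≤ delta G)
    (G : Type u) [Group G] [Finite G] (h : delta G < 16) : Group.IsSolvable G := by
  induction hn : Nat.card G using Nat.strong_induction_on generalizing G with
  | _ n ih =>
    subst hn
    by_contra hG
    have hsub : ∀ N : Subgroup G, N ≠ ⊤ → Group.IsSolvable N := fun N hN =>
      ih _ (lt_of_le_of_ne (Subgroup.card_le_card_group N)
        fun e => hN (Subgroup.eq_top_of_card_eq N e)) N ((delta_subgroup_le N).trans_lt h) rfl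
    have : Nontrivial G := by
      by_contra hn
      rw [not_nontrivial_iff_subsingleton] at hn
      exact hG inferInstance
    have : IsSimpleGroup G := by
      refine ⟨fun N hN => ?_⟩
      by_contra! hne
      refine hG ((Group.isSolvable_iff_subgroup_quotient N).2 ⟨hsub N hne.2, ?_⟩)
      refine ih _ ?_ (G ⧸ N) ((delta_quotient_le N).trans_lt h) rfl
      rw [Subgroup.card_eq_card_quotient_mul_card_subgroup N]
      have : 1 < Nat.card N := by
        rw [Nat.one_lt_iff_ne_zero_and_ne_one]
        exact ⟨Nat.card_pos.ne', fun e => hne.1 (Subgroup.card_eq_one.1 e)⟩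
      exact lt_mul_of_one_lt_right Nat.card_pos this
    exact absurd h (not_lt.2 (main G hG))

section Fusion

open Subgroup Pointwise
open scoped commutatorElement

variable {G : Type*} [Group G] [Finite G] {p : ℕ} [Fact p.Prime]

/-- Frobenius' condition: elements of prime power order prime to `p` normalising a `p`-subgroup
centralise it. -/
def FrobeniusCondition (G : Type*) [Group G] (p : ℕ) : Prop :=
  ∀ D : Subgroup G, IsPGroup p D → ∀ x ∈ normalizer (D : Set G),
    ∀ q k : ℕ, q.Prime → q ≠ p → orderOf x = q ^ k → x ∈ centralizer (D : Set G)

theorem FrobeniusCondition.exists_mul_eq (hG : FrobeniusCondition G p) {D : Subgroup G}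
    (hD : IsPGroup p D) (S : Sylow p (normalizer (D : Set G)))
    (n : normalizer (D : Set G)) :
    ∃ c : normalizer (D : Set G), (c : G) ∈ centralizer (D : Set G) ∧
      ∃ s ∈ (S : Subgroup (normalizer (D : Set G))), c * s = n := by
  let C : Subgroup (normalizer (D : Set G)) := (centralizer (D : Set G)).subgroupOf _
  have htop : C ⊔ S = ⊤ := by
    rw [← index_eq_one]
    by_contra hne
    obtain ⟨q, hq, hdvd⟩ := Nat.exists_prime_and_dvd hne
    have : Fact q.Prime := ⟨hq⟩
    by_cases hqp : q = p
    · subst hqp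
      exact S.not_dvd_index (hdvd.trans (index_dvd_of_le le_sup_right))
    · obtain ⟨Q⟩ : Nonempty (Sylow q (normalizer (D : Set G))) := inferInstance
      refine Q.not_dvd_index (hdvd.trans (index_dvd_of_le (le_trans ?_ le_sup_left)))
      intro x hx
      refine mem_subgroupOf.2 ?_
      obtain ⟨k, hk⟩ := IsPGroup.iff_orderOf.1 Q.2 ⟨x, hx⟩
      refine hG D hD x x.2 q k hq hqp ?_
      rw [← hk]
      simp
  have hn : n ∈ C ⊔ S := htop ▸ mem_top n
  obtain ⟨c, hc, s, hs, h⟩ := mem_sup_of_normal_left (s := C).1 hn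
  exact ⟨c, hc, s, hs, h⟩

theorem FrobeniusCondition.exists_conj_sup (hG : FrobeniusCondition G p) {D : Subgroup G}
    (hD : IsPGroup p D) {A B : Subgroup G} (hA : IsPGroup p A) (hB : IsPGroup p B)
    (hAN : A ≤ normalizer (D : Set G)) (hBN : B ≤ normalizer (D : Set G)) :
    ∃ k ∈ centralizer (D : Set G), ∃ P : Sylow p G, B ≤ P ∧ MulAut.conj k • A ≤ P := by
  set N := normalizer (D : Set G)
  have hA' : IsPGroup p (A.subgroupOf N) := hA.comap_of_injective N.subtype N.subtype_injective
  have hB' : IsPGroup p (B.subgroupOf N) := hB.comap_of_injective N.subtype N.subtype_injective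
  obtain ⟨S, hS⟩ := hA'.exists_le_sylow
  obtain ⟨T, hT⟩ := hB'.exists_le_sylow
  obtain ⟨n, rfl⟩ := MulAction.exists_smul_eq N S T
  obtain ⟨c, hc, s, hs, rfl⟩ := hG.exists_mul_eq hD S n
  obtain ⟨P, hP⟩ := (((c * s) • S).2.map N.subtype).exists_le_sylow
  refine ⟨c, hc, P, ?_, ?_⟩
  · intro b hb
    exact hP ⟨⟨b, hBN hb⟩, hT (mem_subgroupOf.2 hb), rfl⟩
  · rintro _ ⟨a, ha, rfl⟩
    refine hP ⟨c * ⟨a, hAN ha⟩ * c⁻¹, ?_, by simp⟩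
    have h1 : (⟨a, hAN ha⟩ : N) ∈ S := hS (mem_subgroupOf.2 ha)
    have h2 : (c * s) • S = c • S := by
      rw [mul_smul, Sylow.smul_eq_iff_mem_normalizer.2 (le_normalizer hs)]
    rw [h2]
    exact ⟨_, h1, by simp [MulAut.conj_apply]⟩

theorem lt_inf_normalizer_of_lt {P D : Subgroup G} (hP : IsPGroup p P) (h : D < P) :
    D < P ⊓ normalizer (D : Set G) := by
  refine lt_of_le_of_ne (le_inf h.le le_normalizer) fun e => ?_
  have := hP.isNilpotent
  have hlt : D.subgroupOf P < ⊤ := by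
    rw [lt_top_iff_ne_top, Ne, subgroupOf_eq_top]
    exact h.not_ge
  have h1 := Group.normalizerCondition_of_isNilpotent (G := P) _ hlt
  refine h1.not_ge ?_
  intro x hx
  rw [mem_subgroupOf, e]
  refine ⟨x.2, ?_⟩
  rw [mem_normalizer_iff] at hx
  refine mem_normalizer_iff.2 fun y => ?_
  constructor
  · intro hy
    have := (hx ⟨y, h.le hy⟩).1 (mem_subgroupOf.2 hy)
    simpa [mem_subgroupOf] using this
  · intro hy
    have h2 : y ∈ P := by
      have := P.mul_mem (P.mul_mem (P.inv_mem x.2) (h.le hy)) x.2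
      simpa [mul_assoc] using this
    have := (hx ⟨y, h2⟩).2 (by simpa [mem_subgroupOf] using hy)
    simpa [mem_subgroupOf] using this

theorem card_lt_card_of_subgroup_lt {H K : Subgroup G} (h : H < K) : Nat.card H < Nat.card K :=
  lt_of_le_of_ne (card_le_of_le h.le) fun e => h.ne (eq_of_le_of_card_ge h.le e.ge)

theorem FrobeniusCondition.exists_smul_eq (hG : FrobeniusCondition G p) (P Q : Sylow p G) :
    ∃ c ∈ centralizer ((P ⊓ Q : Subgroup G) : Set G), c • P = Q := by
  induction hn : Nat.card G - Nat.card (P ⊓ Q : Subgroup G) using Nat.strong_induction_on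
    generalizing P Q with
  | _ n ih =>
    subst hn
    set D : Subgroup G := P ⊓ Q with hDdef
    by_cases hPQ : P = Q
    · exact ⟨1, one_mem _, by simpa using hPQ⟩
    have hDP : D < P := by
      refine lt_of_le_of_ne inf_le_left fun e => hPQ ?_
      have : (P : Subgroup G) ≤ Q := inf_eq_left.1 e
      exact (Sylow.ext (P.3 Q.2 this)).symm
    have hDQ : D < Q := by
      refine lt_of_le_of_ne inf_le_right fun e => hPQ ?_
      have : (Q : Subgroup G) ≤ P := inf_eq_right.1 e
      exact Sylow.ext (Q.3 P.2 this)
    have hDp : IsPGroup p D := P.2.to_le inf_le_left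
    have hA := lt_inf_normalizer_of_lt P.2 hDP
    have hB := lt_inf_normalizer_of_lt Q.2 hDQ
    obtain ⟨k, hk, P2, hBP, hAP⟩ := hG.exists_conj_sup hDp (P.2.to_le inf_le_left)
      (Q.2.to_le inf_le_left) (A := P ⊓ normalizer (D : Set G))
      (B := Q ⊓ normalizer (D : Set G)) inf_le_right inf_le_right
    have hkD : D = MulAut.conj k • D := by
      have hle : MulAut.conj k • D ≤ D := by
        rintro _ ⟨d, hd, rfl⟩
        have := mem_centralizer_iff.1 hk d hd
        simpa [MulAut.conj_apply, ← this] using hd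
      exact (eq_of_le_of_card_ge hle
        (Nat.card_congr (equivSMul (MulAut.conj k) D).toEquiv).le).symm
    have h1 : D < ((k • P : Sylow p G) : Subgroup G) ⊓ P2 := by
      refine lt_of_lt_of_le (b := MulAut.conj k • ((P : Subgroup G) ⊓ normalizer (D : Set G))) ?_ ?_
      · nth_rw 1 [hkD]
        refine lt_of_le_of_ne ?_ ?_
        · exact Subgroup.pointwise_smul_le_pointwise_smul_iff.2 hA.le
        · intro e
          exact hA.ne (smul_left_cancel _ e)
      · refine le_inf ?_ hAP
        rw [Sylow.coe_subgroup_smul]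
        exact Subgroup.pointwise_smul_le_pointwise_smul_iff.2 inf_le_left
    have h2 : D < (P2 : Subgroup G) ⊓ Q := lt_of_lt_of_le hB (le_inf hBP inf_le_left)
    have hlt : ∀ E : Subgroup G, D < E → Nat.card G - Nat.card E < Nat.card G - Nat.card D := by
      intro E hE
      have := card_lt_card_of_subgroup_lt hE
      have := Subgroup.card_le_card_group E
      omega
    obtain ⟨c1, hc1, e1⟩ := ih _ (hlt _ h1) _ _ rfl
    obtain ⟨c2, hc2, e2⟩ := ih _ (hlt _ h2) _ _ rfl
    refine ⟨c2 * c1 * k, mul_mem (mul_mem ?_ ?_) hk, ?_⟩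
    · exact centralizer_le h2.le hc2
    · exact centralizer_le h1.le hc1
    · rw [mul_smul, mul_smul, e1, e2]

/-- Under Frobenius' condition a Sylow subgroup controls its own fusion. -/
theorem FrobeniusCondition.exists_conj_eq (hG : FrobeniusCondition G p) (P : Sylow p G) {g x : G}
    (hx : x ∈ P) (hgx : g * x * g⁻¹ ∈ P) : ∃ u ∈ P, g * x * g⁻¹ = u * x * u⁻¹ := by
  obtain ⟨c, hc, e⟩ := hG.exists_smul_eq (g⁻¹ • P) P
  have hxQ : x ∈ ((g⁻¹ • P : Sylow p G) : Subgroup G) := by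
    rw [Sylow.coe_subgroup_smul]
    exact ⟨_, hgx, by simp [mul_assoc]⟩
  have hcx : x * c = c * x := mem_centralizer_iff.1 hc x ⟨hxQ, hx⟩
  have hn : g * c⁻¹ ∈ normalizer ((P : Subgroup G) : Set G) := by
    have : c * g⁻¹ ∈ normalizer ((P : Subgroup G) : Set G) := by
      refine Sylow.smul_eq_iff_mem_normalizer.1 ?_
      rw [mul_smul, e]
    simpa using inv_mem this
  obtain ⟨d, hd, s, hs, h⟩ := hG.exists_mul_eq P.2 (P.subtype le_normalizer) ⟨_, hn⟩
  have hs' : (s : G) ∈ P := by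
    rw [Sylow.coe_subtype] at hs
    exact mem_subgroupOf.1 hs
  have h' : (d : G) * s = g * c⁻¹ := congrArg Subtype.val h
  refine ⟨s, hs', ?_⟩
  have hd' := mem_centralizer_iff.1 hd (s * x * (s : G)⁻¹)
    (mul_mem (mul_mem hs' hx) (inv_mem hs'))
  generalize (s : G) = t at *
  generalize (d : G) = a at *
  have hg : g = a * t * c := by rw [h']; group
  calc g * x * g⁻¹ = a * t * (c * x) * c⁻¹ * t⁻¹ * a⁻¹ := by rw [hg]; group
    _ = a * (t * x * t⁻¹) * a⁻¹ := by rw [← hcx]; group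
    _ = t * x * t⁻¹ := by rw [← hd']; group

theorem not_frobeniusCondition [IsSimpleGroup G] (hns : ¬ Group.IsSolvable G)
    (hp : p ∣ Nat.card G) : ¬ FrobeniusCondition G p := by
  intro hG
  obtain ⟨P⟩ : Nonempty (Sylow p G) := inferInstance
  have hP : (P : Subgroup G) ≠ ⊥ := P.ne_bot_of_dvd_card hp
  have hcomm : _root_.commutator G = ⊤ := by
    have hnorm : (_root_.commutator G).Normal := inferInstance
    rcases hnorm.eq_bot_or_eq_top with h | h
    · exfalso
      refine hns (IsSimpleGroup.comm_iff_isSolvable.1 fun a b => ?_)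
      have : ⁅a, b⁆ ∈ _root_.commutator G := commutator_mem_commutator (mem_top a) (mem_top b)
      rw [h, mem_bot] at this
      exact commutatorElement_eq_one_iff_mul_comm.1 this
    · exact h
  have hfoc := commutator_inf_eq_focalSubgroup P
  rw [hcomm, top_inf_eq] at hfoc
  have hle : (P : Subgroup G) ≤ ⁅(P : Subgroup G), (P : Subgroup G)⁆ := by
    conv_lhs => rw [hfoc]
    rw [focalSubgroup_def, closure_le]
    rintro y ⟨hy, x, hx, u, rfl⟩
    have hux : u * x⁻¹ * u⁻¹ ∈ (P : Subgroup G) := by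
      have := P.mul_mem (P.inv_mem hx) hy
      simpa only [commutatorElement_def, mul_assoc, inv_mul_cancel_left] using this
    obtain ⟨v, hv, e⟩ := hG.exists_conj_eq P (P.inv_mem hx) hux
    have : ⁅x, u⁆ = ⁅x, v⁆ := by
      simp only [commutatorElement_def]
      rw [mul_assoc, mul_assoc, ← mul_assoc u, e]
      group
    rw [this]
    exact commutator_mem_commutator hx hv
  have := P.2.isNilpotent
  have htop : (⊤ : Subgroup P) ≠ ⊥ := by
    intro h
    refine hP ((eq_bot_iff_forall _).2 fun x hx => ?_)
    have : (⟨x, hx⟩ : P) ∈ (⊤ : Subgroup P) := mem_top _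
    rw [h, mem_bot] at this
    exact congrArg Subtype.val this
  have hlt := Group.IsSolvable.commutator_lt_of_ne_bot htop
  refine hlt.not_ge ?_
  rw [← map_subtype_le_map_subtype, map_commutator]
  simpa [← MonoidHom.range_eq_map] using hle

end Fusion

section PrimeOrder

open Subgroup Pointwise

variable {G : Type*} [Group G] [Finite G] {p q : ℕ}

omit [Finite G] in
theorem card_sup_of_le_normalizer {A C : Subgroup G} (h : C ≤ normalizer (A : Set G))
    (hd : Disjoint A C) : Nat.card (A ⊔ C : Subgroup G) = Nat.card A * Nat.card C := by
  rw [← Nat.card_prod]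
  refine (Nat.card_congr (Equiv.ofBijective
    (fun z : A × C => (⟨z.1 * z.2, mul_mem_sup z.1.2 z.2.2⟩ : (A ⊔ C : Subgroup G)))
    ⟨?_, ?_⟩)).symm
  · intro a b hab
    exact mul_injective_of_disjoint hd (congrArg Subtype.val hab)
  · rintro ⟨y, hy⟩
    have : y ∈ ((A ⊔ C : Subgroup G) : Set G) := hy
    rw [coe_mul_of_right_le_normalizer_left A C h] at this
    obtain ⟨a, ha, c, hc, rfl⟩ := this
    exact ⟨(⟨a, ha⟩, ⟨c, hc⟩), rfl⟩

theorem exists_le_card_eq_of_card_eq_pow [hp : Fact p.Prime] {P : Subgroup G} {b : ℕ}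
    (hP : Nat.card P = p ^ (b + 1)) {H : Subgroup G} (hHP : H ≤ P) {a : ℕ}
    (hH : Nat.card H = p ^ a) (hab : a ≤ b) :
    ∃ K : Subgroup G, H ≤ K ∧ K ≤ P ∧ Nat.card K = p ^ b := by
  have hH' : Nat.card (H.subgroupOf P) = p ^ a := by
    rw [← hH]; exact Nat.card_congr (subgroupOfEquivOfLe hHP).toEquiv
  obtain ⟨K, hK, hHK⟩ := Sylow.exists_subgroup_card_pow_prime_le p (m := b)
    (by rw [hP]; exact pow_dvd_pow p (Nat.le_succ b)) (H.subgroupOf P) hH' hab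
  refine ⟨K.map P.subtype, ?_, map_subtype_le K, ?_⟩
  · rw [← map_subgroupOf_eq_of_le hHP]
    exact map_mono hHK
  · rw [← hK, card_map_of_injective P.subtype_injective]

theorem CovChain.of_card_eq_pow [hp : Fact p.Prime] {H P : Subgroup G} (hHP : H ≤ P) {a b : ℕ}
    (hH : Nat.card H = p ^ a) (hP : Nat.card P = p ^ b) : CovChain H P (b - a) := by
  induction b generalizing P with
  | zero =>
    have : H = P := eq_of_le_of_card_ge hHP (by
      rw [hH, hP, pow_zero]; exact Nat.one_le_pow _ _ hp.out.pos)
    subst this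
    rw [Nat.zero_sub]
    exact CovChain.refl _
  | succ b ih =>
    rcases Nat.lt_or_ge b a with hlt | hle
    · have hdvd := card_dvd_of_le hHP
      rw [hH, hP, Nat.pow_dvd_pow_iff_le_right hp.out.one_lt] at hdvd
      have : H = P := eq_of_le_of_card_ge hHP (by
        rw [hH, hP]; exact Nat.pow_le_pow_right hp.out.pos hlt)
      subst this
      rw [Nat.sub_eq_zero_of_le hlt]
      exact CovChain.refl _
    · obtain ⟨K, hHK, hKP, hK⟩ := exists_le_card_eq_of_card_eq_pow hP hHP hH hle
      rw [Nat.succ_sub hle]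
      exact (ih hHK hK).trans (.single (covBy_of_card_eq_mul_prime hKP hp.out (by
        rw [hP, hK, pow_succ])))

theorem CovChain.sup_of_le_normalizer [hq : Fact q.Prime] {A C : Subgroup G}
    (h : C ≤ normalizer (A : Set G)) (hd : Disjoint A C) {b : ℕ} (hC : Nat.card C = q ^ b) :
    CovChain A (A ⊔ C) b := by
  induction b generalizing C with
  | zero =>
    rw [pow_zero, card_eq_one] at hC
    subst hC
    rw [sup_bot_eq]
    exact .refl _
  | succ b ih =>
    obtain ⟨K, -, hKC, hK⟩ := exists_le_card_eq_of_card_eq_pow hC bot_le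
      (by rw [card_bot, pow_zero]) (Nat.zero_le b)
    refine (ih (hKC.trans h) (hd.mono_right hKC) hK).trans
      (.single (covBy_of_card_eq_mul_prime (sup_le_sup_left hKC _) hq.out ?_))
    rw [card_sup_of_le_normalizer h hd,
      card_sup_of_le_normalizer (hKC.trans h) (hd.mono_right hKC), hC, hK]
    ring

omit [Finite G] in
theorem disjoint_of_card_eq_pow (hp : p.Prime) (hq : q.Prime) (hpq : p ≠ q) {A C : Subgroup G}
    {a b : ℕ} (hA : Nat.card A = p ^ a) (hC : Nat.card C = q ^ b) : Disjoint A C := by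
  refine disjoint_of_coprime_natCard ?_
  rw [hA, hC]
  exact Nat.Coprime.pow _ _ ((Nat.coprime_primes hp hq).2 hpq)

omit [Finite G] in
theorem zpowers_le_normalizer {x : G} {A : Subgroup G} (hx : x ∈ normalizer (A : Set G)) :
    zpowers x ≤ normalizer (A : Set G) := by
  rwa [zpowers_le]

/-- A `q`-element normalising a `p`-subgroup and centralising only `E` has `p ^ m ≡ p ^ e`. -/
theorem card_modEq_card_inf_centralizer [hq : Fact q.Prime] {D : Subgroup G} {x : G} {b : ℕ}
    (hx : x ∈ normalizer (D : Set G)) (hxq : orderOf x = q ^ b) :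
    Nat.card D ≡ Nat.card (D ⊓ centralizer {x} : Subgroup G) [MOD q] := by
  let f : zpowers x →* MulAut D :=
    D.normalizerMonoidHom.comp (inclusion (zpowers_le_normalizer hx))
  let _ : MulAction (zpowers x) D := MulAction.compHom D f
  have hsm : ∀ (g : zpowers x) (d : D), ((g • d : D) : G) = g * d * (g : G)⁻¹ := fun g d => rfl
  have hC : IsPGroup q (zpowers x) := IsPGroup.of_card (n := b) (by rw [Nat.card_zpowers, hxq])
  refine (hC.card_modEq_card_fixedPoints D).trans ?_
  have e : MulAction.fixedPoints (zpowers x) D ≃ (D ⊓ centralizer {x} : Subgroup G) :=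
    { toFun := fun d => ⟨d.1, d.1.2, ?_⟩
      invFun := fun d => ⟨⟨d.1, d.2.1⟩, ?_⟩
      left_inv := fun _ => rfl
      right_inv := fun _ => rfl }
  · rw [Nat.card_congr e]
  · have := congrArg Subtype.val (d.2 ⟨x, mem_zpowers x⟩)
    rw [hsm] at this
    refine mem_centralizer_singleton_iff.2 ?_
    simpa using (mul_inv_eq_iff_eq_mul.1 this).symm
  · rintro ⟨g, k, rfl⟩
    refine Subtype.ext ?_
    rw [hsm]
    have h1 : Commute (d : G) x := (mem_centralizer_singleton_iff.1 d.2.2)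
    exact mul_inv_eq_iff_eq_mul.2 ((h1.zpow_right k).eq.symm)

theorem exists_covChains_of_dvd_card [IsSimpleGroup G] (hns : ¬ Group.IsSolvable G)
    (hp : p.Prime) (hdvd : p ∣ Nat.card G) :
    ∃ q, q.Prime ∧ q ∣ Nat.card G ∧ ∃ H R K : Subgroup G, ∃ s t, Nat.card H = p ∧
      Nat.card R = q ∧ CovChain H K s ∧ CovChain R K t ∧ t ≤ s ∧ (t = s → q < p) := by
  have : Fact p.Prime := ⟨hp⟩
  have hF := not_frobeniusCondition hns hdvd
  rw [FrobeniusCondition] at hF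
  push Not at hF
  obtain ⟨D₀, hD₀p, x, hxD₀, q, b, hq, hqp, hxq, hxC₀⟩ := hF
  have : Fact q.Prime := ⟨hq⟩
  obtain ⟨D, ⟨hDp, hxD, hxC⟩, hDmin⟩ := exists_minimal_of_wellFoundedLT
    (fun D : Subgroup G => IsPGroup p D ∧ x ∈ normalizer (D : Set G) ∧
      x ∉ centralizer (D : Set G)) ⟨D₀, hD₀p, hxD₀, hxC₀⟩
  have hDbot : ⊥ < D := by
    rw [bot_lt_iff_ne_bot]
    rintro rfl
    exact hxC (mem_centralizer_iff.2 (by simp))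
  obtain ⟨E, ⟨hED, hxE⟩, hEmax⟩ := exists_maximal_of_wellFoundedGT
    (fun E : Subgroup G => E < D ∧ x ∈ normalizer (E : Set G)) ⟨⊥, hDbot, by
      rw [normalizer_eq_top]; exact mem_top x⟩
  have hEmax' : ∀ F : Subgroup G, E ≤ F → F < D → x ∈ normalizer (F : Set G) → F = E :=
    fun F h1 h2 h3 => le_antisymm (hEmax ⟨h2, h3⟩ h1) h1
  have hxCE : x ∈ centralizer (E : Set G) := by
    by_contra h
    exact hED.not_ge (hDmin ⟨hDp.to_le hED.le, hxE, h⟩ hED.le)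
  set C := zpowers x with hC
  obtain ⟨m, hm⟩ := IsPGroup.iff_card.1 hDp
  obtain ⟨e, he⟩ := IsPGroup.iff_card.1 (hDp.to_le hED.le)
  have hCcard : Nat.card C = q ^ b := by rw [hC, Nat.card_zpowers, hxq]
  have hem : e < m := by
    have := card_lt_card_of_subgroup_lt hED
    rwa [hm, he, Nat.pow_lt_pow_iff_right hp.one_lt] at this
  have hb : b ≠ 0 := by
    rintro rfl
    rw [pow_zero, orderOf_eq_one_iff] at hxq
    exact hxC (hxq ▸ one_mem _)
  have hDC := disjoint_of_card_eq_pow hp hq hqp.symm hm hCcard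
  have hEC := disjoint_of_card_eq_pow hp hq hqp.symm he hCcard
  have hcov : E ⊔ C ⋖ D ⊔ C := by
    refine ⟨lt_of_le_of_ne (sup_le_sup_right hED.le _) fun h => ?_, ?_⟩
    · have h1 := card_sup_of_le_normalizer (zpowers_le_normalizer hxD) hDC
      rw [← hC, ← h, card_sup_of_le_normalizer (zpowers_le_normalizer hxE) hEC] at h1
      exact (card_lt_card_of_subgroup_lt hED).ne (Nat.eq_of_mul_eq_mul_right Nat.card_pos h1)
    · intro L hL hL'
      have hxL : x ∈ L := hL.le (mem_sup_right (mem_zpowers x))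
      have hinv : x ∈ normalizer ((L ⊓ D : Subgroup G) : Set G) :=
        inf_normalizer_le_normalizer_inf ⟨le_normalizer hxL, hxD⟩
      rcases (inf_le_right : L ⊓ D ≤ D).eq_or_lt with h | h
      · refine hL'.not_ge (sup_le (inf_eq_right.1 h) ?_)
        rwa [hC, zpowers_le]
      · have h1 := hEmax' _ (le_inf (le_sup_left.trans hL.le) hED.le) h hinv
        refine hL.not_ge fun y hy => ?_
        have hy' : y ∈ ((D ⊔ C : Subgroup G) : Set G) := hL'.le hy
        rw [coe_mul_of_right_le_normalizer_left D C (zpowers_le_normalizer hxD)] at hy'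
        obtain ⟨d, hd, c, hc, rfl⟩ := hy'
        have hcL : c ∈ L := (zpowers_le.2 hxL) hc
        refine mul_mem_sup ?_ hc
        rw [← h1]
        exact ⟨by simpa using L.mul_mem hy (L.inv_mem hcL), hd⟩
  obtain ⟨H, -, hHD, hH⟩ : ∃ K : Subgroup G, ⊥ ≤ K ∧ K ≤ D ∧ Nat.card K = p ^ 1 := by
    obtain ⟨K, hK, -⟩ := Sylow.exists_subgroup_card_pow_prime_le p (m := 1)
      (by rw [hm]; exact pow_dvd_pow p (by omega)) (⊥ : Subgroup D) (n := 0) (by simp) (by omega)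
    exact ⟨K.map D.subtype, bot_le, map_subtype_le K, by
      rw [← hK, card_map_of_injective D.subtype_injective]⟩
  obtain ⟨R, -, hRC, hR⟩ : ∃ K : Subgroup G, ⊥ ≤ K ∧ K ≤ C ∧ Nat.card K = q ^ 1 := by
    obtain ⟨K, hK, -⟩ := Sylow.exists_subgroup_card_pow_prime_le q (m := 1)
      (by rw [hCcard]; exact pow_dvd_pow q (by omega)) (⊥ : Subgroup C) (n := 0) (by simp)
      (by omega)
    exact ⟨K.map C.subtype, bot_le, map_subtype_le K, by
      rw [← hK, card_map_of_injective C.subtype_injective]⟩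
  have c1 := (CovChain.of_card_eq_pow hHD hH hm).trans
    (CovChain.sup_of_le_normalizer (zpowers_le_normalizer hxD) hDC hCcard)
  have hEN : E ≤ normalizer (C : Set G) := by
    refine le_trans ?_ (centralizer_le_normalizer _)
    intro y hy
    rw [mem_centralizer_iff]
    rintro _ ⟨k, rfl⟩
    have h1 : Commute y x := mem_centralizer_iff.1 hxCE y hy
    exact (h1.zpow_right k).eq.symm
  have c2 := (CovChain.of_card_eq_pow hRC hR hCcard).trans
    (CovChain.sup_of_le_normalizer hEN hEC.symm he)
  rw [sup_comm] at c2
  refine ⟨q, hq, ?_, H, R, D ⊔ C, _, _, by simpa using hH, by simpa using hR, c1,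
    c2.trans (.single hcov), by omega, ?_⟩
  · refine dvd_trans ?_ (card_subgroup_dvd_card R)
    rw [hR, pow_one]
  · intro heq
    have hm' : m = e + 1 := by omega
    have hfix : D ⊓ centralizer {x} = E := by
      refine hEmax' _ (le_inf hED.le fun y hy => ?_) ?_ ?_
      · exact mem_centralizer_singleton_iff.2 (mem_centralizer_iff.1 hxCE y hy)
      · refine lt_of_le_of_ne inf_le_left fun h => hxC (mem_centralizer_iff.2 fun y hy => ?_)
        have : y ∈ centralizer {x} := inf_eq_left.1 h hy
        exact mem_centralizer_singleton_iff.1 this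
      · refine inf_normalizer_le_normalizer_inf ⟨hxD, le_normalizer ?_⟩
        exact mem_centralizer_singleton_iff.2 rfl
    have hmod := card_modEq_card_inf_centralizer hxD hxq
    rw [hfix, hm, he, hm'] at hmod
    have h1 : q ∣ p ^ (e + 1) - p ^ e :=
      (Nat.modEq_iff_dvd' (Nat.pow_le_pow_right hp.pos (Nat.le_succ e))).1 hmod.symm
    have h2 : p ^ (e + 1) - p ^ e = p ^ e * (p - 1) := by
      rw [pow_succ, Nat.mul_sub, mul_one]
    rw [h2] at h1
    rcases hq.dvd_mul.1 h1 with h3 | h3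
    · exact absurd ((Nat.prime_dvd_prime_iff_eq hq hp).1 (hq.dvd_of_dvd_pow h3)) hqp
    · have := Nat.le_of_dvd (Nat.sub_pos_of_lt hp.one_lt) h3
      have := hp.one_lt
      omega

theorem exists_forall_covChain_eq [hp : Fact p.Prime]
    (hgood : ∀ H : Subgroup G, Nat.card H = p → AllMaxChainsSameLength H) :
    ∃ r, ∀ H : Subgroup G, Nat.card H = p → ∀ s, CovChain H ⊤ s → s = r := by
  obtain ⟨P⟩ : Nonempty (Sylow p G) := inferInstance
  obtain ⟨l, hl⟩ := CovChain.exists_of_le (le_top : (P : Subgroup G) ≤ ⊤)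
  obtain ⟨a, ha⟩ := IsPGroup.iff_card.1 P.2
  refine ⟨a - 1 + l, fun H hH s hs => ?_⟩
  have hHp : IsPGroup p H := IsPGroup.of_card (n := 1) (by simpa using hH)
  obtain ⟨Q, hQ⟩ := hHp.exists_le_sylow
  obtain ⟨g, rfl⟩ := MulAction.exists_smul_eq G P Q
  have h1 := hl.conj g
  rw [map_top_of_surjective _ (MulAut.conj g).surjective] at h1
  have h2 : Nat.card (g • P : Sylow p G) = p ^ a := by
    rw [← ha]; exact (Nat.card_congr (P.equivSMul g).toEquiv).symm
  exact allMaxChainsSameLength_iff.1 (hgood H hH) _ _ hs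
    ((CovChain.of_card_eq_pow hQ (by rw [hH, pow_one]) h2).trans h1)

/-- A finite nonabelian simple group has a subgroup of prime order with maximal chains of
different lengths. -/
theorem exists_prime_card_not_allMaxChainsSameLength [IsSimpleGroup G]
    (hns : ¬ Group.IsSolvable G) :
    ∃ H : Subgroup G, (Nat.card H).Prime ∧ ¬ AllMaxChainsSameLength H := by
  by_contra! hgood
  have hlen : ∀ p : ℕ, ∃ r, p.Prime →
      ∀ H : Subgroup G, Nat.card H = p → ∀ s, CovChain H ⊤ s → s = r := by
    intro p
    by_cases hp : p.Prime
    · have : Fact p.Prime := ⟨hp⟩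
      obtain ⟨r, hr⟩ := exists_forall_covChain_eq (G := G) (p := p)
        fun H hH => hgood H (hH ▸ hp)
      exact ⟨r, fun _ => hr⟩
    · exact ⟨0, fun h => absurd h hp⟩
  choose l hl using hlen
  have key : ∀ N p, p.Prime → p ∣ Nat.card G → l p * (Nat.card G + 1) + p = N → False := by
    intro N
    induction N using Nat.strong_induction_on with
    | _ N ih =>
      rintro p hp hpG rfl
      obtain ⟨q, hq, hqG, H, R, K, s, t, hH, hR, hHK, hRK, hts, hlt⟩ :=
        exists_covChains_of_dvd_card hns hp hpG
      obtain ⟨u, hu⟩ := CovChain.exists_of_le (le_top : K ≤ ⊤)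
      have h1 := hl p hp H hH _ (hHK.trans hu)
      have h2 := hl q hq R hR _ (hRK.trans hu)
      have hqle := Nat.le_of_dvd Nat.card_pos hqG
      refine ih _ ?_ q hq hqG rfl
      rcases hts.eq_or_lt with h | h
      · have h3 := hlt h
        rw [← h1, ← h2, h]
        omega
      · rw [← h1, ← h2]
        nlinarith
  obtain ⟨p, hp, hpG⟩ := Nat.exists_prime_and_dvd (n := Nat.card G) (by
    intro h
    have := (Nat.card_eq_one_iff_unique.1 h).1
    exact not_nontrivial G IsSimpleGroup.toNontrivial)
  exact key _ p hp hpG rfl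

end PrimeOrder
section SolvablePerm

theorem isSolvable_perm_of_card_eq_four {α : Type*} [Fintype α] [DecidableEq α]
    (h : Nat.card α = 4) : Group.IsSolvable (Equiv.Perm α) := by
  have hA : Group.IsSolvable (alternatingGroup α) := by
    refine ⟨⟨2, ?_⟩⟩
    rw [derivedSeries_succ, derivedSeries_one, ← alternatingGroup.kleinFour_eq_commutator h,
      Subgroup.commutator_eq_bot_iff_le_centralizer]
    have hk := alternatingGroup.kleinFour_isKleinFour h
    intro x hx
    rw [Subgroup.mem_centralizer_iff]
    intro y hy
    exact congrArg Subtype.val (mul_comm_of_exponent_two hk.exponent_two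
      (⟨y, hy⟩ : alternatingGroup.kleinFour α) ⟨x, hx⟩)
  refine Group.isSolvable_of_ker_le_range (alternatingGroup α).subtype Equiv.Perm.sign ?_
  rw [Subgroup.range_subtype, alternatingGroup]

theorem isSolvable_perm_of_card_le_four {α : Type*} [Finite α] (h : Nat.card α ≤ 4) :
    Group.IsSolvable (Equiv.Perm α) := by
  have h4 : Group.IsSolvable (Equiv.Perm (Fin 4)) := isSolvable_perm_of_card_eq_four (by simp)
  have := Fintype.ofFinite α
  rw [Nat.card_eq_fintype_card] at h
  obtain ⟨e⟩ : Nonempty (α ↪ Fin 4) := Function.Embedding.nonempty_of_card_le (by simpa using h)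
  exact Group.isSolvable_of_isSolvable_injective (Equiv.Perm.viaEmbeddingHom_injective e)

end SolvablePerm

section SimpleAction

open MulAction Pointwise

variable {G Y : Type*} [Group G] [IsSimpleGroup G] [MulAction G Y]

theorem hom_apply_eq_one_of_isSolvable {K : Type*} [Group K] [Group.IsSolvable K]
    (hns : ¬ Group.IsSolvable G) (φ : G →* K) (g : G) : φ g = 1 := by
  rcases φ.normal_ker.eq_bot_or_eq_top with h | h
  · exact absurd (Group.isSolvable_of_isSolvable_injective ((MonoidHom.ker_eq_bot_iff φ).1 h)) hns
  · exact MonoidHom.mem_ker.1 (h ▸ Subgroup.mem_top g)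

theorem smul_eq_of_card_le_four (hns : ¬ Group.IsSolvable G) [Finite Y] (h : Nat.card Y ≤ 4)
    (g : G) (y : Y) : g • y = y := by
  have := isSolvable_perm_of_card_le_four h
  simpa using congrArg (· y) (hom_apply_eq_one_of_isSolvable hns (toPermHom G Y) g)

theorem sign_toPerm_eq_one (hns : ¬ Group.IsSolvable G) [Fintype Y] [DecidableEq Y] (g : G) :
    Equiv.Perm.sign (toPermHom G Y g) = 1 :=
  hom_apply_eq_one_of_isSolvable hns (Equiv.Perm.sign.comp (toPermHom G Y)) g

theorem eq_one_of_forall_smul_eq [IsPretransitive G Y] [Nontrivial Y] {g : G}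
    (h : ∀ y : Y, g • y = y) : g = 1 := by
  rcases (toPermHom G Y).normal_ker.eq_bot_or_eq_top with h' | h'
  · refine (MonoidHom.ker_eq_bot_iff _).1 h' (Equiv.ext fun y => ?_)
    simpa using h y
  · obtain ⟨a, b, hab⟩ := exists_pair_ne Y
    obtain ⟨k, hk⟩ := exists_smul_eq G a b
    refine absurd ?_ hab
    have : k ∈ (toPermHom G Y).ker := h' ▸ Subgroup.mem_top k
    rw [← hk]
    simpa using (congrArg (· a) (MonoidHom.mem_ker.1 this)).symm

omit [IsSimpleGroup G] in
/-- The action on the quotient by an invariant equivalence relation. -/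
@[reducible]
def quotientAction (r : Setoid Y) (hr : ∀ (g : G) x y, r x y → r (g • x) (g • y)) :
    MulAction G (Quotient r) where
  smul g := Quotient.map (g • ·) fun x y h => hr g x y h
  one_smul := by
    rintro ⟨y⟩
    exact congrArg (Quotient.mk r) (one_smul G y)
  mul_smul := by
    rintro g h ⟨y⟩
    exact congrArg (Quotient.mk r) (mul_smul g h y)

omit [IsSimpleGroup G] in
theorem mul_card_quotient_le [Fintype Y] [IsPretransitive G Y] (r : Setoid Y)
    (hr : ∀ (g : G) x y, r x y → r (g • x) (g • y)) {a : Y} {S : Finset Y}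
    (hS : ∀ y ∈ S, r a y) : S.card * Nat.card (Quotient r) ≤ Fintype.card Y := by
  choose g hg using fun q : Quotient r => exists_smul_eq G a q.out
  have hcls : ∀ (s : S) (q : Quotient r), Quotient.mk r (g q • (s : Y)) = q := fun s q => by
    rw [← Quotient.out_eq q, Quotient.eq, Quotient.out_eq, ← hg q]
    exact hr _ _ _ (r.symm (hS _ s.2))
  have hinj : Function.Injective fun z : S × Quotient r => g z.2 • (z.1 : Y) := by
    rintro ⟨s, q⟩ ⟨s', q'⟩ h
    have hq : q = q' := by
      rw [← hcls s q, ← hcls s' q']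
      exact congrArg _ h
    subst hq
    exact Prod.ext (Subtype.ext (smul_left_cancel _ h)) rfl
  simpa [Nat.card_prod] using Nat.card_le_card_of_injective _ hinj

theorem rel_total_of_card_quotient_le_four (hns : ¬ Group.IsSolvable G) [Finite Y]
    [IsPretransitive G Y] (r : Setoid Y) (hr : ∀ (g : G) x y, r x y → r (g • x) (g • y))
    (h : Nat.card (Quotient r) ≤ 4) (x y : Y) : r x y := by
  let _ := quotientAction r hr
  obtain ⟨g, rfl⟩ := exists_smul_eq G x y
  exact Quotient.exact (smul_eq_of_card_le_four hns h g (Quotient.mk r x)).symm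

/-- On at most `14` points, an invariant equivalence relation with a class of size at least `3`
is total. -/
theorem rel_total_of_three_le (hns : ¬ Group.IsSolvable G) [Fintype Y] [IsPretransitive G Y]
    (hY : Fintype.card Y ≤ 14) (r : Setoid Y) (hr : ∀ (g : G) x y, r x y → r (g • x) (g • y))
    {a : Y} {S : Finset Y} (hS : ∀ y ∈ S, r a y) (h3 : 3 ≤ S.card) (x y : Y) : r x y := by
  classical
  refine rel_total_of_card_quotient_le_four hns r hr ?_ x y
  have := mul_card_quotient_le r hr hS
  nlinarith

/-- An element fixing a point and its two neighbours in an invariant graph of valency two is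
trivial. -/
theorem eq_one_of_smul_eq_of_valency_two (hns : ¬ Group.IsSolvable G) [Fintype Y]
    [IsPretransitive G Y] [Nontrivial Y] (hY : Fintype.card Y ≤ 14) (R : Y → Y → Prop)
    (hsymm : ∀ x y, R x y → R y x) (hirr : ∀ x, ¬ R x x)
    (hR : ∀ (g : G) x y, R x y → R (g • x) (g • y)) {y₀ a b : Y} (hab : a ≠ b)
    (hy : ∀ z, R y₀ z ↔ z = a ∨ z = b) {g : G} (hg : g • y₀ = y₀) (hga : g • a = a)
    (hgb : g • b = b) : g = 1 := by
  classical
  let r : Setoid Y := Relation.EqvGen.setoid R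
  have hr : ∀ (g : G) x y, r x y → r (g • x) (g • y) := by
    intro g x y h
    induction h with
    | rel x y h => exact .rel _ _ (hR g x y h)
    | refl x => exact .refl _
    | symm x y _ ih => exact .symm _ _ ih
    | trans x y z _ _ h1 h2 => exact .trans _ _ _ h1 h2
  have hya : R y₀ a := (hy a).2 (Or.inl rfl)
  have hyb : R y₀ b := (hy b).2 (Or.inr rfl)
  have h1 : y₀ ≠ a := fun h => hirr y₀ (h ▸ hya)
  have h2 : y₀ ≠ b := fun h => hirr y₀ (h ▸ hyb)
  have htot := rel_total_of_three_le hns hY r hr (a := y₀) (S := {y₀, a, b})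
    (by
      intro y hy'
      simp only [Finset.mem_insert, Finset.mem_singleton] at hy'
      rcases hy' with rfl | rfl | rfl
      · exact .refl _
      · exact .rel _ _ hya
      · exact .rel _ _ hyb)
    (by rw [Finset.card_eq_three.2 ⟨y₀, a, b, h1, h2, hab, rfl⟩])
  have hnb : ∀ x, ∃ u v, u ≠ v ∧ ∀ z, R x z ↔ z = u ∨ z = v := by
    intro x
    obtain ⟨k, rfl⟩ := exists_smul_eq G y₀ x
    refine ⟨k • a, k • b, fun h => hab (smul_left_cancel k h), fun z => ⟨fun h => ?_, ?_⟩⟩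
    · have := hR k⁻¹ _ _ h
      rwa [inv_smul_smul, hy, inv_smul_eq_iff, inv_smul_eq_iff] at this
    · rintro (rfl | rfl)
      · exact hR k _ _ hya
      · exact hR k _ _ hyb
  let P : Y → Prop := fun x => g • x = x ∧ ∀ z, R x z → g • z = z
  have hstep : ∀ x y, R x y → P x → P y := by
    rintro x y hxy ⟨hx, hx'⟩
    refine ⟨hx' y hxy, fun w hyw => ?_⟩
    obtain ⟨u, v, huv, hnv⟩ := hnb y
    have hgw : R y (g • w) := by simpa [hx' y hxy] using hR g _ _ hyw
    have hyx := hsymm _ _ hxy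
    by_cases hwx : w = x
    · rw [hwx, hx]
    · have : g • w ≠ x := fun h => hwx (smul_left_cancel g (h.trans hx.symm))
      rw [hnv] at hgw hyx hyw
      grind
  have hP : ∀ x y, r x y → (P x ↔ P y) := by
    intro x y h
    induction h with
    | rel x y h => exact ⟨hstep x y h, hstep y x (hsymm _ _ h)⟩
    | refl x => rfl
    | symm x y _ ih => exact ih.symm
    | trans x y z _ _ h1 h2 => exact h1.trans h2
  have hP₀ : P y₀ := ⟨hg, fun z hz => by
    rcases (hy z).1 hz with rfl | rfl
    · exact hga
    · exact hgb⟩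
  exact eq_one_of_forall_smul_eq fun y => ((hP _ _ (htot y₀ y)).1 hP₀).1

end SimpleAction

section PrimePower

open MulAction

variable {G Y : Type*} [Group G] [MulAction G Y]

theorem card_modEq_card_filter {p n : ℕ} [Fact p.Prime] {K : Subgroup G}
    (hK : Nat.card K = p ^ n) (S : Finset Y) (hS : ∀ k ∈ K, ∀ y ∈ S, k • y ∈ S)
    [DecidablePred fun y : Y => ∀ k ∈ K, k • y = y] :
    S.card ≡ (S.filter fun y => ∀ k ∈ K, k • y = y).card [MOD p] := by
  let _ : MulAction K S :=
    { smul := fun k y => ⟨(k : G) • (y : Y), hS k k.2 y y.2⟩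
      one_smul := fun y => Subtype.ext (one_smul G (y : Y))
      mul_smul := fun k l y => Subtype.ext (mul_smul (k : G) (l : G) (y : Y)) }
  have : Finite K := Nat.finite_of_card_ne_zero (by
    rw [hK]; exact pow_ne_zero _ (Fact.out : p.Prime).ne_zero)
  have h := (IsPGroup.of_card hK).card_modEq_card_fixedPoints S
  rw [Nat.card_eq_fintype_card, Fintype.card_coe] at h
  rw [← Fintype.card_coe (S.filter _), ← Nat.card_eq_fintype_card (α := S.filter _)]
  refine h.trans (congrArg (· % p) ?_)
  refine Nat.card_congr
    { toFun := fun y => ⟨y.1.1, Finset.mem_filter.2 ⟨y.1.2, fun k hk =>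
        congrArg Subtype.val (y.2 ⟨k, hk⟩)⟩⟩
      invFun := fun y => ⟨⟨y.1, (Finset.mem_filter.1 y.2).1⟩, fun k =>
        Subtype.ext ((Finset.mem_filter.1 y.2).2 k k.2)⟩
      left_inv := fun _ => rfl
      right_inv := fun _ => rfl }

/-- A subgroup of prime order containing a nontrivial element of `L` is contained in `L`. -/
theorem le_of_prime_card {p : ℕ} (hp : p.Prime) {K L : Subgroup G} (hK : Nat.card K = p) {k : G}
    (hk : k ∈ K) (h1 : k ≠ 1) (hL : k ∈ L) : K ≤ L := by
  have : Fact (Nat.card K).Prime := ⟨hK ▸ hp⟩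
  rcases (L.subgroupOf K).eq_bot_or_eq_top_of_prime_card with h | h
  · have : (⟨k, hk⟩ : K) ∈ L.subgroupOf K := hL
    rw [h, Subgroup.mem_bot] at this
    exact absurd (congrArg Subtype.val this) h1
  · exact Subgroup.subgroupOf_eq_top.1 h

/-- A subgroup of prime order acting without fixed points on an invariant set with as many elements
is transitive there. -/
theorem exists_smul_eq_of_card_le {p : ℕ} (hp : p.Prime) {K : Subgroup G}
    (hK : Nat.card K = p) {S : Finset Y} (hS : ∀ k ∈ K, ∀ y ∈ S, k • y ∈ S) (hc : S.card ≤ p)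
    {a : Y} (ha : a ∈ S) (hfix : ∃ k ∈ K, k • a ≠ a) {b : Y} (hb : b ∈ S) :
    ∃ k ∈ K, k • a = b := by
  have : Finite K := Nat.finite_of_card_ne_zero (by rw [hK]; exact hp.ne_zero)
  have hinj : Function.Injective fun k : K => (⟨(k : G) • a, hS k k.2 a ha⟩ : S) := by
    intro k l h
    by_contra hkl
    obtain ⟨m, hm, hma⟩ := hfix
    refine hma (le_of_prime_card hp hK (L := stabilizer G a) (mul_mem (inv_mem l.2) k.2)
      (fun h1 => hkl (Subtype.ext (inv_mul_eq_one.1 h1).symm)) ?_ hm)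
    have h' : (k : G) • a = (l : G) • a := congrArg Subtype.val h
    rw [mem_stabilizer_iff, mul_smul, h', inv_smul_smul]
  have hbij := hinj.bijective_of_nat_card_le (by simpa [hK] using hc)
  obtain ⟨k, hk⟩ := hbij.2 ⟨b, hb⟩
  exact ⟨k, k.2, congrArg Subtype.val hk⟩

end PrimePower

/-- A faithful copy of a conjugacy class of subgroups of prime order. -/
structure SmallPrimeClass (G X : Type*) [Group G] [MulAction G X] [Fintype X] (q : ℕ) where
  H : X → Subgroup G
  prime : q.Prime
  card_H : ∀ x, Nat.card (H x) = q
  mem_smul : ∀ (g : G) x k, k ∈ H (g • x) ↔ g⁻¹ * k * g ∈ H x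
  inj : ∀ x y, H x = H y → x = y
  not_solvable : ¬ Group.IsSolvable G
  card_le : Fintype.card X ≤ 14

namespace SmallPrimeClass

open MulAction

variable {G X : Type*} [Group G] [MulAction G X] [Fintype X] {q : ℕ} (C : SmallPrimeClass G X q)

/-- Two members of the class commute. -/
def Com (x y : X) : Prop := ∀ k ∈ C.H x, k • y = y

theorem finite_H (x : X) : Finite (C.H x) :=
  Nat.finite_of_card_ne_zero (by rw [C.card_H]; exact C.prime.ne_zero)

theorem conj_mem (g : G) {x : X} {k : G} (hk : k ∈ C.H x) : g * k * g⁻¹ ∈ C.H (g • x) := by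
  rw [C.mem_smul]
  simpa [mul_assoc] using hk

theorem smul_eq_iff (g : G) (x y : X) : g • x = y ↔ ∀ k ∈ C.H x, g * k * g⁻¹ ∈ C.H y := by
  refine ⟨fun h k hk => h ▸ C.conj_mem g hk, fun h => C.inj _ _ ?_⟩
  have := C.finite_H
  refine Subgroup.eq_of_le_of_card_ge (fun k hk => ?_) (by rw [C.card_H, C.card_H])
  rw [C.mem_smul] at hk
  simpa [mul_assoc] using h _ hk

theorem com_refl (x : X) : C.Com x x := fun k hk => by
  rw [C.smul_eq_iff]
  exact fun l hl => mul_mem (mul_mem hk hl) (inv_mem hk)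

theorem com_of_smul_eq {x y : X} {k : G} (hk : k ∈ C.H x) (h1 : k ≠ 1) (hy : k • y = y) :
    C.Com x y :=
  fun _ hl => le_of_prime_card C.prime (C.card_H x) (L := stabilizer G y) hk h1 hy hl

theorem com_smul (g : G) {x y : X} (h : C.Com x y) : C.Com (g • x) (g • y) := by
  intro k hk
  rw [C.mem_smul] at hk
  have := h _ hk
  rwa [mul_smul, mul_smul, inv_smul_eq_iff] at this

theorem com_smul_iff (g : G) {x y : X} : C.Com (g • x) (g • y) ↔ C.Com x y :=
  ⟨fun h => by simpa using C.com_smul g⁻¹ h, C.com_smul g⟩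

section

variable [Finite G]

theorem com_iff (x y : X) : C.Com x y ↔ ∀ k ∈ C.H x, ∀ l ∈ C.H y, k * l = l * k := by
  constructor
  · intro h k hk l hl
    by_cases h1 : k = 1
    · rw [h1, one_mul, mul_one]
    have hkn : k ∈ Subgroup.normalizer (C.H y : Set G) := by
      refine Subgroup.mem_normalizer_iff.2 fun m => ?_
      have := C.mem_smul k y (k * m * k⁻¹)
      rw [h k hk] at this
      simpa [mul_assoc] using this.symm
    have := Fact.mk C.prime
    have hkq : orderOf k = q ^ 1 := by
      rw [pow_one, ← Nat.card_zpowers, ← C.card_H x]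
      congr 2
      exact le_antisymm (Subgroup.zpowers_le.2 hk)
        (le_of_prime_card C.prime (C.card_H x) hk h1 (Subgroup.mem_zpowers k))
    have hmod := card_modEq_card_inf_centralizer hkn hkq
    have hle : C.H y ≤ Subgroup.centralizer {k} := by
      have := C.finite_H y
      refine inf_eq_left.1 (Subgroup.eq_of_le_of_card_ge inf_le_left ?_)
      rw [C.card_H] at hmod ⊢
      refine Nat.le_of_dvd Nat.card_pos ?_
      rw [← Nat.modEq_zero_iff_dvd]
      exact hmod.symm.trans (by simp)
    exact (Subgroup.mem_centralizer_singleton_iff.1 (hle hl)).symm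
  · intro h k hk
    rw [C.smul_eq_iff]
    intro l hl
    rw [h k hk l hl, mul_inv_cancel_right]
    exact hl

variable {C}

theorem Com.symm {x y : X} (h : C.Com x y) : C.Com y x := by
  rw [com_iff] at h ⊢
  exact fun k hk l hl => (h l hl k hk).symm

variable (C)
theorem com_comm {x y : X} : C.Com x y ↔ C.Com y x := ⟨Com.symm, Com.symm⟩

end

open Classical in
/-- The members of the class commuting with a given one. -/
noncomputable def Z (x : X) : Finset X := {y | C.Com x y}

@[simp]
theorem mem_Z {x y : X} : y ∈ C.Z x ↔ C.Com x y := by simp [Z]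

section General

open scoped Classical Pointwise

theorem mem_Z_smul (g : G) {x y : X} : g • y ∈ C.Z (g • x) ↔ y ∈ C.Z x := by
  rw [mem_Z, mem_Z, com_smul_iff]

theorem Z_smul (g : G) (x : X) : C.Z (g • x) = g • C.Z x := by
  ext y
  rw [← Finset.inv_smul_mem_iff, ← C.mem_Z_smul g (x := x), smul_inv_smul]

theorem exists_mem_ne_one (x : X) : ∃ k ∈ C.H x, k ≠ 1 := by
  by_contra! h
  have h1 := C.card_H x
  rw [(Subgroup.eq_bot_iff_forall _).2 h, Subgroup.card_bot] at h1
  exact C.prime.ne_one h1.symm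

variable [IsSimpleGroup G] [IsPretransitive G X]

omit [IsPretransitive G X] in
theorem eq_top_of_forall_H_le [Nonempty X] {K : Subgroup G} (hK : ∀ x, C.H x ≤ K) : K = ⊤ := by
  let L : Subgroup G := ⨆ x, C.H x
  have hL : L.Normal := by
    refine ⟨fun n hn g => ?_⟩
    refine Subgroup.iSup_induction (fun x => C.H x) (C := fun n => g * n * g⁻¹ ∈ L) hn
      (fun x k hk => Subgroup.mem_iSup_of_mem (g • x) (C.conj_mem g hk)) (by simp) ?_
    intro a b ha hb
    simpa [mul_assoc] using mul_mem ha hb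
  rcases hL.eq_bot_or_eq_top with h | h
  · obtain ⟨x⟩ := ‹Nonempty X›
    have h1 : C.H x ≤ ⊥ := h ▸ le_iSup (fun x => C.H x) x
    have h2 := C.card_H x
    rw [le_bot_iff.1 h1, Subgroup.card_bot] at h2
    exact absurd h2.symm C.prime.ne_one
  · exact top_le_iff.1 (h ▸ iSup_le hK)

include C in
omit [IsPretransitive G X] in
theorem nontrivial [Nonempty X] : Nontrivial X := by
  by_contra hX
  rw [not_nontrivial_iff_subsingleton] at hX
  obtain ⟨x⟩ := ‹Nonempty X›
  have h := C.eq_top_of_forall_H_le (K := C.H x) fun y => by rw [Subsingleton.elim y x]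
  have := Fact.mk C.prime
  have hc : IsCyclic G := isCyclic_of_prime_card (p := q)
      (by rw [← C.card_H x, h, Subgroup.card_top])
  exact C.not_solvable (Group.isSolvable_of_comm hc.isMulCommutative.is_comm.comm)

include C in
theorem five_le_card [Nonempty X] : 5 ≤ Fintype.card X := by
  by_contra! h
  have := C.nontrivial
  obtain ⟨g, hg⟩ := exists_ne (1 : G)
  exact hg (eq_one_of_forall_smul_eq (Y := X) fun y =>
    smul_eq_of_card_le_four C.not_solvable (by simpa using Nat.le_of_lt_succ h) g y)

/-- The noncommuting graph is connected. -/
theorem mem_of_com_compl [Finite G] {S : Set X} (hne : S.Nonempty)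
    (hS : ∀ s ∈ S, ∀ u ∉ S, C.Com s u) (x : X) :
    x ∈ S := by
  have : Nonempty X := ⟨x⟩
  have h := C.eq_top_of_forall_H_le (K := stabilizer G S) fun y => by
    rw [le_stabilizer_iff_smul_le]
    rintro k hk _ ⟨s, hs, rfl⟩
    by_cases hy : y ∈ S
    · by_contra hu
      have h1 : k • s = s := smul_left_cancel k (hS y hy _ hu k hk)
      exact hu (by simpa [h1] using hs)
    · simpa [(hS s hs y hy).symm k hk] using hs
  obtain ⟨s, hs⟩ := hne
  obtain ⟨g, rfl⟩ := exists_smul_eq G s x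
  have hg : g ∈ stabilizer G S := h ▸ Subgroup.mem_top g
  rw [← mem_stabilizer_iff.1 hg]
  exact Set.smul_mem_smul_set hs

theorem exists_not_com (x : X) : ∃ y, ¬ C.Com x y := by
  by_contra! h
  have : Nonempty X := ⟨x⟩
  have := C.nontrivial
  obtain ⟨k, hk, h1⟩ := C.exists_mem_ne_one x
  exact h1 (eq_one_of_forall_smul_eq fun y => h y k hk)

omit [IsSimpleGroup G] in
theorem card_Z_eq (x y : X) : (C.Z x).card = (C.Z y).card := by
  obtain ⟨g, rfl⟩ := exists_smul_eq G x y
  rw [Z_smul, Finset.card_smul_finset]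

theorem twin_le_two {x a b : X} (ha : C.Z x = C.Z a) (hb : C.Z x = C.Z b) (hxa : x ≠ a)
    (hxb : x ≠ b) (hab : a ≠ b) : False := by
  have := rel_total_of_three_le C.not_solvable C.card_le (Setoid.ker C.Z)
    (fun g u v h => by
      rw [Setoid.ker_def] at h ⊢
      rw [Z_smul, Z_smul, h]) (a := x) (S := {x, a, b})
    (by
      intro y hy
      rw [Setoid.ker_def]
      grind)
    (by rw [Finset.card_eq_three.2 ⟨x, a, b, hxa, hxb, hab, rfl⟩]) x
  obtain ⟨y, hy⟩ := C.exists_not_com x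
  rw [← mem_Z, Setoid.ker_def.1 (this y)] at hy
  exact hy (C.mem_Z.2 (C.com_refl y))

omit [IsSimpleGroup G] [IsPretransitive G X] in
theorem card_modEq_card_inter_Z (x : X) {S : Finset X} (hS : ∀ k ∈ C.H x, ∀ y ∈ S, k • y ∈ S) :
    S.card ≡ (S ∩ C.Z x).card [MOD q] := by
  have := Fact.mk C.prime
  have h := card_modEq_card_filter (K := C.H x) (n := 1) (by rw [C.card_H, pow_one]) S hS
  rwa [show (S.filter fun y => ∀ k ∈ C.H x, k • y = y) = S ∩ C.Z x by
    ext y; simp [Com]] at h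

omit [IsSimpleGroup G] [IsPretransitive G X] in
theorem dvd_card_of_disjoint (x : X) {S : Finset X} (hS : ∀ k ∈ C.H x, ∀ y ∈ S, k • y ∈ S)
    (hd : ∀ y ∈ S, ¬ C.Com x y) : q ∣ S.card := by
  have h := C.card_modEq_card_inter_Z x hS
  rw [Finset.card_eq_zero (s := S ∩ C.Z x).2 (Finset.eq_empty_of_forall_notMem fun y hy => by
    rw [Finset.mem_inter, mem_Z] at hy
    exact hd y hy.1 hy.2)] at h
  exact (Nat.modEq_zero_iff_dvd).1 h

omit [IsSimpleGroup G] [IsPretransitive G X] in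
theorem smul_mem_Z_iff {x c y : X} (h : C.Com x c) {k : G} (hk : k ∈ C.H x) :
    k • y ∈ C.Z c ↔ y ∈ C.Z c := by
  conv_lhs => rw [← h k hk]
  rw [mem_Z_smul]

omit [IsSimpleGroup G] [IsPretransitive G X] in
theorem dvd_card_compl (x : X) : q ∣ Fintype.card X - (C.Z x).card := by
  rw [← Finset.card_compl]
  refine C.dvd_card_of_disjoint x (fun k hk y hy => ?_) fun y hy => by simpa using hy
  rw [Finset.mem_compl, C.smul_mem_Z_iff (C.com_refl x) hk]
  exact Finset.mem_compl.1 hy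

theorem card_Z_le_two_of_forall_twin (x : X) (h : ∀ c, C.Com x c → C.Z c = C.Z x) :
    (C.Z x).card ≤ 2 := by
  by_contra! h3
  obtain ⟨a, b, c, ha, hb, hc, hab, hac, hbc⟩ := Finset.two_lt_card_iff.1 h3
  have hZ : ∀ y ∈ C.Z x, C.Z a = C.Z y := fun y hy => by
    rw [h a (C.mem_Z.1 ha), h y (C.mem_Z.1 hy)]
  exact C.twin_le_two (hZ b hb) (hZ c hc) hab hac hbc

theorem card_Z_le_two [Finite G] (x : X) (hf : (C.Z x).card ≤ q + 1) : (C.Z x).card ≤ 2 := by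
  refine C.card_Z_le_two_of_forall_twin x fun c hc => ?_
  have hmod := C.card_modEq_card_inter_Z c (S := C.Z x)
    fun k hk y hy => (C.smul_mem_Z_iff hc.symm hk).2 hy
  have h2 : 2 ≤ (C.Z x ∩ C.Z c).card ∨ x = c := by
    by_cases hxc : x = c
    · exact .inr hxc
    · left
      rw [← Finset.card_pair hxc]
      refine Finset.card_le_card fun y hy => ?_
      simp only [Finset.mem_insert, Finset.mem_singleton] at hy
      rcases hy with rfl | rfl
      · simpa using ⟨C.com_refl _, hc.symm⟩
      · simpa using ⟨hc, C.com_refl _⟩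
  rcases h2 with h2 | rfl
  · have hle : (C.Z x ∩ C.Z c).card ≤ (C.Z x).card := Finset.card_le_card Finset.inter_subset_left
    have h1 : q ∣ (C.Z x).card - (C.Z x ∩ C.Z c).card := (Nat.modEq_iff_dvd' hle).1 hmod.symm
    have h3 : (C.Z x).card ≤ (C.Z x ∩ C.Z c).card := by
      rcases Nat.eq_zero_or_pos ((C.Z x).card - (C.Z x ∩ C.Z c).card) with h | h
      · omega
      · have := Nat.le_of_dvd h h1
        omega
    have h4 := Finset.eq_of_subset_of_card_le Finset.inter_subset_left h3
    exact (Finset.eq_of_subset_of_card_le (Finset.inter_eq_left.1 h4) (C.card_Z_eq c x).le).symm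
  · rfl

omit [IsSimpleGroup G] in
/-- Two commuting members of the class with different centralisers. -/
theorem card_compl_inter_compl [Finite G] {x c : X} (hc : C.Com x c) (hZ : C.Z c ≠ C.Z x) :
    q ∣ ((C.Z c)ᶜ ∩ (C.Z x)ᶜ).card ∧ q ∣ (C.Z c ∩ (C.Z x)ᶜ).card ∧ 0 < (C.Z c ∩ (C.Z x)ᶜ).card ∧
      ((C.Z c)ᶜ ∩ (C.Z x)ᶜ).card + (C.Z c ∩ (C.Z x)ᶜ).card = (C.Z x)ᶜ.card ∧
      (C.Z c ∩ (C.Z x)ᶜ).card + (C.Z c ∩ C.Z x).card = (C.Z x).card ∧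
      2 ≤ (C.Z c ∩ C.Z x).card := by
  have hxc : x ≠ c := fun h => hZ (h ▸ rfl)
  refine ⟨?_, ?_, ?_, ?_, ?_, ?_⟩
  · refine C.dvd_card_of_disjoint x (fun k hk y hy => ?_) fun y hy => by simp_all
    simp only [Finset.mem_inter, Finset.mem_compl] at hy ⊢
    rwa [C.smul_mem_Z_iff hc hk, C.smul_mem_Z_iff (C.com_refl x) hk]
  · refine C.dvd_card_of_disjoint x (fun k hk y hy => ?_) fun y hy => by simp_all
    simp only [Finset.mem_inter, Finset.mem_compl] at hy ⊢
    rwa [C.smul_mem_Z_iff hc hk, C.smul_mem_Z_iff (C.com_refl x) hk]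
  · rw [Finset.card_pos]
    by_contra! h
    refine hZ (Finset.eq_of_subset_of_card_le (fun y hy => ?_) (C.card_Z_eq x c).le)
    by_contra hy'
    exact Finset.notMem_empty y (h ▸ Finset.mem_inter.2 ⟨hy, Finset.mem_compl.2 hy'⟩)
  · rw [← Finset.card_union_of_disjoint
      (Disjoint.mono Finset.inter_subset_left Finset.inter_subset_left disjoint_compl_left),
      ← Finset.union_inter_distrib_right, Finset.union_comm, Finset.union_compl,
      Finset.univ_inter]
  · rw [← C.card_Z_eq c x, ← Finset.card_union_of_disjoint
      (Disjoint.mono Finset.inter_subset_right Finset.inter_subset_right disjoint_compl_left),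
      ← Finset.inter_union_distrib_left, Finset.union_comm, Finset.union_compl,
      Finset.inter_univ]
  · rw [← Finset.card_pair hxc]
    refine Finset.card_le_card fun y hy => ?_
    simp only [Finset.mem_insert, Finset.mem_singleton] at hy
    rcases hy with rfl | rfl
    · simpa using ⟨hc.symm, C.com_refl _⟩
    · simpa using ⟨C.com_refl _, hc⟩

theorem exists_compl_inter_compl_nonempty [Finite G] {x : X} (hf : 3 ≤ (C.Z x).card) :
    ∃ c, C.Com x c ∧ C.Z c ≠ C.Z x ∧ ((C.Z c)ᶜ ∩ (C.Z x)ᶜ).Nonempty := by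
  by_contra! h
  have hall : ∀ y c, C.Com y c → C.Z c ≠ C.Z y → ∀ w, C.Com y w ∨ C.Com c w := by
    intro y c hyc hZ w
    obtain ⟨g, rfl⟩ := exists_smul_eq G x y
    have h1 := h (g⁻¹ • c) (by rw [← C.com_smul_iff g, smul_inv_smul]; exact hyc) (fun he => hZ (by
      rw [← smul_inv_smul g c, Z_smul, he, Z_smul]))
    by_contra! hw
    refine Finset.notMem_empty (g⁻¹ • w) (h1 ▸ ?_)
    rw [Finset.mem_inter, Finset.mem_compl, Finset.mem_compl, ← C.mem_Z_smul g,
      ← C.mem_Z_smul g (x := x), smul_inv_smul, smul_inv_smul]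
    simpa using hw.symm
  refine absurd (C.card_Z_le_two_of_forall_twin x fun c hc => ?_) (by omega)
  by_contra hcZ
  have hconn := C.mem_of_com_compl (S := {y | ¬ C.Com x y ∨ C.Z y = C.Z x}) ⟨x, .inr rfl⟩ (by
    rintro s hs u hu
    simp only [Set.mem_ofPred_eq, not_or, not_not] at hs hu
    rcases hs with hs | hs
    · exact ((hall x u hu.1 hu.2 s).resolve_left hs).symm
    · have : u ∈ C.Z s := by rw [hs, mem_Z]; exact hu.1
      exact C.mem_Z.1 this) c
  rcases hconn with h1 | h1
  · exact h1 hc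
  · exact hcZ h1

omit [IsSimpleGroup G] [IsPretransitive G X] in
theorem smul_ne_of_not_com {x y : X} {k : G} (hk : k ∈ C.H x) (h1 : k ≠ 1) (h : ¬ C.Com x y) :
    k • y ≠ y :=
  fun hy => h (C.com_of_smul_eq hk h1 hy)

omit [IsSimpleGroup G] [IsPretransitive G X] in
theorem erase_Z_smul (g : G) (x : X) : (C.Z (g • x)).erase (g • x) = g • (C.Z x).erase x := by
  ext y
  rw [← Finset.inv_smul_mem_iff, Finset.mem_erase, Finset.mem_erase, Z_smul,
    ← Finset.inv_smul_mem_iff, Ne, Ne, inv_smul_eq_iff]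

theorem eq_of_erase_Z_eq [Finite G] {x a : X} (hf : 2 ≤ (C.Z x).card)
    (h : (C.Z x).erase x = (C.Z a).erase a) : x = a := by
  by_contra hxa
  by_cases hc : C.Com x a
  · have : a ∈ (C.Z a).erase a := h ▸ Finset.mem_erase.2 ⟨Ne.symm hxa, C.mem_Z.2 hc⟩
    exact Finset.notMem_erase a _ this
  · obtain ⟨k, hk, h1⟩ := C.exists_mem_ne_one x
    have hka := C.smul_ne_of_not_com hk h1 hc
    have hkx : k • x = x := C.com_refl x k hk
    have hk' : (C.Z x).erase x = (C.Z (k • a)).erase (k • a) := by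
      rw [erase_Z_smul, ← h, ← erase_Z_smul, hkx]
    have htot := rel_total_of_three_le C.not_solvable C.card_le
      (Setoid.ker fun y => (C.Z y).erase y)
      (fun g u v huv => by
        rw [Setoid.ker_def] at huv ⊢
        rw [erase_Z_smul, erase_Z_smul, huv]) (a := x) (S := {x, a, k • a})
      (by
        intro y hy
        rw [Setoid.ker_def]
        grind)
      (by
        rw [Finset.card_eq_three.2 ⟨x, a, k • a, hxa, fun he => hxa ?_, Ne.symm hka, rfl⟩]
        exact smul_left_cancel k (hkx.trans he)) x
    obtain ⟨c, hc⟩ : ((C.Z x).erase x).Nonempty := by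
      rw [← Finset.card_pos, Finset.card_erase_of_mem (C.mem_Z.2 (C.com_refl x))]
      omega
    have hc' := Setoid.ker_def.1 (htot c)
    rw [hc'] at hc
    exact Finset.notMem_erase c _ hc

/-- The members of the class not commuting with `x`, when no two members of the class commuting
with `x` commute. -/
theorem card_inter_Z_of_forall_card_eq_two [Finite G] {x : X} (hf : 2 ≤ (C.Z x).card)
    (h2 : ∀ c ∈ (C.Z x).erase x, (C.Z c ∩ C.Z x).card = 2) :
    (∀ u ∈ (C.Z x)ᶜ, ((C.Z u ∩ C.Z x).card = 0 ∨ (C.Z u ∩ C.Z x).card ≡ 1 [MOD q]) ∧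
      (C.Z u ∩ C.Z x).card + 2 ≤ (C.Z x).card) ∧
    ∑ u ∈ (C.Z x)ᶜ, (C.Z u ∩ C.Z x).card = ((C.Z x).card - 1) * ((C.Z x).card - 2) := by
  have hcx : ∀ c ∈ (C.Z x).erase x, C.Z c ∩ C.Z x = {c, x} := by
    intro c hc
    have hc' := Finset.mem_erase.1 hc
    refine (Finset.eq_of_subset_of_card_le ?_ ?_).symm
    · intro y hy
      simp only [Finset.mem_insert, Finset.mem_singleton] at hy
      rcases hy with rfl | rfl
      · exact Finset.mem_inter.2 ⟨C.mem_Z.2 (C.com_refl _), hc'.2⟩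
      · exact Finset.mem_inter.2 ⟨C.mem_Z.2 (C.mem_Z.1 hc'.2).symm, C.mem_Z.2 (C.com_refl _)⟩
    · rw [h2 c hc, Finset.card_pair hc'.1]
  refine ⟨fun u hu => ⟨?_, ?_⟩, ?_⟩
  · rcases Finset.eq_empty_or_nonempty (C.Z u ∩ C.Z x) with h | ⟨c, hc⟩
    · exact .inl (by rw [h, Finset.card_empty])
    · right
      have hc' := Finset.mem_inter.1 hc
      have hux := Finset.mem_compl.1 hu
      have hcx' : c ≠ x := fun h => hux (C.mem_Z.2 (C.mem_Z.1 (h ▸ hc'.1)).symm)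
      refine (C.card_modEq_card_inter_Z c (fun k hk y hy => ?_)).trans ?_
      · rw [Finset.mem_inter] at hy ⊢
        rwa [C.smul_mem_Z_iff (C.mem_Z.1 hc'.1).symm hk, C.smul_mem_Z_iff (C.mem_Z.1 hc'.2).symm hk]
      · rw [Finset.inter_assoc, Finset.inter_comm (C.Z x),
          hcx c (Finset.mem_erase.2 ⟨hcx', hc'.2⟩)]
        rw [show C.Z u ∩ {c, x} = {c} by
          ext y
          simp only [Finset.mem_inter, Finset.mem_insert, Finset.mem_singleton]
          constructor
          · rintro ⟨h1, rfl | rfl⟩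
            · rfl
            · exact absurd (C.mem_Z.2 (C.mem_Z.1 h1).symm) hux
          · rintro rfl
            exact ⟨hc'.1, .inl rfl⟩]
        rfl
  · have hux := Finset.mem_compl.1 hu
    have hxu : x ∉ C.Z u := fun h => hux (C.mem_Z.2 (C.mem_Z.1 h).symm)
    have hsub : C.Z u ∩ C.Z x ⊆ (C.Z x).erase x := fun y hy => by
      rw [Finset.mem_inter] at hy
      exact Finset.mem_erase.2 ⟨fun h => hxu (h ▸ hy.1), hy.2⟩
    have hcard := Finset.card_erase_of_mem (C.mem_Z.2 (C.com_refl x))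
    by_contra! hlt
    have heq := Finset.eq_of_subset_of_card_le hsub (by omega)
    have hsub' : (C.Z x).erase x ⊆ (C.Z u).erase u := fun y hy => by
      have h1 := heq ▸ hy
      rw [Finset.mem_inter] at h1
      exact Finset.mem_erase.2 ⟨fun h => hux (h ▸ h1.2), h1.1⟩
    have := C.eq_of_erase_Z_eq hf (Finset.eq_of_subset_of_card_le hsub' (by
      rw [Finset.card_erase_of_mem (C.mem_Z.2 (C.com_refl x)),
        Finset.card_erase_of_mem (C.mem_Z.2 (C.com_refl u)), C.card_Z_eq u x]))
    exact hux (this ▸ C.mem_Z.2 (C.com_refl x))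
  · have hdc := Finset.sum_card_bipartiteAbove_eq_sum_card_bipartiteBelow (s := (C.Z x)ᶜ)
      (t := C.Z x) C.Com
    have h1 : ∀ u, (C.Z x).bipartiteAbove C.Com u = C.Z u ∩ C.Z x := fun u => by
      ext y
      simp [Finset.bipartiteAbove, and_comm]
    have h3 : ∀ c, (C.Z x)ᶜ.bipartiteBelow C.Com c = C.Z c ∩ (C.Z x)ᶜ := fun u => by
      ext y
      simp [Finset.bipartiteBelow, and_comm, C.com_comm (x := u)]
    simp only [h1, h3] at hdc
    rw [hdc, ← Finset.add_sum_erase _ _ (C.mem_Z.2 (C.com_refl x)), Finset.inter_compl,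
      Finset.card_empty, zero_add, Finset.sum_congr rfl (g := fun _ => (C.Z x).card - 2),
      Finset.sum_const, smul_eq_mul, Finset.card_erase_of_mem (C.mem_Z.2 (C.com_refl x))]
    intro c hc
    have h4 : (C.Z c ∩ (C.Z x)ᶜ).card + (C.Z c ∩ C.Z x).card = (C.Z c).card := by
      rw [← Finset.card_union_of_disjoint
        (Disjoint.mono Finset.inter_subset_right Finset.inter_subset_right disjoint_compl_left),
        ← Finset.inter_union_distrib_left, Finset.union_comm, Finset.union_compl,
        Finset.inter_univ]
    rw [h2 c hc, C.card_Z_eq c x] at h4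
    omega

omit [IsSimpleGroup G] [IsPretransitive G X] in
theorem pow_eq_one {x : X} {k : G} (hk : k ∈ C.H x) : k ^ q = 1 := by
  rw [← C.card_H x]
  exact congrArg Subtype.val (pow_card_eq_one' (x := (⟨k, hk⟩ : C.H x)))

omit [IsPretransitive G X] in
theorem four_dvd_card_compl (C : SmallPrimeClass G X 2) (x : X) :
    4 ∣ Fintype.card X - (C.Z x).card := by
  obtain ⟨t, ht, h1⟩ := C.exists_mem_ne_one x
  have ht2 := C.pow_eq_one ht
  have hs := sign_toPerm_eq_one C.not_solvable (Y := X) t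
  rw [Equiv.Perm.sign_of_pow_two_eq_one (by rw [← map_pow, ht2, map_one])] at hs
  have hfix : Fintype.card (Function.fixedPoints (toPermHom G X t)) = (C.Z x).card := by
    rw [← Fintype.card_coe]
    refine Fintype.card_congr (Equiv.subtypeEquivRight fun y => ?_)
    rw [mem_Z]
    exact ⟨fun h => C.com_of_smul_eq ht h1 h, fun h => h t ht⟩
  rw [hfix] at hs
  obtain ⟨m, hm⟩ := C.dvd_card_compl x
  rw [hm, Nat.mul_div_cancel_left _ two_pos] at hs
  rcases Nat.even_or_odd m with ⟨j, rfl⟩ | hodd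
  · rw [hm]
    exact ⟨j, by ring⟩
  · rw [hodd.neg_one_pow] at hs
    exact absurd hs (by decide)

/-- An element fixing all classes of members of the class with equal centralisers is trivial. -/
theorem eq_one_of_forall_Z_smul_eq [Nonempty X] {g : G} (h : ∀ y, C.Z (g • y) = C.Z y) : g = 1 := by
  let L : Subgroup G :=
    { carrier := {g | ∀ y, C.Z (g • y) = C.Z y}
      one_mem' := fun y => by rw [one_smul]
      mul_mem' := fun {a b} ha hb y => by rw [mul_smul, ha, hb]
      inv_mem' := fun {a} ha y => by rw [← ha, smul_inv_smul] }
  have hL : L.Normal := ⟨fun n hn g y => by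
    rw [mul_smul, mul_smul, Z_smul, hn, ← Z_smul, smul_inv_smul]⟩
  rcases hL.eq_bot_or_eq_top with hb | ht
  · exact Subgroup.mem_bot.1 (hb ▸ (show g ∈ L from h))
  · obtain ⟨x⟩ := ‹Nonempty X›
    obtain ⟨y, hy⟩ := C.exists_not_com x
    obtain ⟨k, rfl⟩ := exists_smul_eq G x y
    have : C.Z (k • x) = C.Z x := (ht ▸ Subgroup.mem_top k : k ∈ L) x
    exact absurd (C.mem_Z.1 (this ▸ C.mem_Z.2 (C.com_refl _))) hy

omit [IsSimpleGroup G] [IsPretransitive G X] in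
theorem eq_pow_of_mem {x : X} {k l : G} (hk : k ∈ C.H x) (h1 : k ≠ 1) (hl : l ∈ C.H x) :
    ∃ i < q, l = k ^ i := by
  have := C.finite_H x
  have hl' : l ∈ Subgroup.zpowers k :=
    le_of_prime_card C.prime (C.card_H x) hk h1 (Subgroup.mem_zpowers k) hl
  obtain ⟨j, rfl⟩ := Subgroup.mem_zpowers_iff.1 hl'
  refine ⟨(j % q).toNat, ?_, ?_⟩
  · have := C.prime.pos
    have := Int.emod_lt_of_pos j (b := q) (by omega)
    have := Int.emod_nonneg j (b := q) (by omega)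
    omega
  · have := C.prime.pos
    rw [← zpow_natCast, Int.toNat_of_nonneg (Int.emod_nonneg j (by omega))]
    conv_lhs => rw [← Int.emod_add_mul_ediv j q]
    rw [zpow_add, zpow_mul, zpow_natCast, C.pow_eq_one hk, one_zpow, mul_one]

omit [IsSimpleGroup G] [IsPretransitive G X] in
theorem eq_or_of_mem (hq : q = 2 ∨ q = 3) {x : X} {k l : G} (hk : k ∈ C.H x) (h1 : k ≠ 1)
    (hl : l ∈ C.H x) : l = 1 ∨ l = k ∨ l = k⁻¹ := by
  obtain ⟨i, hi, rfl⟩ := C.eq_pow_of_mem hk h1 hl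
  have hp := C.pow_eq_one hk
  rcases hq with rfl | rfl
  · interval_cases i <;> simp
  · interval_cases i
    · simp
    · simp
    · exact .inr (.inr (eq_inv_of_mul_eq_one_left (by rw [← hp]; group)))

set_option maxHeartbeats 1000000 in
theorem card_Z_le_two_of_card_compl [Finite G] (hq : q = 2 ∨ q = 3) (x : X)
    (hd : (C.Z x)ᶜ.card = 2 * q) : (C.Z x).card ≤ 2 := by
  by_contra! hf
  have : Nonempty X := ⟨x⟩
  obtain ⟨c, hxc, hZ, hne⟩ := C.exists_compl_inter_compl_nonempty hf
  obtain ⟨hAq, hBq, hB0, hAB, -, -⟩ := C.card_compl_inter_compl hxc hZ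
  have hA0 := hne.card_pos
  set A := (C.Z c)ᶜ ∩ (C.Z x)ᶜ with hAdef
  set B := C.Z c ∩ (C.Z x)ᶜ with hBdef
  have hmemA : ∀ y, y ∈ A ↔ ¬ C.Com c y ∧ ¬ C.Com x y := fun y => by simp [hAdef]
  have hmemB : ∀ y, y ∈ B ↔ C.Com c y ∧ ¬ C.Com x y := fun y => by simp [hBdef]
  have hBof : ∀ y ∉ A, ¬ C.Com x y → y ∈ B := fun y h1 h2 =>
    (hmemB y).2 ⟨by_contra fun h => h1 ((hmemA y).2 ⟨h, h2⟩), h2⟩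
  have hA : A.card ≤ q := by
    have := Nat.le_of_dvd hB0 hBq
    omega
  have hB : B.card ≤ q := by
    have := Nat.le_of_dvd hA0 hAq
    omega
  have hkx : ∀ k ∈ C.H x, ∀ y, C.Com x (k • y) ↔ C.Com x y := fun k hk y => by
    rw [← mem_Z, ← mem_Z, C.smul_mem_Z_iff (C.com_refl x) hk]
  have hkc : ∀ k ∈ C.H x, ∀ y, C.Com c (k • y) ↔ C.Com c y := fun k hk y => by
    rw [← mem_Z, ← mem_Z, C.smul_mem_Z_iff hxc hk]
  have hkA : ∀ k ∈ C.H x, ∀ y ∈ A, k • y ∈ A := fun k hk y hy => by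
    rw [hmemA] at hy ⊢
    rwa [hkx k hk, hkc k hk]
  have hkB : ∀ k ∈ C.H x, ∀ y ∈ B, k • y ∈ B := fun k hk y hy => by
    rw [hmemB] at hy ⊢
    rwa [hkx k hk, hkc k hk]
  obtain ⟨k, hk, hk1⟩ := C.exists_mem_ne_one x
  have htA : ∀ a ∈ A, ∀ a' ∈ A, ∃ k ∈ C.H x, k • a = a' := fun a ha a' ha' =>
    exists_smul_eq_of_card_le C.prime (C.card_H x) hkA hA ha
      ⟨k, hk, C.smul_ne_of_not_com hk hk1 ((hmemA a).1 ha).2⟩ ha'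
  have htB : ∀ a ∈ B, ∀ a' ∈ B, ∃ k ∈ C.H x, k • a = a' := fun a ha a' ha' =>
    exists_smul_eq_of_card_le C.prime (C.card_H x) hkB hB ha
      ⟨k, hk, C.smul_ne_of_not_com hk hk1 ((hmemB a).1 ha).2⟩ ha'
  have hw : ∀ b ∈ B, ∀ b' ∈ B, ∃ w : G, (∀ a ∈ A, w • a = a) ∧ w • b = b' := by
    intro b hb b' hb'
    obtain ⟨l, hl, rfl⟩ := htB b hb b' hb'
    obtain ⟨g, hg, hg1⟩ := C.exists_mem_ne_one c
    obtain ⟨a₀, ha₀⟩ := hne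
    have hcomm := (C.com_iff c x).1 hxc.symm g hg
    obtain ⟨h, hh, hha⟩ := htA a₀ ha₀ (g • a₀) (by
      rw [hmemA] at ha₀ ⊢
      refine ⟨fun h => ha₀.1 ?_, fun h => ha₀.2 ?_⟩
      · rwa [← mem_Z, C.smul_mem_Z_iff (C.com_refl c) hg, mem_Z] at h
      · rwa [← mem_Z, C.smul_mem_Z_iff hxc.symm hg, mem_Z] at h)
    have hh1 : h ≠ 1 := by
      rintro rfl
      rw [one_smul] at hha
      exact C.smul_ne_of_not_com hg hg1 ((hmemA _).1 ha₀).1 hha.symm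
    obtain ⟨i, -, rfl⟩ := C.eq_pow_of_mem hh hh1 hl
    have hz : ∀ a ∈ A, (g⁻¹ * h) • a = a := by
      intro a ha
      obtain ⟨m, hm, rfl⟩ := htA a₀ ha₀ a ha
      rw [mul_smul, inv_smul_eq_iff, smul_smul, smul_smul, hcomm m hm,
        (C.com_iff x x).1 (C.com_refl x) h hh m hm, mul_smul, mul_smul, hha]
    refine ⟨(g⁻¹ * h) ^ i, fun a ha => ?_, ?_⟩
    · have : g⁻¹ * h ∈ stabilizer G a := hz a ha
      exact pow_mem this i
    · clear hl hb'
      induction i with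
      | zero => simp
      | succ i ih =>
        rw [pow_succ', mul_smul, ih, mul_smul, smul_smul h, ← pow_succ']
        exact ((hmemB _).1 (hkB _ (pow_mem hh _) b hb)).1 _ (inv_mem hg)
  have hZA : ∀ a ∈ A, ∀ a' ∈ A, ∀ y ∉ A, y ∈ C.Z a → y ∈ C.Z a' := by
    intro a ha a' ha' y hyA hy
    obtain ⟨l, hl, rfl⟩ := htA a ha a' ha'
    by_cases hyx : C.Com x y
    · rw [← hyx l hl]
      exact (C.mem_Z_smul l).2 hy
    · have hyB : y ∈ B := hBof y hyA hyx
      obtain ⟨w, hwA, hwy⟩ := hw y hyB _ (hkB _ (inv_mem hl) y hyB)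
      have := (C.mem_Z_smul w).2 hy
      rw [hwA a ha, hwy] at this
      have := (C.mem_Z_smul l).2 this
      rwa [smul_inv_smul] at this
  obtain ⟨a, ha⟩ := hne
  have hka : k • a ≠ a := C.smul_ne_of_not_com hk hk1 ((hmemA a).1 ha).2
  have hkaA := hkA k hk a ha
  have hAmem : ∀ y ∈ A, y = a ∨ y = k • a ∨ y = k⁻¹ • a := by
    intro y hy
    obtain ⟨l, hl, rfl⟩ := htA a ha y hy
    rcases C.eq_or_of_mem hq hk hk1 hl with rfl | rfl | rfl <;> simp
  have hc1 : C.Com a (k⁻¹ • a) ↔ C.Com a (k • a) := by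
    rw [← C.com_smul_iff k, smul_inv_smul, com_comm]
  have hc2 : k⁻¹ • a = k • a ∨ (C.Com (k • a) (k⁻¹ • a) ↔ C.Com a (k • a)) := by
    have hp := C.pow_eq_one hk
    rcases hq with rfl | rfl
    · left
      rw [inv_smul_eq_iff, smul_smul, ← pow_two, hp, one_smul]
    · right
      rw [← C.com_smul_iff k, smul_inv_smul, smul_smul, ← C.com_smul_iff k, smul_smul,
        ← pow_two, ← pow_succ', hp, one_smul]
  by_cases hcom : C.Com a (k • a)
  · have hall : ∀ y ∈ A, ∀ y' ∈ A, C.Com y y' := by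
      intro y hy y' hy'
      have := C.com_refl
      rcases hAmem y hy with rfl | rfl | rfl <;> rcases hAmem y' hy' with rfl | rfl | rfl
      all_goals first
        | exact C.com_refl _
        | exact hcom
        | exact hcom.symm
        | exact hc1.2 hcom
        | exact (hc1.2 hcom).symm
        | skip
      · rcases hc2 with h | h
        · rw [h]; exact C.com_refl _
        · exact h.2 hcom
      · rcases hc2 with h | h
        · rw [h]; exact C.com_refl _
        · exact (h.2 hcom).symm
    have htwin : ∀ y ∈ A, ∀ y' ∈ A, C.Z y = C.Z y' := by
      have : ∀ y ∈ A, ∀ y' ∈ A, C.Z y ⊆ C.Z y' := fun y hy y' hy' u hu => by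
        by_cases huA : u ∈ A
        · exact C.mem_Z.2 (hall _ hy' _ huA)
        · exact hZA y hy y' hy' u huA hu
      exact fun y hy y' hy' => (this y hy y' hy').antisymm (this y' hy' y hy)
    by_cases hkk : k⁻¹ • a = k • a
    · refine hk1 (C.eq_one_of_forall_Z_smul_eq fun y => ?_)
      by_cases hyA : y ∈ A
      · exact htwin _ (hkA k hk y hyA) _ hyA
      by_cases hyx : C.Com x y
      · rw [hyx k hk]
      have hyB : y ∈ B := hBof y hyA hyx
      have hky : k • y ≠ y := C.smul_ne_of_not_com hk hk1 hyx
      obtain ⟨y', hy', hyy'⟩ : ∃ y', y' ≠ y ∧ C.Z y = C.Z y' := by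
        obtain ⟨g, rfl⟩ := exists_smul_eq G a y
        refine ⟨g • k • a, fun h => hka (MulAction.injective g h), ?_⟩
        rw [Z_smul, Z_smul, htwin a ha _ hkaA]
      by_cases hy'A : y' ∈ A
      · refine (C.twin_le_two (x := y') (hyy'.symm) (htwin _ hy'A _ (hkA k hk y' hy'A)) hy' ?_
          fun h => hyA (h ▸ hkA k hk y' hy'A)).elim
        exact (C.smul_ne_of_not_com hk hk1 ((hmemA _).1 hy'A).2).symm
      by_cases hy'x : C.Com x y'
      · refine (C.twin_le_two (x := y') hyy'.symm (b := k • y) ?_ hy' ?_ hky.symm).elim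
        · rw [← hy'x k hk, Z_smul, Z_smul, hyy']
        · rintro rfl
          exact hyx ((hkx k hk y).1 hy'x)
      have hy'B : y' ∈ B := hBof y' hy'A hy'x
      obtain ⟨l, hl, rfl⟩ := htB y hyB y' hy'B
      have hkinv : k⁻¹ = k := by
        have hz : (k * k) • a = a := by rw [mul_smul, ← hkk, smul_inv_smul]
        by_contra h
        refine C.smul_ne_of_not_com (mul_mem hk hk) (fun h' => h ?_) ((hmemA a).1 ha).2 hz
        exact inv_eq_of_mul_eq_one_left h'
      rcases C.eq_or_of_mem hq hk hk1 hl with rfl | rfl | rfl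
      · simp at hy'
      · exact hyy'.symm
      · rw [hkinv] at hyy'
        exact hyy'.symm
    · have hk' := hkA _ (inv_mem hk) a ha
      refine C.twin_le_two (htwin a ha _ hkaA) (htwin a ha _ hk') hka.symm ?_ (Ne.symm hkk)
      rw [Ne, eq_inv_smul_iff]
      exact hka
  · refine hka (C.eq_of_erase_Z_eq (by rw [C.card_Z_eq a x]; omega) ?_).symm
    ext y
    rw [Finset.mem_erase, Finset.mem_erase]
    by_cases hyA : y ∈ A
    · rw [mem_Z, mem_Z]
      rcases hAmem y hyA with rfl | rfl | rfl
      · have : ¬ C.Com (k • y) y := fun h => hcom h.symm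
        tauto
      · tauto
      · rcases hc2 with h | h
        · rw [h]; tauto
        · rw [h, hc1]; tauto
    · have h1 : y ≠ a := fun h => hyA (h ▸ ha)
      have h2 : y ≠ k • a := fun h => hyA (h ▸ hkaA)
      exact ⟨fun h => ⟨h2, hZA a ha _ hkaA y hyA h.2⟩, fun h => ⟨h1, hZA _ hkaA a ha y hyA h.2⟩⟩

/-- A variant of `eq_one_of_smul_eq_of_valency_two` for the classes of members with equal
centralisers. -/
theorem eq_one_of_Z_smul_eq_of_valency_two (R : X → X → Prop) (hsymm : ∀ x y, R x y → R y x)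
    (hirr : ∀ x, ¬ R x x) (hR : ∀ (g : G) x y, R x y → R (g • x) (g • y))
    (hZ : ∀ x y y', C.Z y = C.Z y' → R x y → R x y') {x a b : X} (hab : C.Z a ≠ C.Z b)
    (hx : ∀ z, R x z ↔ C.Z z = C.Z a ∨ C.Z z = C.Z b) {g : G} (hg : C.Z (g • x) = C.Z x)
    (hga : C.Z (g • a) = C.Z a) (hgb : C.Z (g • b) = C.Z b) : g = 1 := by
  let Y := orbit G (C.Z x)
  have hmem : ∀ y, C.Z y ∈ orbit G (C.Z x) := fun y => by
    obtain ⟨k, rfl⟩ := exists_smul_eq G x y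
    rw [Z_smul]
    exact mem_orbit _ _
  let m : X → Y := fun y => ⟨C.Z y, hmem y⟩
  have hm : ∀ {y z}, m y = m z ↔ C.Z y = C.Z z := Subtype.ext_iff
  have hsm : ∀ (k : G) y, k • m y = m (k • y) := fun k y => Subtype.ext (C.Z_smul k y).symm
  have hsurj : Function.Surjective m := by
    rintro ⟨_, k, rfl⟩
    exact ⟨k • x, Subtype.ext (C.Z_smul k x)⟩
  have : Finite Y := Finite.of_surjective m hsurj
  have := Fintype.ofFinite Y
  have hY : Fintype.card Y ≤ 14 := (Fintype.card_le_of_surjective m hsurj).trans C.card_le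
  have : Nontrivial Y := ⟨m a, m b, fun h => hab (hm.1 h)⟩
  have hZ' : ∀ y y' z z', C.Z y = C.Z y' → C.Z z = C.Z z' → R y z → R y' z' :=
    fun y y' z z' h h' hr => hZ _ _ _ h' (hsymm _ _ (hZ _ _ _ h (hsymm _ _ hr)))
  have hRm : ∀ y z, (∃ y' z', m y = m y' ∧ m z = m z' ∧ R y' z') ↔ R y z := fun y z =>
    ⟨fun ⟨y', z', h, h', hr⟩ => hZ' _ _ _ _ (hm.1 h).symm (hm.1 h').symm hr,
      fun h => ⟨y, z, rfl, rfl, h⟩⟩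
  refine eq_one_of_smul_eq_of_valency_two C.not_solvable hY
    (fun S T => ∃ y z, S = m y ∧ T = m z ∧ R y z) ?_ ?_ ?_ (y₀ := m x) (a := m a) (b := m b)
    (fun h => hab (hm.1 h)) ?_ ?_ ?_ ?_
  · rintro S T ⟨y, z, hS, hT, h⟩
    exact ⟨z, y, hT, hS, hsymm _ _ h⟩
  · intro S h
    obtain ⟨y, rfl⟩ := hsurj S
    exact hirr y ((hRm _ _).1 h)
  · rintro k S T ⟨y, z, rfl, rfl, h⟩
    exact ⟨k • y, k • z, hsm k y, hsm k z, hR k y z h⟩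
  · intro T
    obtain ⟨z, rfl⟩ := hsurj T
    rw [hRm, hx, hm, hm]
  · rw [hsm, hm, hg]
  · rw [hsm, hm, hga]
  · rw [hsm, hm, hgb]

omit [IsSimpleGroup G] [IsPretransitive G X] in
/-- The number of ordered triples of distinct pairwise commuting members of the class is divisible
by three. -/
theorem three_dvd_card_mul [Finite G] (m : ℕ)
    (h : ∀ x, ∑ c ∈ (C.Z x).erase x, ((C.Z c ∩ C.Z x).card - 2) = m) :
    3 ∣ Fintype.card X * m := by
  let P : X × X × X → Prop := fun p =>
    C.Com p.1 p.2.1 ∧ C.Com p.1 p.2.2 ∧ C.Com p.2.1 p.2.2 ∧ p.1 ≠ p.2.1 ∧ p.1 ≠ p.2.2 ∧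
      p.2.1 ≠ p.2.2
  let ρ : Function.End {p // P p} := fun p =>
    ⟨(p.1.2.1, p.1.2.2, p.1.1), p.2.2.2.1, p.2.1.symm, p.2.2.1.symm, p.2.2.2.2.2.2,
      p.2.2.2.2.1.symm, p.2.2.2.2.2.1.symm⟩
  have hρ : ρ ^ 3 ^ 1 = 1 := rfl
  have := Fact.mk Nat.prime_three
  have hmod := Equiv.Perm.card_fixedPoints_modEq hρ
  have hempty : IsEmpty ρ.fixedPoints := ⟨fun ⟨p, hp⟩ => p.2.2.2.2.1 (by
    have := congrArg (fun p => p.1.1) (show ρ p = p from hp)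
    exact this.symm)⟩
  rw [Fintype.card_eq_zero (α := ρ.fixedPoints), Nat.modEq_zero_iff_dvd] at hmod
  refine hmod.trans (dvd_of_eq ?_)
  rw [Fintype.card_subtype, ← Finset.card_univ, ← smul_eq_mul, ← Finset.sum_const,
    Finset.card_eq_sum_card_fiberwise (f := Prod.fst) (t := Finset.univ) (by simp)]
  refine Finset.sum_congr rfl fun x _ => ?_
  rw [← h x, Finset.card_eq_sum_card_fiberwise (f := fun p => p.2.1) (t := (C.Z x).erase x)]
  · refine Finset.sum_congr rfl fun c hc => ?_
    rw [Finset.mem_erase, mem_Z] at hc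
    have h1 : c ∈ C.Z c ∩ C.Z x := by simp [hc.2, C.com_refl]
    have h2 : x ∈ (C.Z c ∩ C.Z x).erase c := by simp [hc.2.symm, hc.1.symm, C.com_refl]
    rw [show (C.Z c ∩ C.Z x).card - 2 = (((C.Z c ∩ C.Z x).erase c).erase x).card by
      rw [Finset.card_erase_of_mem h2, Finset.card_erase_of_mem h1]; rfl]
    refine Finset.card_nbij' (fun p => p.2.2) (fun e => (x, c, e)) ?_ ?_ ?_ ?_
    · rintro ⟨p, p', e⟩ hp
      simp only [Finset.coe_filter, Set.mem_ofPred_eq, Finset.mem_filter, P, Finset.mem_univ] at hp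
      obtain ⟨⟨⟨-, hp⟩, rfl⟩, rfl⟩ := hp
      simp only [Finset.coe_erase, Finset.coe_inter, Set.mem_sdiff, Set.mem_inter_iff,
        Finset.mem_coe, mem_Z, Set.mem_singleton_iff]
      grind
    · intro e he
      simp only [Finset.coe_erase, Finset.coe_inter, Set.mem_sdiff, Set.mem_inter_iff,
        Finset.mem_coe, mem_Z, Set.mem_singleton_iff] at he
      simp only [Finset.coe_filter, Set.mem_ofPred_eq, Finset.mem_filter, P, Finset.mem_univ]
      grind
    · rintro ⟨p, p', e⟩ hp
      simp only [Finset.coe_filter, Set.mem_ofPred_eq, Finset.mem_filter, P, Finset.mem_univ] at hp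
      obtain ⟨⟨⟨-, hp⟩, rfl⟩, rfl⟩ := hp
      rfl
    · intro e he
      rfl
  · rintro ⟨p, p', e⟩ hp
    simp only [Finset.coe_filter, Set.mem_ofPred_eq, Finset.mem_filter, P, Finset.mem_univ] at hp
    obtain ⟨⟨-, hp⟩, rfl⟩ := hp
    simp only [Finset.coe_erase, Set.mem_sdiff, Finset.mem_coe, mem_Z, Set.mem_singleton_iff]
    grind

omit [IsSimpleGroup G] in
theorem exists_twin {x y : X} (hyx : y ≠ x) (hy : C.Z y = C.Z x) (c : X) :
    ∃ z, z ≠ c ∧ C.Z z = C.Z c := by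
  obtain ⟨g, rfl⟩ := exists_smul_eq G x c
  exact ⟨g • y, fun h => hyx (MulAction.injective g h), by rw [Z_smul, Z_smul, hy]⟩

omit [IsSimpleGroup G] in
theorem four_le_card_inter [Finite G] {x y c : X} (hyx : y ≠ x) (hy : C.Z y = C.Z x)
    (hc : C.Com x c) (hZ : C.Z c ≠ C.Z x) : 4 ≤ (C.Z c ∩ C.Z x).card := by
  obtain ⟨z, hzc, hz⟩ := C.exists_twin hyx hy c
  have hcx : C.Com c y := C.mem_Z.1 (by
    have : c ∈ C.Z y := by rw [hy]; exact C.mem_Z.2 hc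
    exact C.mem_Z.2 (C.mem_Z.1 this).symm)
  have hxz : C.Com x z := (C.mem_Z.1 (by rw [hz]; exact C.mem_Z.2 hc.symm : x ∈ C.Z z)).symm
  have hcz : C.Com c z := (C.mem_Z.1 (by rw [hz]; exact C.mem_Z.2 (C.com_refl c) : c ∈ C.Z z)).symm
  have hxy : C.Com x y := C.mem_Z.1 (by rw [← hy]; exact C.mem_Z.2 (C.com_refl y))
  have hsub : ({x, y, c, z} : Finset X) ⊆ C.Z c ∩ C.Z x := by
    intro u hu
    simp only [Finset.mem_insert, Finset.mem_singleton] at hu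
    rw [Finset.mem_inter, mem_Z, mem_Z]
    rcases hu with rfl | rfl | rfl | rfl
    · exact ⟨hc.symm, C.com_refl _⟩
    · exact ⟨hcx, hxy⟩
    · exact ⟨C.com_refl _, hc⟩
    · exact ⟨hcz, hxz⟩
  refine le_trans ?_ (Finset.card_le_card hsub)
  have h1 : x ≠ c := fun h => hZ (by rw [h])
  have h2 : x ≠ z := fun h => hZ (by rw [h, hz])
  have h3 : y ≠ c := fun h => hZ (by rw [← h, hy])
  have h4 : y ≠ z := fun h => hZ (by rw [← hz, ← h, hy])
  rw [Finset.card_insert_of_notMem, Finset.card_insert_of_notMem, Finset.card_insert_of_notMem,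
    Finset.card_singleton] <;> simp_all [Ne.symm]

theorem card_inter_Z_eq_two [Finite G] {x : X} (hf : (C.Z x).card = q + 2) :
    ∀ c ∈ (C.Z x).erase x, (C.Z c ∩ C.Z x).card = 2 := by
  have key : ∀ c, C.Com x c → C.Z c ≠ C.Z x → (C.Z c ∩ C.Z x).card = 2 := by
    intro c hc hZ
    obtain ⟨-, h1, h2, -, h3, h4⟩ := C.card_compl_inter_compl hc hZ
    have := Nat.le_of_dvd h2 h1
    omega
  intro c hc
  rw [Finset.mem_erase, mem_Z] at hc
  refine key c hc.2 fun hZ => ?_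
  have := C.prime.two_le
  obtain ⟨c', hc', hZ'⟩ : ∃ c', C.Com x c' ∧ C.Z c' ≠ C.Z x := by
    by_contra! h
    have := C.card_Z_le_two_of_forall_twin x h
    omega
  have := C.four_le_card_inter hc.1 hZ hc' hZ'
  rw [key c' hc' hZ'] at this
  omega

theorem card_Z_ne_four [Finite G] (C : SmallPrimeClass G X 2) (x : X)
    (hd : (C.Z x)ᶜ.card = 8) : (C.Z x).card ≠ 4 := by
  intro hf
  obtain ⟨h1, h2⟩ := C.card_inter_Z_of_forall_card_eq_two (by omega) (C.card_inter_Z_eq_two hf)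
  have hcard : ((C.Z x)ᶜ.filter fun u => (C.Z u ∩ C.Z x).card = 0).card = 2 := by
    rw [Finset.card_filter]
    have : ∑ u ∈ (C.Z x)ᶜ, ((C.Z u ∩ C.Z x).card + if (C.Z u ∩ C.Z x).card = 0 then 1 else 0) =
        ∑ u ∈ (C.Z x)ᶜ, 1 := by
      refine Finset.sum_congr rfl fun u hu => ?_
      obtain ⟨h, h'⟩ := h1 u hu
      split_ifs <;> grind [Nat.ModEq]
    rw [Finset.sum_add_distrib, Finset.sum_const, h2, hd, hf] at this
    simp only [smul_eq_mul] at this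
    omega
  obtain ⟨u, u', huu, hF⟩ := Finset.card_eq_two.1 hcard
  have hR : ∀ z, C.Z z ∩ C.Z x = ∅ ↔ z = u ∨ z = u' := by
    intro z
    rw [show z = u ∨ z = u' ↔ z ∈ ({u, u'} : Finset X) by simp, ← hF, Finset.mem_filter,
      Finset.card_eq_zero, Finset.mem_compl, iff_and_self]
    intro h hz
    exact Finset.notMem_empty z (h ▸ Finset.mem_inter.2 ⟨C.mem_Z.2 (C.com_refl z), hz⟩)
  have hRs : ∀ (g : G) y z, C.Z z ∩ C.Z y = ∅ → C.Z (g • z) ∩ C.Z (g • y) = ∅ := fun g y z h => by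
    rw [Z_smul, Z_smul, ← Finset.smul_finset_inter, h, Finset.smul_finset_empty]
  obtain ⟨c, hc⟩ : ((C.Z x).erase x).Nonempty := by
    rw [← Finset.card_pos, Finset.card_erase_of_mem (C.mem_Z.2 (C.com_refl x))]
    omega
  rw [Finset.mem_erase, mem_Z] at hc
  have hswap : ∀ y, C.Com x y → ∀ k ∈ C.H y, k ≠ 1 → k • u = u' ∧ k • u' = u := by
    intro y hy k hk h1
    have hu : ∀ w, w = u ∨ w = u' → k • w ≠ w ∧ (k • w = u ∨ k • w = u') := by
      intro w hw
      rw [← hR] at hw ⊢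
      refine ⟨C.smul_ne_of_not_com hk h1 fun h => ?_, ?_⟩
      · exact Finset.notMem_empty y (hw ▸ Finset.mem_inter.2 ⟨C.mem_Z.2 h.symm, C.mem_Z.2 hy⟩)
      · rw [← hy.symm k hk]
        exact hRs k x w hw
    have := hu u (.inl rfl)
    have := hu u' (.inr rfl)
    tauto
  obtain ⟨s, hs, hs1⟩ := C.exists_mem_ne_one x
  obtain ⟨t, ht, ht1⟩ := C.exists_mem_ne_one c
  obtain ⟨hsu, hsu'⟩ := hswap x (C.com_refl x) s hs hs1
  obtain ⟨htu, htu'⟩ := hswap c hc.2 t ht ht1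
  have : Nonempty X := ⟨x⟩
  have := C.nontrivial
  have hst : s * t = 1 := eq_one_of_smul_eq_of_valency_two C.not_solvable C.card_le
    (fun y z => C.Z z ∩ C.Z y = ∅) (fun y z h => by rwa [Finset.inter_comm])
    (fun y h => by
      rw [Finset.inter_self] at h
      exact Finset.notMem_empty y (h ▸ C.mem_Z.2 (C.com_refl y)))
    hRs huu hR
    (by rw [mul_smul, hc.2.symm t ht, C.com_refl x s hs])
    (by rw [mul_smul, htu, hsu']) (by rw [mul_smul, htu', hsu])
  have hsc : s ∈ C.H c := by
    rw [eq_inv_of_mul_eq_one_left hst]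
    exact inv_mem ht
  have := C.finite_H c
  exact hc.1 (C.inj _ _ (Subgroup.eq_of_le_of_card_ge
    (le_of_prime_card C.prime (C.card_H x) hs hs1 hsc) (by rw [C.card_H, C.card_H]))).symm

theorem card_Z_ne_five [Finite G] (C : SmallPrimeClass G X 2) (x : X)
    (hd : (C.Z x)ᶜ.card = 8) : (C.Z x).card ≠ 5 := by
  intro hf
  have hX := Finset.card_add_card_compl (C.Z x)
  have key : ∀ y c, C.Com y c → C.Z c ≠ C.Z y → (C.Z c ∩ C.Z y).card = 3 := by
    intro y c hc hZ
    obtain ⟨-, h1, h2, -, h3, h4⟩ := C.card_compl_inter_compl hc hZ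
    have := C.card_Z_eq x y
    omega
  have := C.three_dvd_card_mul 4 fun y => by
    rw [Finset.sum_congr rfl (g := fun _ => 1), Finset.sum_const,
      Finset.card_erase_of_mem (C.mem_Z.2 (C.com_refl y)), ← C.card_Z_eq x y, hf]
    · rfl
    intro c hc
    rw [Finset.mem_erase, mem_Z] at hc
    rw [key y c hc.2]
    intro hZ
    obtain ⟨c', hc', hZ'⟩ : ∃ c', C.Com y c' ∧ C.Z c' ≠ C.Z y := by
      by_contra! h
      have := C.card_Z_le_two_of_forall_twin y h
      rw [← C.card_Z_eq x y] at this
      omega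
    have := C.four_le_card_inter hc.1 hZ hc' hZ'
    rw [key y c' hc' hZ'] at this
    omega
  omega

theorem card_Z_ne_six [Finite G] (C : SmallPrimeClass G X 2) (x : X)
    (hd : (C.Z x)ᶜ.card = 8) : (C.Z x).card ≠ 6 := by
  intro hf
  have : Nonempty X := ⟨x⟩
  have := C.nontrivial
  obtain ⟨k, hk, hk1⟩ := C.exists_mem_ne_one x
  have hX := Finset.card_add_card_compl (C.Z x)
  have hZf : ∀ y, (C.Z y).card = 6 := fun y => by rw [← C.card_Z_eq x y, hf]
  have hself : ∀ y, y ∈ C.Z y := fun y => C.mem_Z.2 (C.com_refl y)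
  have key : ∀ y c, C.Com y c → C.Z c ≠ C.Z y →
      (C.Z c ∩ C.Z y).card = 2 ∨ (C.Z c ∩ C.Z y).card = 4 := by
    intro y c hc hZ
    obtain ⟨-, h1, h2, -, h3, h4⟩ := C.card_compl_inter_compl hc hZ
    have := hZf y
    omega
  obtain ⟨c₀, hc₀, hZ₀⟩ : ∃ c', C.Com x c' ∧ C.Z c' ≠ C.Z x := by
    by_contra! h
    have := C.card_Z_le_two_of_forall_twin x h
    omega
  by_cases htwin : ∃ y, y ≠ x ∧ C.Z y = C.Z x
  · obtain ⟨y, hyx, hy⟩ := htwin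
    obtain ⟨z, hzc, hz⟩ := C.exists_twin hyx hy c₀
    obtain ⟨e, he⟩ : (C.Z x \ {x, y, c₀, z}).Nonempty := by
      rw [← Finset.card_pos]
      have := Finset.le_card_sdiff {x, y, c₀, z} (C.Z x)
      have := Finset.card_le_four (a := x) (b := y) (c := c₀) (d := z)
      omega
    simp only [Finset.mem_sdiff, mem_Z, Finset.mem_insert, Finset.mem_singleton, not_or] at he
    obtain ⟨hxe, hex, hey, hec, hez⟩ := he
    have hZex : C.Z e ≠ C.Z x := fun h => C.twin_le_two hy.symm h.symm hyx.symm (Ne.symm hex)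
        (Ne.symm hey)
    have hZec : C.Z e ≠ C.Z c₀ := fun h => C.twin_le_two hz.symm h.symm hzc.symm (Ne.symm hec)
        (Ne.symm hez)
    obtain ⟨w, hwe, hw⟩ := C.exists_twin hyx hy e
    have hclass : ∀ v, C.Com x v → C.Z v = C.Z x ∨ C.Z v = C.Z c₀ ∨ C.Z v = C.Z e := by
      have hmem : ∀ a b, C.Z a = C.Z b → C.Com x b → a ∈ C.Z x := fun a b h hb => by
        rw [mem_Z, com_comm, ← mem_Z, h, mem_Z]
        exact hb.symm
      have hsub : ({x, y, c₀, z, e, w} : Finset X) ⊆ C.Z x := by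
        intro v hv
        simp only [Finset.mem_insert, Finset.mem_singleton] at hv
        rcases hv with rfl | rfl | rfl | rfl | rfl | rfl
        · exact hself _
        · exact hmem _ _ hy (C.com_refl x)
        · exact C.mem_Z.2 hc₀
        · exact hmem _ _ hz hc₀
        · exact C.mem_Z.2 hxe
        · exact hmem _ _ hw hxe
      have hcard : ({x, y, c₀, z, e, w} : Finset X).card = 6 := by
        have : x ≠ c₀ := fun h => hZ₀ (by rw [h])
        have : x ≠ z := fun h => hZ₀ (by rw [h, hz])
        have : x ≠ w := fun h => hZex (by rw [h, hw])
        have : y ≠ c₀ := fun h => hZ₀ (by rw [← h, hy])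
        have : y ≠ z := fun h => hZ₀ (by rw [← hz, ← h, hy])
        have : y ≠ w := fun h => hZex (by rw [← hw, ← h, hy])
        have : c₀ ≠ w := fun h => hZec (by rw [h, hw])
        have : z ≠ w := fun h => hZec (by rw [← hw, ← h, hz])
        rw [Finset.card_insert_of_notMem, Finset.card_insert_of_notMem,
          Finset.card_insert_of_notMem, Finset.card_insert_of_notMem,
          Finset.card_insert_of_notMem, Finset.card_singleton] <;> grind
      have heq := Finset.eq_of_subset_of_card_le hsub (by rw [hcard, hf])
      intro v hv
      rw [← mem_Z, ← heq] at hv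
      simp only [Finset.mem_insert, Finset.mem_singleton] at hv
      rcases hv with rfl | rfl | rfl | rfl | rfl | rfl <;> simp [hy, hz, hw]
    refine hk1 (C.eq_one_of_Z_smul_eq_of_valency_two (fun a b => C.Com a b ∧ C.Z a ≠ C.Z b)
      (fun a b h => ⟨h.1.symm, h.2.symm⟩) (fun a h => h.2 rfl) ?_ ?_ (Ne.symm hZec) (x := x) ?_
      (by rw [C.com_refl x k hk]) (by rw [hc₀ k hk]) (by rw [hxe k hk]))
    · rintro g a b ⟨h, h'⟩
      refine ⟨C.com_smul g h, fun h2 => h' ?_⟩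
      rw [Z_smul, Z_smul] at h2
      exact smul_left_cancel g h2
    · rintro a b b' h ⟨h1, h2⟩
      refine ⟨?_, h ▸ h2⟩
      rw [com_comm, ← mem_Z, ← h, mem_Z]
      exact h1.symm
    · intro v
      constructor
      · rintro ⟨h1, h2⟩
        exact (hclass v h1).resolve_left (Ne.symm h2)
      · have : ∀ b, C.Com x b → C.Z v = C.Z b → C.Com x v := fun b hb h => by
          rw [com_comm, ← mem_Z, h, mem_Z]
          exact hb.symm
        rintro (h | h)
        · exact ⟨this _ hc₀ h, by rw [h]; exact hZ₀.symm⟩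
        · exact ⟨this _ hxe h, by rw [h]; exact hZex.symm⟩
  have hnt : ∀ y c, c ∈ (C.Z y).erase y → (C.Z c ∩ C.Z y).card = 2 ∨ (C.Z c ∩ C.Z y).card = 4 := by
    intro y c hc
    rw [Finset.mem_erase, mem_Z] at hc
    exact key y c hc.2 fun h => htwin (C.exists_twin hc.1 h x)
  have hinter : ∀ (g : G) y z, (C.Z (g • z) ∩ C.Z (g • y)).card = (C.Z z ∩ C.Z y).card :=
    fun g y z => by
      rw [Z_smul, Z_smul, ← Finset.smul_finset_inter, Finset.card_smul_finset]
  let N : X → ℕ := fun y => (((C.Z y).erase y).filter fun c => (C.Z c ∩ C.Z y).card = 4).card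
  have hN : ∀ y, N y = N x := by
    intro y
    obtain ⟨g, rfl⟩ := exists_smul_eq G x y
    refine (Finset.card_equiv (MulAction.toPerm g) fun c => ?_).symm
    rw [Finset.mem_filter, Finset.mem_filter, MulAction.toPerm_apply, hinter, erase_Z_smul,
      Finset.smul_mem_smul_finset_iff]
  have h3 := C.three_dvd_card_mul (2 * N x) fun y => by
    rw [← hN y, show N y = _ from Finset.card_filter _ _, Finset.mul_sum]
    refine Finset.sum_congr rfl fun c hc => ?_
    rcases hnt y c hc with h | h <;> simp [h]
  rw [show Fintype.card X = 14 by omega] at h3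
  have hcard5 : ((C.Z x).erase x).card = 5 := by
    rw [Finset.card_erase_of_mem (hself x), hf]
  have hN24 := Finset.card_filter_add_card_filter_not (s := (C.Z x).erase x)
    (fun c => (C.Z c ∩ C.Z x).card = 4)
  rw [hcard5] at hN24
  have hN3 : N x = 0 ∨ N x = 3 := by
    have : N x ≤ 5 := by
      rw [← hN24]
      exact Nat.le_add_right _ _
    omega
  rcases hN3 with h0 | h3
  · have h2 : ∀ c ∈ (C.Z x).erase x, (C.Z c ∩ C.Z x).card = 2 := fun c hc =>
      (hnt x c hc).resolve_right fun h4 => Finset.notMem_empty c (by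
        rw [← Finset.card_eq_zero.1 h0]
        exact Finset.mem_filter.2 ⟨hc, h4⟩)
    obtain ⟨hs, hsum⟩ := C.card_inter_Z_of_forall_card_eq_two (by omega) h2
    have hcard : ((C.Z x)ᶜ.filter fun u => (C.Z u ∩ C.Z x).card = 1).card = 2 := by
      have hs' : ∀ u ∈ (C.Z x)ᶜ, (C.Z u ∩ C.Z x).card = 0 ∨ (C.Z u ∩ C.Z x).card = 1 ∨
          (C.Z u ∩ C.Z x).card = 3 := by
        intro u hu
        obtain ⟨h, h'⟩ := hs u hu
        rw [Nat.ModEq] at h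
        omega
      have e1 : ∑ u ∈ (C.Z x)ᶜ, ((C.Z u ∩ C.Z x).card +
          (2 * (if (C.Z u ∩ C.Z x).card = 1 then 1 else 0) +
          3 * if (C.Z u ∩ C.Z x).card = 0 then 1 else 0)) = ∑ u ∈ (C.Z x)ᶜ, 3 :=
        Finset.sum_congr rfl fun u hu => by
          rcases hs' u hu with h | h | h <;> simp [h]
      rw [Finset.sum_add_distrib, Finset.sum_add_distrib, ← Finset.mul_sum, ← Finset.mul_sum,
        Finset.sum_const, hsum, hf, hd, ← Finset.card_filter, smul_eq_mul] at e1
      omega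
    obtain ⟨u, u', huu, hF⟩ := Finset.card_eq_two.1 hcard
    have hR : ∀ z, ¬ C.Com x z ∧ (C.Z z ∩ C.Z x).card = 1 ↔ z = u ∨ z = u' := by
      intro z
      rw [show z = u ∨ z = u' ↔ z ∈ ({u, u'} : Finset X) by simp, ← hF, Finset.mem_filter,
        Finset.mem_compl, mem_Z]
    have hRs : ∀ (g : G) y z, ¬ C.Com y z ∧ (C.Z z ∩ C.Z y).card = 1 →
        ¬ C.Com (g • y) (g • z) ∧ (C.Z (g • z) ∩ C.Z (g • y)).card = 1 := fun g y z h => by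
      rwa [com_smul_iff, hinter]
    have hu := (hR u).2 (.inl rfl)
    obtain ⟨c, hc⟩ := Finset.card_eq_one.1 hu.2
    have hcu : c ∈ C.Z u ∩ C.Z x := by rw [hc]; exact Finset.mem_singleton_self c
    rw [Finset.mem_inter, mem_Z, mem_Z] at hcu
    have hku := hRs k x u hu
    rw [C.com_refl x k hk, hR] at hku
    have hku' : k • u = u' := hku.resolve_left (C.smul_ne_of_not_com hk hk1 hu.1)
    have hcu' : C.Com c u' := by
      have := C.com_smul k hcu.1
      rw [hku', hcu.2 k hk] at this
      exact this.symm
    obtain ⟨s, hs, hs1⟩ := C.exists_mem_ne_one c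
    exact hs1 (eq_one_of_smul_eq_of_valency_two C.not_solvable C.card_le
      (fun y z => ¬ C.Com y z ∧ (C.Z z ∩ C.Z y).card = 1)
      (fun y z h => by rwa [com_comm, Finset.inter_comm]) (fun y h => h.1 (C.com_refl y)) hRs huu hR
      (hcu.2.symm s hs) (hcu.1.symm s hs) (hcu' s hs))
  · have hcard : (((C.Z x).erase x).filter fun c => ¬ (C.Z c ∩ C.Z x).card = 4).card = 2 := by
      have : N x + _ = 5 := hN24
      omega
    obtain ⟨u, u', huu, hF⟩ := Finset.card_eq_two.1 hcard
    have hR : ∀ z, C.Com x z ∧ z ≠ x ∧ (C.Z z ∩ C.Z x).card ≠ 4 ↔ z = u ∨ z = u' := by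
      intro z
      rw [show z = u ∨ z = u' ↔ z ∈ ({u, u'} : Finset X) by simp, ← hF, Finset.mem_filter,
        Finset.mem_erase, mem_Z]
      tauto
    exact hk1 (eq_one_of_smul_eq_of_valency_two C.not_solvable C.card_le
      (fun y z => C.Com y z ∧ z ≠ y ∧ (C.Z z ∩ C.Z y).card ≠ 4)
      (fun y z h => by rwa [com_comm, Finset.inter_comm, ne_comm]) (fun y h => h.2.1 rfl)
      (fun g y z h => by rwa [com_smul_iff, hinter, Ne, smul_left_cancel_iff]) huu hR
      (C.com_refl x k hk) (((hR u).2 (.inl rfl)).1 k hk) (((hR u').2 (.inr rfl)).1 k hk))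

theorem card_Z_eq_one_or_eq_two [Finite G] (x : X) : (C.Z x).card = 1 ∨ (C.Z x).card = 2 := by
  have h0 : 0 < (C.Z x).card := Finset.card_pos.2 ⟨x, C.mem_Z.2 (C.com_refl x)⟩
  suffices (C.Z x).card ≤ 2 by omega
  by_contra! hf
  have hX := Finset.card_add_card_compl (C.Z x)
  have h14 := C.card_le
  have hdvd := C.dvd_card_compl x
  rw [← Finset.card_compl] at hdvd
  have hfq : q + 2 ≤ (C.Z x).card := by
    by_contra! h
    have := C.card_Z_le_two x (by omega)
    omega
  have hdq : 2 * q ≤ (C.Z x)ᶜ.card := by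
    obtain ⟨c, hc, hZ, hne⟩ := C.exists_compl_inter_compl_nonempty hf
    obtain ⟨h1, h2, h3, h4, -, -⟩ := C.card_compl_inter_compl hc hZ
    have := Nat.le_of_dvd h3 h2
    have := Nat.le_of_dvd hne.card_pos h1
    omega
  have hq2 := C.prime.two_le
  have hq4 : q ≤ 4 := by omega
  have hd2 : (q = 2 ∨ q = 3) → (C.Z x)ᶜ.card ≠ 2 * q := fun hq hd => by
    have := C.card_Z_le_two_of_card_compl hq x hd
    omega
  interval_cases q
  · have h4 := C.four_dvd_card_compl x
    rw [← Finset.card_compl] at h4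
    have hd : (C.Z x)ᶜ.card = 8 := by
      have := hd2 (.inl rfl)
      omega
    have := C.card_Z_ne_four x hd
    have := C.card_Z_ne_five x hd
    have := C.card_Z_ne_six x hd
    omega
  · have := hd2 (.inr rfl)
    have hd : (C.Z x)ᶜ.card = 9 := by omega
    have hf5 : (C.Z x).card = 5 := by omega
    obtain ⟨h1, h2⟩ := C.card_inter_Z_of_forall_card_eq_two (by omega) (C.card_inter_Z_eq_two hf5)
    have := Finset.sum_le_card_nsmul (C.Z x)ᶜ (fun u => (C.Z u ∩ C.Z x).card) 1 fun u hu => by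
      obtain ⟨h, h'⟩ := h1 u hu
      rw [Nat.ModEq] at h
      omega
    rw [h2, hd, hf5] at this
    simp at this
  · exact absurd C.prime (by norm_num)

omit [IsSimpleGroup G] in
theorem com_iff_Z_eq [Finite G] {x : X} (hf : (C.Z x).card = 2) (y z : X) :
    C.Com y z ↔ C.Z y = C.Z z := by
  refine ⟨fun h => ?_, fun h => C.mem_Z.1 (h ▸ C.mem_Z.2 (C.com_refl z))⟩
  by_cases hyz : y = z
  · rw [hyz]
  have key : ∀ w, y ∈ C.Z w → z ∈ C.Z w → C.Z w = {y, z} := fun w hy hz => by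
    refine (Finset.eq_of_subset_of_card_le ?_ ?_).symm
    · exact Finset.insert_subset hy (Finset.singleton_subset_iff.2 hz)
    · rw [Finset.card_pair hyz, C.card_Z_eq w x, hf]
  rw [key y (C.mem_Z.2 (C.com_refl y)) (C.mem_Z.2 h),
    key z (C.mem_Z.2 h.symm) (C.mem_Z.2 (C.com_refl z))]

/-- The action on the pairs of commuting members of the class. -/
theorem exists_blocks [Finite G] {x : X} (hf : (C.Z x).card = 2) :
    ∃ (Y : Set (Finset X)) (_ : MulAction G Y) (_ : Fintype Y) (m : X → Y), IsPretransitive G Y ∧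
      Nontrivial Y ∧ Function.Surjective m ∧ (∀ (g : G) y, m (g • y) = g • m y) ∧
      (∀ y z, m y = m z ↔ C.Com y z) ∧ Fintype.card X = 2 * Fintype.card Y := by
  have hmem : ∀ y, C.Z y ∈ orbit G (C.Z x) := fun y => by
    obtain ⟨k, rfl⟩ := exists_smul_eq G x y
    rw [Z_smul]
    exact mem_orbit _ _
  let m : X → orbit G (C.Z x) := fun y => ⟨C.Z y, hmem y⟩
  have hsurj : Function.Surjective m := by
    rintro ⟨_, k, rfl⟩
    exact ⟨k • x, Subtype.ext (C.Z_smul k x)⟩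
  have hm : ∀ y z, m y = m z ↔ C.Com y z := fun y z => by
    rw [C.com_iff_Z_eq hf]
    exact Subtype.ext_iff
  have : Finite (orbit G (C.Z x)) := Finite.of_surjective m hsurj
  have hft := Fintype.ofFinite (orbit G (C.Z x))
  refine ⟨_, inferInstance, hft, m, inferInstance, ?_, hsurj,
    fun k y => Subtype.ext (C.Z_smul k y), hm, ?_⟩
  · obtain ⟨y, hy⟩ := C.exists_not_com x
    exact ⟨m x, m y, fun h => hy ((hm _ _).1 h)⟩
  · rw [← Finset.card_univ, Finset.card_eq_sum_card_fiberwise (f := m) (t := Finset.univ) (by simp),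
      Finset.sum_const_nat (m := 2), mul_comm]
    · rfl
    · intro S _
      obtain ⟨y, rfl⟩ := hsurj S
      rw [show (Finset.univ.filter fun z => m z = m y) = C.Z y by
        ext z
        simp [hm, C.com_comm], C.card_Z_eq y x, hf]

theorem toPermHom_injective {Y : Type*} [MulAction G Y] [IsPretransitive G Y] [Nontrivial Y] :
    Function.Injective (toPermHom G Y) := by
  refine (injective_iff_map_eq_one _).2 fun g hg => eq_one_of_forall_smul_eq fun y : Y => ?_
  simpa using congrArg (· y) hg

omit [IsSimpleGroup G] [IsPretransitive G X] in
/-- Two distinct commuting members of the class generate their direct product. -/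
theorem exists_injective_hom_prod [Finite G] {x y : X} (hxy : x ≠ y) (h : C.Com x y) :
    ∃ φ : C.H x × C.H y →* G, Function.Injective φ ∧
      ∀ p : C.H x × C.H y, φ p = (p.1 : G) * (p.2 : G) := by
  have hcomm : ∀ (k : C.H x) (l : C.H y), Commute ((C.H x).subtype k) ((C.H y).subtype l) :=
    fun k l => (C.com_iff x y).1 h k k.2 l l.2
  refine ⟨(C.H x).subtype.noncommCoprod (C.H y).subtype hcomm, ?_, fun p => rfl⟩
  rw [MonoidHom.noncommCoprod_injective]
  refine ⟨Subtype.val_injective, Subtype.val_injective, ?_⟩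
  rw [Subgroup.range_subtype, Subgroup.range_subtype, Subgroup.disjoint_def]
  intro k hk hk'
  by_contra h1
  have := C.finite_H y
  exact hxy (C.inj _ _ (Subgroup.eq_of_le_of_card_ge
    (le_of_prime_card C.prime (C.card_H x) hk h1 hk') (by rw [C.card_H, C.card_H])))

omit [IsSimpleGroup G] [IsPretransitive G X] in
theorem sq_dvd_card_stabilizer [Finite G] {x : X} (hf : (C.Z x).card = 2) :
    q ^ 2 ∣ Nat.card (stabilizer G x) := by
  obtain ⟨y, hy⟩ : ((C.Z x).erase x).Nonempty := by
    rw [← Finset.card_pos, Finset.card_erase_of_mem (C.mem_Z.2 (C.com_refl x))]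
    omega
  rw [Finset.mem_erase, mem_Z] at hy
  obtain ⟨φ, hφ, h⟩ := C.exists_injective_hom_prod hy.1.symm hy.2
  rw [pow_two, show q * q = Nat.card (C.H x × C.H y) by rw [Nat.card_prod, C.card_H, C.card_H]]
  refine Subgroup.card_dvd_of_injective (φ.codRestrict (stabilizer G x) fun p => ?_) fun a b hab =>
    hφ (congrArg Subtype.val hab)
  rw [h, mem_stabilizer_iff, mul_smul, hy.2.symm p.2 p.2.2, C.com_refl x p.1 p.1.2]

omit [IsSimpleGroup G] [Fintype X] in
theorem card_mul_card_stabilizer [Fintype X] (x : X) :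
    Fintype.card X * Nat.card (stabilizer G x) = Nat.card G := by
  rw [← Nat.card_eq_fintype_card, ← index_stabilizer_of_transitive G x, Subgroup.index_mul_card]

theorem card_ne_ten_of_card_Z_eq_two [Finite G] (C : SmallPrimeClass G X 2) {x : X}
    (hf : (C.Z x).card = 2) : Fintype.card X ≠ 10 := by
  intro h10
  obtain ⟨Y, _, _, m, _, _, -, -, -, hcard⟩ := C.exists_blocks hf
  have h1 : Nat.card G ∣ Nat.card (alternatingGroup Y) :=
    Subgroup.card_dvd_of_injective ((toPermHom G Y).codRestrict (alternatingGroup Y) fun g => by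
      rw [Equiv.Perm.mem_alternatingGroup]
      convert sign_toPerm_eq_one C.not_solvable (Y := Y) g) fun a b hab =>
        toPermHom_injective (congrArg Subtype.val hab)
  rw [nat_card_alternatingGroup, Nat.card_eq_fintype_card (α := Y),
    show Fintype.card Y = 5 by omega,
    ← card_mul_card_stabilizer x, h10] at h1
  obtain ⟨r, hr⟩ := C.sq_dvd_card_stabilizer hf
  rw [hr] at h1
  obtain ⟨s, hs⟩ := h1
  have : (60 : ℕ) = 40 * (r * s) := by
    rw [show (60 : ℕ) = Nat.factorial 5 / 2 from rfl, hs]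
    ring
  omega

theorem card_ne_twelve_of_card_Z_eq_two [Finite G] (C : SmallPrimeClass G X 5) {x : X}
    (hf : (C.Z x).card = 2) : Fintype.card X ≠ 12 := by
  intro h12
  obtain ⟨Y, _, _, m, _, _, -, -, -, hcard⟩ := C.exists_blocks hf
  have h1 : Nat.card G ∣ Nat.card (Equiv.Perm Y) :=
    Subgroup.card_dvd_of_injective (toPermHom G Y) toPermHom_injective
  rw [Nat.card_perm, Nat.card_eq_fintype_card (α := Y), show Fintype.card Y = 6 by omega,
    ← card_mul_card_stabilizer x, h12] at h1
  have := (C.sq_dvd_card_stabilizer hf).trans ((Dvd.intro_left _ rfl).trans h1)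
  revert this
  decide

theorem card_ne_fourteen_of_card_Z_eq_two [Finite G] (C : SmallPrimeClass G X 2) {x : X}
    (hf : (C.Z x).card = 2) : Fintype.card X ≠ 14 := by
  intro h14
  obtain ⟨Y, _, _, m, _, _, hsurj, hm, hmc, hcard⟩ := C.exists_blocks hf
  obtain ⟨t, ht, ht1⟩ := C.exists_mem_ne_one x
  have ht2 := C.pow_eq_one ht
  have hY : Fintype.card Y = 7 := by omega
  have hσ2 : toPermHom G Y t ^ 2 = 1 := by rw [← map_pow, ht2, map_one]
  have hfix : Fintype.card (Function.fixedPoints (toPermHom G Y t)) = 3 := by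
    have hs := sign_toPerm_eq_one C.not_solvable (Y := Y) t
    rw [Equiv.Perm.sign_of_pow_two_eq_one hσ2] at hs
    have hmod := Equiv.Perm.card_fixedPoints_modEq (p := 2) (n := 1) (α := Y)
      (f := (fun y => t • y : Function.End Y)) (by
        have := congrArg (fun σ : Equiv.Perm Y => (σ : Y → Y)) hσ2
        rw [pow_one]
        exact this)
    have hle : Fintype.card (Function.fixedPoints (toPermHom G Y t)) ≤ 7 :=
      hY ▸ set_fintype_card_le_univ _
    have h7 : Fintype.card (Function.fixedPoints (toPermHom G Y t)) ≠ 7 := fun h => by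
      rw [← hY, set_fintype_card_eq_univ_iff] at h
      refine ht1 (eq_one_of_forall_smul_eq fun y : Y => ?_)
      have : y ∈ Function.fixedPoints (toPermHom G Y t) := h ▸ Set.mem_univ y
      exact this
    rw [hY] at hs hmod
    change 7 ≡ Fintype.card (Function.fixedPoints (toPermHom G Y t)) [MOD 2] at hmod
    rw [Nat.ModEq] at hmod
    generalize Fintype.card (Function.fixedPoints (toPermHom G Y t)) = F at *
    interval_cases F <;> simp_all
    revert hs
    decide
  have hZ := C.com_iff_Z_eq hf
  have hR : ∀ z, ¬ C.Com x z ∧ (∀ k ∈ C.H x, C.Z (k • z) = C.Z z) ↔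
      m z ∈ ((Function.fixedPoints (toPermHom G Y t)).toFinset.erase (m x)) := by
    intro z
    rw [Finset.mem_erase, Set.mem_toFinset, Ne, hmc, C.com_comm (y := x)]
    refine and_congr_right fun _ => ?_
    change _ ↔ t • m z = m z
    rw [← hm, hmc, hZ]
    refine ⟨fun h => h t ht, fun h k hk => ?_⟩
    obtain ⟨i, hi, rfl⟩ := C.eq_pow_of_mem ht ht1 hk
    interval_cases i <;> simp [h]
  have hcard2 : ((Function.fixedPoints (toPermHom G Y t)).toFinset.erase (m x)).card = 2 := by
    rw [Finset.card_erase_of_mem, Set.toFinset_card, hfix]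
    rw [Set.mem_toFinset]
    change t • m x = m x
    rw [← hm, C.com_refl x t ht]
  obtain ⟨A, B, hAB, hF⟩ := Finset.card_eq_two.1 hcard2
  obtain ⟨a, rfl⟩ := hsurj A
  obtain ⟨b, rfl⟩ := hsurj B
  rw [Ne, hmc, hZ] at hAB
  have hR' : ∀ z, ¬ C.Com x z ∧ (∀ k ∈ C.H x, C.Z (k • z) = C.Z z) ↔
      C.Z z = C.Z a ∨ C.Z z = C.Z b := fun z => by
    rw [hR, hF, Finset.mem_insert, Finset.mem_singleton, hmc, hmc, hZ, hZ]
  refine ht1 (C.eq_one_of_Z_smul_eq_of_valency_two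
    (fun y z => ¬ C.Com y z ∧ ∀ k ∈ C.H y, C.Z (k • z) = C.Z z) ?_
    (fun y h => h.1 (C.com_refl y)) ?_ ?_ hAB hR' (by rw [C.com_refl x t ht])
    (((hR' a).2 (.inl rfl)).2 t ht) (((hR' b).2 (.inr rfl)).2 t ht))
  · rintro y z ⟨h, h'⟩
    refine ⟨fun hc => h hc.symm, fun l hl => ?_⟩
    rw [← hZ, C.com_comm, C.com_iff]
    intro k hk k' hk'
    rw [C.mem_smul] at hk'
    by_cases h1 : k = 1
    · rw [h1, one_mul, mul_one]
    have hll : l⁻¹ = l := inv_eq_of_mul_eq_one_left (by rw [← pow_two, C.pow_eq_one hl])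
    have hkk : k⁻¹ = k := inv_eq_of_mul_eq_one_left (by rw [← pow_two, C.pow_eq_one hk])
    have hkl : k * l * k * l = l * (k * l * k) := by
      have := (C.com_iff _ _).1 ((hZ _ _).2 (h' k hk)) _ (C.conj_mem k hl) l hl
      rwa [hkk] at this
    have hk2 : l * k' * l = 1 ∨ l * k' * l = k := by
      have := C.eq_or_of_mem (.inl rfl) hk h1 hk'
      rwa [hll, hkk, or_self] at this
    have hk3 : k' = l * (l * k' * l) * l := by
      rw [← mul_assoc, ← mul_assoc, mul_assoc _ l l, ← pow_two, C.pow_eq_one hl]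
      simp
    rcases hk2 with h | h
    · rw [h, mul_one, ← pow_two, C.pow_eq_one hl] at hk3
      rw [hk3, one_mul, mul_one]
    · rw [h] at hk3
      rw [hk3]
      simpa [mul_assoc] using hkl
  · rintro g y z ⟨h, h'⟩
    refine ⟨by rwa [com_smul_iff], fun k hk => ?_⟩
    rw [C.mem_smul] at hk
    have := congrArg (g • ·) (h' _ hk)
    simp only [← Z_smul, smul_smul] at this
    simpa [mul_assoc, smul_smul] using this
  · rintro y z z' h ⟨h1, h2⟩
    refine ⟨fun hc => h1 ?_, fun k hk => ?_⟩
    · rw [hZ, h, ← hZ]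
      exact hc
    · rw [Z_smul, ← h, ← Z_smul, h2 k hk]

omit [IsSimpleGroup G] in
theorem not_com_smul_of_not_com [Finite G] (C : SmallPrimeClass G X 3) {x a : X}
    (hf : (C.Z x).card = 2)
    (h : ¬ C.Com x a) {k : G} (hk : k ∈ C.H x) (h1 : k ≠ 1) : ¬ C.Com a (k • a) := by
  intro hc
  have h3 := C.pow_eq_one hk
  have hk2 : k ^ 2 ≠ 1 := fun h2 => h1 (by rw [pow_succ, h2, one_mul] at h3; exact h3)
  have hZ : C.Z a = C.Z (k • a) := (C.com_iff_Z_eq hf _ _).1 hc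
  have hmem : ∀ i : ℕ, k ^ i • a ∈ C.Z a := fun i => by
    induction i with
    | zero => simpa [mem_Z] using C.com_refl a
    | succ i ih => rwa [pow_succ', mul_smul, hZ, mem_Z_smul]
  have hsub : ({a, k • a, k ^ 2 • a} : Finset X) ⊆ C.Z a := by
    intro b hb
    simp only [Finset.mem_insert, Finset.mem_singleton] at hb
    rcases hb with rfl | rfl | rfl
    · simpa using hmem 0
    · simpa using hmem 1
    · exact hmem 2
  have hle := Finset.card_le_card hsub
  have hka := C.smul_ne_of_not_com hk h1 h
  have hka2 := C.smul_ne_of_not_com (pow_mem hk 2) hk2 h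
  rw [C.card_Z_eq a x, hf, Finset.card_eq_three.2 ⟨a, k • a, k ^ 2 • a, hka.symm, hka2.symm,
    fun he => hka ?_, rfl⟩] at hle
  · omega
  · rw [pow_two, mul_smul] at he
    exact (MulAction.injective k he).symm

/-- A transitive action of prime degree in which some nontrivial element moves at most three
points. -/
theorem factorial_div_two_dvd_card {Y : Type*} [MulAction G Y] [Fintype Y]
    [IsPretransitive G Y] [Nontrivial Y] (hns : ¬ Group.IsSolvable G) (hp : (Fintype.card Y).Prime)
    {z : G} (h1 : z ≠ 1) {S : Finset Y} (hS : Fintype.card Y ≤ S.card + 3)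
    (hfix : ∀ y ∈ S, z • y = y) : (Fintype.card Y).factorial / 2 ∣ Nat.card G := by
  have hz : (toPermHom G Y z).IsThreeCycle := by
    have hs := sign_toPerm_eq_one hns (Y := Y) z
    rw [← card_support_eq_three_iff]
    have hsub : (toPermHom G Y z).support ⊆ Finset.univ \ S := fun y hy => by
      rw [Equiv.Perm.mem_support] at hy
      simp only [Finset.mem_sdiff, Finset.mem_univ, true_and]
      exact fun hyS => hy (hfix y hyS)
    have hle := Finset.card_le_card hsub
    have := Finset.card_sdiff_add_card_eq_card (Finset.subset_univ S)
    rw [Finset.card_univ] at this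
    have h0 : (toPermHom G Y z).support.card ≠ 0 := fun h => by
      rw [Equiv.Perm.card_support_eq_zero] at h
      exact h1 (toPermHom_injective (h.trans (map_one _).symm))
    have h1' := Equiv.Perm.card_support_ne_one (toPermHom G Y z)
    have h2 : (toPermHom G Y z).support.card ≠ 2 := fun h => by
      rw [Equiv.Perm.card_support_eq_two] at h
      have := h.sign_eq
      rw [hs] at this
      exact absurd this (by decide)
    omega
  have : IsPretransitive (toPermHom G Y).range Y := ⟨fun y y' => by
    obtain ⟨g, hg⟩ := exists_smul_eq G y y'
    exact ⟨⟨toPermHom G Y g, g, rfl⟩, hg⟩⟩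
  have h := Equiv.Perm.alternatingGroup_le_of_isPreprimitive_of_isThreeCycle_mem
    (IsPreprimitive.of_prime_card (by rwa [Nat.card_eq_fintype_card])) hz
    (MonoidHom.mem_range.2 ⟨z, rfl⟩)
  rw [← Nat.card_eq_fintype_card, ← nat_card_alternatingGroup,
    Nat.card_congr (MonoidHom.ofInjective (toPermHom_injective (G := G) (Y := Y))).toEquiv]
  exact Subgroup.card_dvd_of_le h

omit [IsSimpleGroup G] in
/-- An element fixing two blocks and centralising `H x` fixes four blocks. -/
theorem exists_card_eq_four {Y : Type*} [MulAction G Y] {m : X → Y}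
    (hm : ∀ (g : G) y, m (g • y) = g • m y) (C : SmallPrimeClass G X 3) [Finite G]
    (hmc : ∀ y z, m y = m z ↔ C.Com y z) {x a : X} (hf : (C.Z x).card = 2) {z : G}
    (hzx : z • m x = m x) (hzc : ∀ k ∈ C.H x, Commute z k) (ha : ¬ C.Com x a)
    (hza : z • m a = m a) : ∃ S : Finset Y, S.card = 4 ∧ ∀ y ∈ S, z • y = y := by
  obtain ⟨h, hh, hh1⟩ := C.exists_mem_ne_one x
  have hh2 : h ^ 2 ≠ 1 := fun h2 => hh1 (by
    have h3 := C.pow_eq_one hh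
    rw [pow_succ, h2, one_mul] at h3; exact h3)
  have hxa : ∀ k ∈ C.H x, m x ≠ m (k • a) := fun k hk e => ha (by
    have := (hmc _ _).1 e
    rwa [← C.com_smul_iff k, C.com_refl x k hk])
  have hne : ∀ k ∈ C.H x, k ≠ 1 → m a ≠ m (k • a) := fun k hk hk1 e =>
    C.not_com_smul_of_not_com hf ha hk hk1 ((hmc _ _).1 e)
  have hfix : ∀ k ∈ C.H x, z • m (k • a) = m (k • a) := fun k hk => by
    rw [hm, smul_smul, (hzc k hk).eq, mul_smul, hza]
  have h3 : m (h • a) ≠ m (h ^ 2 • a) := fun e => by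
    rw [pow_two, mul_smul, hm, hm h (h • a)] at e
    exact hne h hh hh1 (MulAction.injective h e)
  refine ⟨{m x, m a, m (h • a), m (h ^ 2 • a)}, ?_, ?_⟩
  · rw [Finset.card_insert_of_notMem, Finset.card_eq_three.2 ⟨_, _, _, hne h hh hh1,
      hne _ (pow_mem hh 2) hh2, h3, rfl⟩]
    simp only [Finset.mem_insert, Finset.mem_singleton, not_or]
    exact ⟨by simpa using hxa 1 (one_mem _), hxa _ hh, hxa _ (pow_mem hh 2)⟩
  · intro y hy
    simp only [Finset.mem_insert, Finset.mem_singleton] at hy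
    rcases hy with rfl | rfl | rfl | rfl
    · exact hzx
    · exact hza
    · exact hfix _ hh
    · exact hfix _ (pow_mem hh 2)

theorem card_ne_fourteen_of_card_Z_eq_two' [Finite G] (C : SmallPrimeClass G X 3) {x : X}
    (hf : (C.Z x).card = 2) : Fintype.card X ≠ 14 := by
  intro h14
  obtain ⟨Y, _, _, m, _, _, hsurj, hm, hmc, hcard⟩ := C.exists_blocks hf
  have hY : Fintype.card Y = 7 := by omega
  have hdvd : (Fintype.card Y).factorial / 2 ∣ Nat.card G := by
    obtain ⟨a, ha⟩ := C.exists_not_com x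
    obtain ⟨x', hx'⟩ : ((C.Z x).erase x).Nonempty := by
      rw [← Finset.card_pos, Finset.card_erase_of_mem (C.mem_Z.2 (C.com_refl x))]
      omega
    rw [Finset.mem_erase, mem_Z] at hx'
    obtain ⟨φ, hφ, hφ'⟩ := C.exists_injective_hom_prod hx'.1.symm hx'.2
    have hninj : ¬ Function.Injective fun p : C.H x × C.H x' => φ p • m a := fun hinj => by
      have := Nat.card_le_card_of_injective _ hinj
      rw [Nat.card_prod, C.card_H, C.card_H, Nat.card_eq_fintype_card (α := Y), hY] at this
      omega
    simp only [Function.Injective, not_forall] at hninj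
    obtain ⟨p, p', hpp, hne⟩ := hninj
    have hz1 : φ (p'⁻¹ * p) ≠ 1 := fun e => hne (inv_mul_eq_one.1
      (hφ (e.trans (map_one φ).symm))).symm
    have hza : φ (p'⁻¹ * p) • m a = m a := by
      rw [map_mul, mul_smul, hpp, map_inv, inv_smul_smul]
    have hzx : φ (p'⁻¹ * p) • x = x := by
      rw [hφ', mul_smul, hx'.2.symm _ (p'⁻¹ * p).2.2, C.com_refl x _ (p'⁻¹ * p).1.2]
    have hzc : ∀ k ∈ C.H x, Commute (φ (p'⁻¹ * p)) k := fun k hk => by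
      rw [hφ']
      exact Commute.mul_left ((C.com_iff x x).1 (C.com_refl x) k hk _ (p'⁻¹ * p).1.2).symm
        ((C.com_iff x x').1 hx'.2 k hk _ (p'⁻¹ * p).2.2).symm
    obtain ⟨S, hS, hfix⟩ := exists_card_eq_four hm C hmc hf (by rw [← hm, hzx]) hzc ha hza
    exact factorial_div_two_dvd_card C.not_solvable (hY ▸ by norm_num) hz1 (by rw [hY, hS]) hfix
  rw [hY,
    ← card_mul_card_stabilizer x, h14, show Nat.factorial 7 / 2 = 14 * 180 from rfl] at hdvd
  have h5 : 5 ∣ Nat.card (stabilizer G x) :=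
    (show 5 ∣ 180 by decide).trans ((Nat.mul_dvd_mul_iff_left (by norm_num)).1 hdvd)
  have : Fact (Nat.Prime 5) := ⟨Nat.prime_five⟩
  obtain ⟨⟨g, hg⟩, hg5⟩ := exists_prime_orderOf_dvd_card' 5 h5
  rw [Subgroup.orderOf_mk] at hg5
  have hg5' : g ^ 5 = 1 := hg5 ▸ pow_orderOf_eq_one g
  have hg1 : g ^ 2 ≠ 1 := fun e => by
    have := orderOf_dvd_of_pow_eq_one e
    rw [hg5] at this
    omega
  have hgx : g ^ 2 • x = x := by rw [pow_two, mul_smul, hg, hg]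
  have hgc : ∀ k ∈ C.H x, Commute (g ^ 2) k := fun k hk => by
    by_cases hk1 : k = 1
    · rw [hk1]
      exact Commute.one_right _
    have hgk : g * k * g⁻¹ ∈ C.H x := by
      rw [← hg, C.mem_smul]
      simpa [mul_assoc] using hk
    have : g ^ 2 * k * (g ^ 2)⁻¹ = k := by
      rw [show g ^ 2 * k * (g ^ 2)⁻¹ = g * (g * k * g⁻¹) * g⁻¹ by
        rw [pow_two, mul_inv_rev]; simp only [mul_assoc]]
      rcases C.eq_or_of_mem (.inr rfl) hk hk1 hgk with h | h | h
      · exact absurd (conj_eq_one_iff.1 h) hk1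
      · rw [h, h]
      · rw [h, ← conj_inv, h, inv_inv]
    exact mul_inv_eq_iff_eq_mul.1 this
  have hcard : Nat.card (Subgroup.zpowers (g ^ 2)) = 5 ^ 1 := by
    rw [Nat.card_zpowers, pow_one]
    exact orderOf_eq_prime (by rw [← pow_mul, mul_comm, pow_mul, hg5', one_pow]) hg1
  have hmod := card_modEq_card_filter hcard (Finset.univ : Finset Y) (by simp)
  rw [Finset.card_univ, hY] at hmod
  have hmem : ∀ y : Y, (∀ k ∈ Subgroup.zpowers (g ^ 2), k • y = y) ↔ g ^ 2 • y = y := fun y =>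
    ⟨fun h => h _ (Subgroup.mem_zpowers _), fun h k hk =>
      (Subgroup.zpowers_le (H := stabilizer G y)).2 h hk⟩
  set F := Finset.univ.filter fun y : Y => ∀ k ∈ Subgroup.zpowers (g ^ 2), k • y = y with hF
  have hmF : ∀ y, y ∈ F ↔ g ^ 2 • y = y := fun y => by simp [hF, hmem]
  have hxF : m x ∈ F := (hmF _).2 (by rw [← hm, hgx])
  have hF7 : F.card ≤ 7 := hY ▸ Finset.card_le_univ F
  have hF0 : 0 < F.card := Finset.card_pos.2 ⟨_, hxF⟩
  rw [Nat.ModEq] at hmod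
  obtain ⟨y, hy, hyx⟩ := Finset.exists_mem_ne (show 1 < F.card by omega) (m x)
  obtain ⟨a, rfl⟩ := hsurj y
  obtain ⟨S, hS, hfix⟩ := exists_card_eq_four hm C hmc hf ((hmF _).1 hxF) hgc
    (fun hc => hyx ((hmc _ _).2 hc).symm) ((hmF _).1 hy)
  have hSF := Finset.card_le_card (show S ⊆ F from fun y hy => (hmF y).2 (hfix y hy))
  have huniv : F = Finset.univ := Finset.eq_univ_of_card _ (by omega)
  exact hg1 (eq_one_of_forall_smul_eq fun y : Y => (hmF y).1 (huniv ▸ Finset.mem_univ y))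

/-- Distinct members of the class do not commute. -/
theorem card_Z_eq_one [Finite G] (x : X) : (C.Z x).card = 1 := by
  refine (C.card_Z_eq_one_or_eq_two x).resolve_right fun hf => ?_
  obtain ⟨Y, _, _, m, _, _, -, -, -, hcard⟩ := C.exists_blocks hf
  have h5 : 5 ≤ Fintype.card Y := by
    by_contra h
    obtain ⟨y, y', hy⟩ := exists_pair_ne Y
    obtain ⟨g, rfl⟩ := exists_smul_eq G y y'
    exact hy (smul_eq_of_card_le_four C.not_solvable
      (by rw [Nat.card_eq_fintype_card]; omega) g y).symm
  have h14 := C.card_le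
  have hdvd := C.dvd_card_compl x
  have hp := C.prime
  rw [hf] at hdvd
  have hq12 := Nat.le_of_dvd (by omega) hdvd
  rcases (by omega : Fintype.card X = 10 ∨ Fintype.card X = 12 ∨ Fintype.card X = 14) with h | h | h
  · rw [h] at hdvd
    have : q = 2 := (Nat.prime_dvd_prime_iff_eq hp Nat.prime_two).1
      (hp.dvd_of_dvd_pow (n := 3) hdvd)
    subst this
    exact C.card_ne_ten_of_card_Z_eq_two hf h
  · rw [h] at hdvd
    rcases hp.dvd_mul.1 (show q ∣ 2 * 5 from hdvd) with h' | h'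
    · obtain rfl := (Nat.prime_dvd_prime_iff_eq hp Nat.prime_two).1 h'
      have := C.four_dvd_card_compl x
      rw [hf, h] at this
      omega
    · obtain rfl := (Nat.prime_dvd_prime_iff_eq hp Nat.prime_five).1 h'
      exact C.card_ne_twelve_of_card_Z_eq_two hf h
  · rw [h] at hdvd
    rcases hp.dvd_mul.1 (show q ∣ 2 ^ 2 * 3 from hdvd) with h' | h'
    · obtain rfl := (Nat.prime_dvd_prime_iff_eq hp Nat.prime_two).1 (hp.dvd_of_dvd_pow h')
      exact C.card_ne_fourteen_of_card_Z_eq_two hf h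
    · obtain rfl := (Nat.prime_dvd_prime_iff_eq hp Nat.prime_three).1 h'
      exact C.card_ne_fourteen_of_card_Z_eq_two' hf h

theorem com_iff_eq [Finite G] {x y : X} : C.Com x y ↔ y = x := by
  obtain ⟨z, hz⟩ := Finset.card_eq_one.1 (C.card_Z_eq_one x)
  have hx : x ∈ C.Z x := C.mem_Z.2 (C.com_refl x)
  rw [hz, Finset.mem_singleton] at hx
  rw [← mem_Z, hz, Finset.mem_singleton, hx]

theorem Z_eq_singleton [Finite G] (x : X) : C.Z x = {x} := by
  ext y
  rw [mem_Z, com_iff_eq, Finset.mem_singleton]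

theorem smul_eq_iff_eq [Finite G] {x y : X} {k : G} (hk : k ∈ C.H x) (h1 : k ≠ 1) :
    k • y = y ↔ y = x :=
  ⟨fun h => C.com_iff_eq.1 (C.com_of_smul_eq hk h1 h), fun h => C.com_iff_eq.2 h k hk⟩

theorem card_modEq_one [Finite G] {x : X} {S : Finset X} (hS : ∀ k ∈ C.H x, ∀ y ∈ S, k • y ∈ S)
    (hx : x ∈ S) : S.card ≡ 1 [MOD q] := by
  have h := C.card_modEq_card_inter_Z x hS
  rwa [Z_eq_singleton, Finset.inter_singleton_of_mem hx, Finset.card_singleton] at h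

theorem dvd_card_of_notMem [Finite G] {x : X} {S : Finset X}
    (hS : ∀ k ∈ C.H x, ∀ y ∈ S, k • y ∈ S) (hx : x ∉ S) : q ∣ S.card :=
  C.dvd_card_of_disjoint x hS fun _ hy hc => hx (C.com_iff_eq.1 hc ▸ hy)

/-- The members of the class contained in a subgroup. -/
noncomputable def below (K : Subgroup G) : Finset X := Finset.univ.filter fun x => C.H x ≤ K

omit [IsSimpleGroup G] [IsPretransitive G X] in
theorem mem_below {K : Subgroup G} {x : X} : x ∈ C.below K ↔ C.H x ≤ K := by simp [below]

omit [IsSimpleGroup G] [IsPretransitive G X] in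
theorem smul_mem_below {K : Subgroup G} {x : X} {k : G} (hk : k ∈ K) (hx : x ∈ C.below K) :
    k • x ∈ C.below K := by
  rw [mem_below] at hx ⊢
  intro l hl
  rw [C.mem_smul] at hl
  have := mul_mem (mul_mem hk (hx hl)) (inv_mem hk)
  simpa [mul_assoc] using this

theorem card_below_modEq_one [Finite G] {K : Subgroup G} {x : X} (hx : x ∈ C.below K) :
    (C.below K).card ≡ 1 [MOD q] :=
  C.card_modEq_one (fun _ hk _ hy => C.smul_mem_below (C.mem_below.1 hx hk) hy) hx

/-- A subgroup permutes transitively the members of the class it contains. -/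
theorem exists_smul_eq_of_mem_below [Finite G] {K : Subgroup G} {x y : X} (hx : x ∈ C.below K)
    (hy : y ∈ C.below K) : ∃ k ∈ K, k • x = y := by
  by_contra! h
  have hS : ∀ k ∈ K, ∀ z ∈ Finset.univ.filter fun z => ∃ l ∈ K, l • x = z,
      k • z ∈ Finset.univ.filter fun z => ∃ l ∈ K, l • x = z := by
    simp only [Finset.mem_filter, Finset.mem_univ, true_and]
    rintro k hk _ ⟨l, hl, rfl⟩
    exact ⟨k * l, mul_mem hk hl, mul_smul _ _ _⟩
  have h1 := C.card_modEq_one (x := x) (fun k hk => hS k (C.mem_below.1 hx hk))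
    (by simpa using ⟨1, one_mem _, one_smul _ _⟩)
  have h0 := C.dvd_card_of_notMem (x := y) (fun k hk => hS k (C.mem_below.1 hy hk)) (by simpa)
  exact C.prime.one_lt.ne' (Nat.dvd_one.1 ((h1.dvd_iff dvd_rfl).1 h0))

omit [IsSimpleGroup G] [IsPretransitive G X] [Fintype X] in
theorem ncard_orbit_mul_card_inf_stabilizer (K : Subgroup G) (x : X) :
    (orbit K x).ncard * Nat.card (K ⊓ stabilizer G x : Subgroup G) = Nat.card K := by
  have h := Nat.card_congr (orbitEquivQuotientStabilizer K x)
  rw [Nat.card_coe_set_eq] at h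
  have hstab : Nat.card (stabilizer K x) = Nat.card (K ⊓ stabilizer G x : Subgroup G) := by
    rw [Nat.card_congr (Subgroup.equivMapOfInjective (stabilizer K x) K.subtype
      K.subtype_injective).toEquiv]
    congr 2
    ext g
    simp only [Subgroup.mem_map, Subgroup.mem_inf, mem_stabilizer_iff, Subgroup.subtype_apply]
    exact ⟨by rintro ⟨k, hk, rfl⟩; exact ⟨k.2, hk⟩, fun h => ⟨⟨g, h.1⟩, h.2, rfl⟩⟩
  rw [h, ← hstab, ← Subgroup.card_eq_card_quotient_mul_card_subgroup]

theorem card_below_mul_card_inf_stabilizer [Finite G] {K : Subgroup G} {x : X}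
    (hx : x ∈ C.below K) :
    (C.below K).card * Nat.card (K ⊓ stabilizer G x : Subgroup G) = Nat.card K := by
  have horb : orbit K x = C.below K := by
    ext y
    constructor
    · rintro ⟨k, rfl⟩
      exact C.smul_mem_below k.2 hx
    · intro hy
      obtain ⟨k, hk, rfl⟩ := C.exists_smul_eq_of_mem_below hx hy
      exact ⟨⟨k, hk⟩, rfl⟩
  rw [← ncard_orbit_mul_card_inf_stabilizer K x, horb, Set.ncard_coe_finset]

omit [IsPretransitive G X] in
theorem eq_top_of_card_below_eq [Finite G] [Nonempty X] {K : Subgroup G}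
    (h : (C.below K).card = Fintype.card X) :
    K = ⊤ :=
  C.eq_top_of_forall_H_le fun y => C.mem_below.1 (by
    rw [Finset.eq_univ_of_card _ h]; exact Finset.mem_univ y)

omit [IsSimpleGroup G] [IsPretransitive G X] in
theorem stabilizer_eq_normalizer (x : X) :
    stabilizer G x = Subgroup.normalizer (C.H x : Set G) := by
  ext g
  rw [mem_stabilizer_iff, Subgroup.mem_normalizer_iff]
  constructor
  · intro h k
    have := C.mem_smul (g := g) (x := x) (k := g * k * g⁻¹)
    rw [h] at this
    simpa [mul_assoc] using this.symm
  · intro h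
    rw [C.smul_eq_iff]
    exact fun k hk => (h k).1 hk

omit [IsSimpleGroup G] [IsPretransitive G X] in
theorem centralizer_le_stabilizer (x : X) :
    Subgroup.centralizer (C.H x : Set G) ≤ stabilizer G x := by
  rw [stabilizer_eq_normalizer]
  exact Subgroup.centralizer_le_normalizer _

omit [IsSimpleGroup G] [IsPretransitive G X] in
theorem card_stabilizer_dvd [Finite G] (x : X) : Nat.card (stabilizer G x) ∣
    Nat.card (Subgroup.centralizer (C.H x : Set G)) * (q - 1) := by
  have hcyc : IsCyclic (C.H x) := by
    have := Fact.mk C.prime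
    exact isCyclic_of_prime_card (C.card_H x)
  rw [stabilizer_eq_normalizer, ← Subgroup.card_mul_index (C.H x).normalizerMonoidHom.ker,
    Subgroup.index_ker]
  refine Nat.mul_dvd_mul ?_ ?_
  · rw [Subgroup.normalizerMonoidHom_ker]
    exact dvd_of_eq (Nat.card_congr (Subgroup.subgroupOfEquivOfLe
      (Subgroup.centralizer_le_normalizer _)).toEquiv)
  · have := Subgroup.card_subgroup_dvd_card (C.H x).normalizerMonoidHom.range
    rwa [IsCyclic.card_mulAut, C.card_H, Nat.totient_prime C.prime] at this

omit [MulAction G X] [IsSimpleGroup G] [IsPretransitive G X] [Fintype X] in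
theorem mem_centralizer_of_mem_normalizer [Finite G] {P : Subgroup G} (hP : (Nat.card P).Prime)
    {g : G} (hg : g ∈ Subgroup.normalizer (P : Set G))
    (hco : (orderOf g).Coprime (Nat.card P - 1)) : g ∈ Subgroup.centralizer (P : Set G) := by
  have hcyc : IsCyclic P := by
    have := Fact.mk hP
    exact isCyclic_of_prime_card rfl
  have h : (⟨g, hg⟩ : Subgroup.normalizer (P : Set G)) ∈ P.normalizerMonoidHom.ker := by
    rw [MonoidHom.mem_ker, ← orderOf_eq_one_iff]
    refine Nat.eq_one_of_dvd_coprimes hco ?_ ?_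
    · refine (orderOf_map_dvd _ _).trans ?_
      rw [Subgroup.orderOf_mk]
    · have := orderOf_dvd_natCard (P.normalizerMonoidHom ⟨g, hg⟩)
      rwa [IsCyclic.card_mulAut, Nat.totient_prime hP] at this
  rwa [Subgroup.normalizerMonoidHom_ker, Subgroup.mem_subgroupOf] at h

omit [IsSimpleGroup G] [IsPretransitive G X] in
theorem mem_centralizer_of_coprime [Finite G] {x : X} {g : G} (hg : g • x = x)
    (hco : (orderOf g).Coprime (q - 1)) : g ∈ Subgroup.centralizer (C.H x : Set G) :=
  mem_centralizer_of_mem_normalizer (by rw [C.card_H]; exact C.prime)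
    (by rwa [← stabilizer_eq_normalizer]) (by rwa [C.card_H])

/-- The fixed points of a group element. -/
noncomputable def fixed (X : Type*) [MulAction G X] [Fintype X] (g : G) : Finset X :=
  Finset.univ.filter fun y => g • y = y

omit [IsSimpleGroup G] [IsPretransitive G X] in
theorem mem_fixed {g : G} {y : X} : y ∈ fixed X g ↔ g • y = y := by simp [fixed]

omit [IsSimpleGroup G] [IsPretransitive G X] in
theorem card_modEq_card_fixed {r : ℕ} (hr : r.Prime) {g : G} (hg : orderOf g = r) :
    Fintype.card X ≡ (fixed X g).card [MOD r] := by
  have := Fact.mk hr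
  have h := card_modEq_card_filter (p := r) (n := 1) (K := Subgroup.zpowers g)
    (by rw [Nat.card_zpowers, hg, pow_one]) (Finset.univ : Finset X) (by simp)
  rw [Finset.card_univ] at h
  convert h using 3
  ext y
  rw [mem_fixed, Finset.mem_filter]
  exact ⟨fun h => ⟨Finset.mem_univ y, fun k hk =>
      (Subgroup.zpowers_le (H := stabilizer G y)).2 h hk⟩,
    fun h => h.2 g (Subgroup.mem_zpowers g)⟩

include C in
theorem nontrivial_of_mem (x : X) : Nontrivial X := by
  have : Nonempty X := ⟨x⟩
  have := C.five_le_card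
  exact Fintype.one_lt_card_iff_nontrivial.1 (by omega)

theorem card_fixed_lt [Nontrivial X] {g : G} (h1 : g ≠ 1) : (fixed X g).card < Fintype.card X := by
  refine (Finset.card_le_univ _).lt_of_ne fun h => h1 ?_
  exact eq_one_of_forall_smul_eq fun y : X => mem_fixed.1 (by
    rw [Finset.eq_univ_of_card _ h]; exact Finset.mem_univ y)

include C in
omit [IsPretransitive G X] in
theorem four_dvd_card_sub_card_fixed {g : G} (hg : orderOf g = 2) :
    4 ∣ Fintype.card X - (fixed X g).card := by
  have hs := sign_toPerm_eq_one C.not_solvable (Y := X) g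
  rw [Equiv.Perm.sign_of_pow_two_eq_one (by rw [← map_pow, ← hg, pow_orderOf_eq_one, map_one])]
    at hs
  have hfix : Fintype.card (Function.fixedPoints (toPermHom G X g)) = (fixed X g).card := by
    rw [← Fintype.card_coe]
    exact Fintype.card_congr (Equiv.subtypeEquivRight fun y => mem_fixed.symm)
  rw [hfix] at hs
  have hmod := (Nat.modEq_iff_dvd' (Finset.card_le_univ _)).1
    (card_modEq_card_fixed Nat.prime_two hg (X := X)).symm
  obtain ⟨m, hm⟩ := hmod
  rw [hm, Nat.mul_div_cancel_left _ two_pos] at hs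
  rcases Nat.even_or_odd m with ⟨j, rfl⟩ | hodd
  · rw [hm]
    exact ⟨j, by ring⟩
  · rw [hodd.neg_one_pow] at hs
    exact absurd hs (by decide)

theorem card_fixed_modEq_one [Finite G] {x : X} {g : G}
    (hg : g ∈ Subgroup.centralizer (C.H x : Set G)) : (fixed X g).card ≡ 1 [MOD q] := by
  refine C.card_modEq_one (x := x) (fun k hk y hy => ?_)
    (mem_fixed.2 (C.centralizer_le_stabilizer x hg))
  rw [mem_fixed] at hy ⊢
  rw [smul_smul, ← Subgroup.mem_centralizer_iff.1 hg k hk, mul_smul, hy]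

omit [IsSimpleGroup G] [IsPretransitive G X] in
theorem fixed_eq_below [Finite G] {g : G} (hg : (orderOf g).Coprime (q - 1)) :
    fixed X g = C.below (Subgroup.centralizer {g}) := by
  ext y
  rw [mem_fixed, mem_below]
  constructor
  · intro h k hk
    rw [Subgroup.mem_centralizer_singleton_iff]
    exact Subgroup.mem_centralizer_iff.1 (C.mem_centralizer_of_coprime h hg) k hk
  · intro h
    refine C.centralizer_le_stabilizer y (Subgroup.mem_centralizer_iff.2 fun k hk => ?_)
    exact Subgroup.mem_centralizer_singleton_iff.1 (h hk)

theorem not_dvd_card_centralizer [Finite G] {n r : ℕ} (hn : Fintype.card X = n) (hr : r.Prime)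
    (h : ∀ f < n, n ≡ f [MOD r] → ¬ f ≡ 1 [MOD q]) (x : X) :
    ¬ r ∣ Nat.card (Subgroup.centralizer (C.H x : Set G)) := by
  intro hdvd
  have := C.nontrivial_of_mem x
  have := Fact.mk hr
  obtain ⟨⟨g, hg⟩, hgr⟩ := exists_prime_orderOf_dvd_card' r hdvd
  rw [Subgroup.orderOf_mk] at hgr
  exact h _ (hn ▸ card_fixed_lt fun h1 => hr.ne_one (by rw [← hgr, h1, orderOf_one]))
    (hn ▸ card_modEq_card_fixed hr hgr) (C.card_fixed_modEq_one hg)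

theorem not_two_dvd_card_centralizer [Finite G] {n : ℕ} (hn : Fintype.card X = n)
    (h : ∀ f < n, 4 ∣ n - f → ¬ f ≡ 1 [MOD q]) (x : X) :
    ¬ 2 ∣ Nat.card (Subgroup.centralizer (C.H x : Set G)) := by
  intro hdvd
  have := C.nontrivial_of_mem x
  obtain ⟨⟨g, hg⟩, hgr⟩ := exists_prime_orderOf_dvd_card' 2 hdvd
  rw [Subgroup.orderOf_mk] at hgr
  exact h _ (hn ▸ card_fixed_lt fun h1 => by simp [h1] at hgr)
    (hn ▸ C.four_dvd_card_sub_card_fixed hgr) (C.card_fixed_modEq_one hg)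

include C in
theorem not_dvd_card_stabilizer [Finite G] {n r : ℕ} (hn : Fintype.card X = n) (hr : r.Prime)
    (hq : r.Coprime (q - 1)) (h : ∀ f < n, n ≡ f [MOD r] → f ≠ 0 → ¬ f ≡ 1 [MOD q]) (x : X) :
    ¬ r ∣ Nat.card (stabilizer G x) := by
  intro hdvd
  have := C.nontrivial_of_mem x
  have := Fact.mk hr
  obtain ⟨⟨g, hg⟩, hgr⟩ := exists_prime_orderOf_dvd_card' r hdvd
  rw [Subgroup.orderOf_mk] at hgr
  have hx : x ∈ fixed X g := mem_fixed.2 hg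
  refine h _ (hn ▸ card_fixed_lt fun h1 => hr.ne_one (by rw [← hgr, h1, orderOf_one]))
    (hn ▸ card_modEq_card_fixed hr hgr) (Finset.card_pos.2 ⟨x, hx⟩).ne' ?_
  rw [C.fixed_eq_below (hgr.symm ▸ hq)] at hx ⊢
  exact C.card_below_modEq_one hx

include C in
theorem not_dvd_card [Finite G] [Nonempty X] {n r : ℕ} (hn : Fintype.card X = n) (hr : r.Prime)
    (hq : r.Coprime (q - 1)) (h0 : ¬ r ∣ n)
    (h : ∀ f < n, n ≡ f [MOD r] → f ≠ 0 → ¬ f ≡ 1 [MOD q]) : ¬ r ∣ Nat.card G := by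
  obtain ⟨x⟩ := ‹Nonempty X›
  rw [← card_mul_card_stabilizer x, hn, hr.dvd_mul, not_or]
  exact ⟨h0, C.not_dvd_card_stabilizer hn hr hq h x⟩

omit [Fintype X] [MulAction G X] [IsPretransitive G X] [IsSimpleGroup G] in
theorem ne_top_of_isPGroup [Finite G] (hns : ¬ Group.IsSolvable G) {r : ℕ} [Fact r.Prime]
    {P : Subgroup G} (hP : IsPGroup r P) : P ≠ ⊤ := by
  rintro rfl
  refine hns ?_
  have : Group.IsNilpotent (⊤ : Subgroup G) := hP.isNilpotent
  exact Group.isSolvable_of_surjective (f := (⊤ : Subgroup G).subtype)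
      (fun g => ⟨⟨g, trivial⟩, rfl⟩)

omit [Fintype X] [MulAction G X] [IsPretransitive G X] in
theorem five_le_card_sylow [Finite G] (hns : ¬ Group.IsSolvable G) {r : ℕ} [Fact r.Prime]
    (hr : r ∣ Nat.card G) : 5 ≤ Nat.card (Sylow r G) := by
  by_contra! h
  have hfix := smul_eq_of_card_le_four hns (Y := Sylow r G) (by omega)
  let P : Sylow r G := default
  have hN : (P : Subgroup G).Normal := by
    rw [← Subgroup.normalizer_eq_top_iff, eq_top_iff]
    exact fun g _ => Sylow.smul_eq_iff_mem_normalizer.1 (hfix g P)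
  rcases hN.eq_bot_or_eq_top with h | h
  · exact P.ne_bot_of_dvd_card hr h
  · exact ne_top_of_isPGroup hns P.2 h

omit [Fintype X] [MulAction G X] [IsPretransitive G X] in
/-- Burnside: no Sylow subgroup is central in its normaliser. -/
theorem not_normalizer_le_centralizer [Finite G] (hns : ¬ Group.IsSolvable G) {r : ℕ} [Fact r.Prime]
    (hr : r ∣ Nat.card G) (P : Sylow r G) :
    ¬ Subgroup.normalizer (P : Set G) ≤ Subgroup.centralizer (P : Set G) := by
  intro hP
  have hc := MonoidHom.ker_transferSylow_isComplement' P hP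
  rcases (inferInstance : (MonoidHom.transferSylow P hP).ker.Normal).eq_bot_or_eq_top with h | h
  · rw [h, Subgroup.isComplement'_bot_left] at hc
    exact ne_top_of_isPGroup hns P.2 hc
  · rw [h, Subgroup.isComplement'_top_left] at hc
    exact P.ne_bot_of_dvd_card hr hc

omit [IsSimpleGroup G] [IsPretransitive G X] in
theorem ncard_orbit_le (K : Subgroup G) (x : X) : (orbit K x).ncard ≤ Fintype.card X := by
  rw [← Nat.card_eq_fintype_card, ← Set.ncard_univ]
  exact Set.ncard_le_ncard (Set.subset_univ _)

omit [Fintype X] in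
theorem card_dvd_factorial [Fintype X] [Nontrivial X] :
    Nat.card G ∣ (Fintype.card X).factorial := by
  have := Subgroup.card_dvd_of_injective (toPermHom G X) toPermHom_injective
  rwa [Nat.card_perm, Nat.card_eq_fintype_card (α := X)] at this

theorem card_stabilizer_dvd_factorial {n : ℕ} (hn : Fintype.card X = n + 1) [Nontrivial X] (x : X) :
    Nat.card (stabilizer G x) ∣ n.factorial := by
  have h := card_dvd_factorial (G := G) (X := X)
  rw [← card_mul_card_stabilizer (G := G) x, hn, Nat.factorial_succ] at h
  exact (Nat.mul_dvd_mul_iff_left n.succ_pos).1 h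

omit [Fintype X] [MulAction G X] [IsPretransitive G X] [IsSimpleGroup G] in
theorem card_sylow_dvd_card [Finite G] (r : ℕ) [Fact r.Prime] :
    Nat.card (Sylow r G) ∣ Nat.card G := by
  rw [(default : Sylow r G).card_eq_index_normalizer]
  exact Subgroup.index_dvd_card _

omit [IsSimpleGroup G] in
theorem card_sylow_dvd_card_stabilizer [Finite G] [Fact (Fintype.card X).Prime] (x : X) :
    Nat.card (Sylow (Fintype.card X) G) ∣ Nat.card (stabilizer G x) := by
  have h := card_sylow_dvd_card (G := G) (Fintype.card X)
  rw [← card_mul_card_stabilizer (G := G) x] at h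
  refine Nat.Coprime.dvd_of_dvd_mul_left ?_ h
  refine Nat.Coprime.symm (((Nat.Prime.coprime_iff_not_dvd Fact.out).2 fun hd => ?_))
  exact (Fact.out : (Fintype.card X).Prime).one_lt.ne'
    (Nat.dvd_one.1 (((card_sylow_modEq_one (Fintype.card X) G).dvd_iff dvd_rfl).1 hd))

omit [IsSimpleGroup G] [IsPretransitive G X] [Fintype X] [MulAction G X] in
theorem _root_.Nat.dvd_of_dvd_mul_of_not_dvd {p k a b : ℕ} (hp : p.Prime) (h : a ∣ p ^ k * b)
    (hpa : ¬ p ∣ a) : a ∣ b :=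
  Nat.Coprime.dvd_of_dvd_mul_left
    ((Nat.Coprime.pow_left k ((hp.coprime_iff_not_dvd).2 hpa)).symm) h

omit [Fintype X] [MulAction G X] [IsPretransitive G X] in
theorem card_normalizer_sylow_ne [Finite G] (hns : ¬ Group.IsSolvable G) {r : ℕ} [Fact r.Prime]
    (hr : r ∣ Nat.card G) (P : Sylow r G) : Nat.card (Subgroup.normalizer (P : Set G)) ≠ r := by
  intro h
  refine not_normalizer_le_centralizer hns hr P fun g hg => ?_
  have := isCyclic_of_prime_card h
  have := IsCyclic.isMulCommutative (α := Subgroup.normalizer (P : Set G))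
  rw [Subgroup.mem_centralizer_iff]
  intro k hk
  exact congrArg Subtype.val (this.is_comm.comm ⟨k, Subgroup.le_normalizer hk⟩ ⟨g, hg⟩)

theorem card_ne_seven [Finite G] (C : SmallPrimeClass G X 3) (x : X) : Fintype.card X ≠ 7 := by
  intro h7
  have := C.nontrivial_of_mem x
  have h2 := C.not_two_dvd_card_centralizer h7 (by decide) x
  have h5 := C.not_dvd_card_centralizer h7 Nat.prime_five (by decide) x
  have hC : Nat.card (Subgroup.centralizer (C.H x : Set G)) ∣ 9 :=
    Nat.dvd_of_dvd_mul_of_not_dvd (k := 1) Nat.prime_five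
      (Nat.dvd_of_dvd_mul_of_not_dvd (k := 4) Nat.prime_two
        ((Subgroup.card_dvd_of_le (C.centralizer_le_stabilizer x)).trans
          (card_stabilizer_dvd_factorial h7 x)) h2) h5
  have hN := (C.card_stabilizer_dvd x).trans (Nat.mul_dvd_mul_right hC _)
  have hf : Fact (Fintype.card X).Prime := ⟨h7 ▸ by norm_num⟩
  have hs := (card_sylow_dvd_card_stabilizer (G := G) x).trans hN
  have hs1 := card_sylow_modEq_one (Fintype.card X) G
  have hs5 := five_le_card_sylow C.not_solvable (r := Fintype.card X)
    (by rw [← card_mul_card_stabilizer (G := G) x]; exact Dvd.intro _ rfl)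
  generalize Nat.card (Sylow (Fintype.card X) G) = s at *
  rw [h7, Nat.ModEq] at hs1
  have := Nat.le_of_dvd (by norm_num) hs
  interval_cases s <;> revert hs hs1 <;> decide

theorem card_ne_eleven [Finite G] (C : SmallPrimeClass G X 5) (x : X) : Fintype.card X ≠ 11 := by
  intro h11
  have := C.nontrivial_of_mem x
  have h2 := C.not_two_dvd_card_centralizer h11 (by decide) x
  have h3 := C.not_dvd_card_centralizer h11 Nat.prime_three (by decide) x
  have h7 := C.not_dvd_card_centralizer h11 (r := 7) (by norm_num) (by decide) x
  have hC : Nat.card (Subgroup.centralizer (C.H x : Set G)) ∣ 25 :=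
    Nat.dvd_of_dvd_mul_of_not_dvd (k := 1) (p := 7) (by norm_num)
      (Nat.dvd_of_dvd_mul_of_not_dvd (k := 4) Nat.prime_three
        (Nat.dvd_of_dvd_mul_of_not_dvd (k := 8) Nat.prime_two
          ((Subgroup.card_dvd_of_le (C.centralizer_le_stabilizer x)).trans
            (card_stabilizer_dvd_factorial h11 x)) h2) h3) h7
  have hN := (C.card_stabilizer_dvd x).trans (Nat.mul_dvd_mul_right hC _)
  have hf : Fact (Fintype.card X).Prime := ⟨h11 ▸ by norm_num⟩
  have hs := (card_sylow_dvd_card_stabilizer (G := G) x)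
  have hs1 := card_sylow_modEq_one (Fintype.card X) G
  have hdvd : Fintype.card X ∣ Nat.card G := by
    rw [← card_mul_card_stabilizer (G := G) x]; exact Dvd.intro _ rfl
  have hs5 := five_le_card_sylow C.not_solvable (r := Fintype.card X) hdvd
  have hs100 : Nat.card (Sylow (Fintype.card X) G) = 100 := by
    have hs := hs.trans hN
    generalize Nat.card (Sylow (Fintype.card X) G) = s at *
    rw [h11, Nat.ModEq] at hs1
    have hmem : s ∈ Nat.divisors 100 := by simpa using hs
    rw [show Nat.divisors 100 = {1, 2, 4, 5, 10, 20, 25, 50, 100} by decide +kernel] at hmem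
    simp only [Finset.mem_insert, Finset.mem_singleton] at hmem
    omega
  have hcard : Nat.card (stabilizer G x) = 100 := by
    rw [hs100] at hs
    exact Nat.dvd_antisymm hN hs
  refine card_normalizer_sylow_ne C.not_solvable hdvd default ?_
  have h := Subgroup.index_mul_card
    (Subgroup.normalizer ((default : Sylow (Fintype.card X) G) : Set G))
  rw [← Sylow.card_eq_index_normalizer, hs100, ← card_mul_card_stabilizer (G := G) x, hcard,
    mul_comm] at h
  exact Nat.eq_of_mul_eq_mul_right (by norm_num) h

theorem card_ne_nine [Finite G] (C : SmallPrimeClass G X 2) (x : X) : Fintype.card X ≠ 9 := by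
  intro h9
  have := C.nontrivial_of_mem x
  have : Nonempty X := ⟨x⟩
  have h5 := C.not_dvd_card h9 Nat.prime_five (by decide) (by decide) (by decide)
  have h7 := C.not_dvd_card h9 (r := 7) (by norm_num) (by decide) (by decide) (by decide)
  obtain ⟨y, hy⟩ := exists_ne x
  have hodd : ¬ 2 ∣ Nat.card (stabilizer G x ⊓ stabilizer G y : Subgroup G) := by
    intro hdvd
    obtain ⟨⟨g, hg⟩, hgr⟩ := exists_prime_orderOf_dvd_card' 2 hdvd
    rw [Subgroup.orderOf_mk] at hgr
    have hf4 := C.four_dvd_card_sub_card_fixed hgr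
    have hlt := card_fixed_lt (X := X) (g := g) fun h1 => by simp [h1] at hgr
    have hx : x ∈ fixed X g := mem_fixed.2 hg.1
    have h1 := Finset.one_lt_card.2 ⟨x, hx, y, mem_fixed.2 hg.2, hy.symm⟩
    rw [C.fixed_eq_below (by rw [hgr]; decide)] at hx hf4 hlt h1
    have hd := (Dvd.intro _ (C.card_below_mul_card_inf_stabilizer hx)).trans
      (Subgroup.card_subgroup_dvd_card _)
    rw [show (C.below (Subgroup.centralizer {g})).card = 5 by omega] at hd
    exact h5 hd
  have h16 : ¬ 2 ^ 4 ∣ Nat.card G := by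
    intro hd
    rw [← card_mul_card_stabilizer (G := G) x, h9] at hd
    have hd := Nat.Coprime.dvd_of_dvd_mul_left (by decide) hd
    rw [← ncard_orbit_mul_card_inf_stabilizer _ y] at hd
    have hd := Nat.Coprime.dvd_of_dvd_mul_right
      (Nat.Coprime.pow_left 4 ((Nat.prime_two.coprime_iff_not_dvd).2 hodd)) hd
    have hpos : 0 < (orbit (stabilizer G x) y).ncard :=
      (Set.ncard_pos).2 ⟨y, mem_orbit_self y⟩
    have := Nat.le_of_dvd hpos hd
    have := ncard_orbit_le (stabilizer G x) y
    omega
  have hs1 := card_sylow_modEq_one 3 G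
  have hs5 := five_le_card_sylow C.not_solvable (r := 3) (by
    rw [← card_mul_card_stabilizer (G := G) x, h9]; exact Dvd.dvd.mul_right (by decide) _)
  have hs := card_sylow_dvd_card (G := G) 3
  have hf := card_dvd_factorial (G := G) (X := X)
  rw [h9] at hf
  have hf' : Nat.card (Sylow 3 G) ∣ 2 ^ 7 :=
    Nat.dvd_of_dvd_mul_of_not_dvd (k := 4) Nat.prime_three
      (Nat.dvd_of_dvd_mul_of_not_dvd (k := 1) (p := 7) (by norm_num)
        (Nat.dvd_of_dvd_mul_of_not_dvd (k := 1) Nat.prime_five (hs.trans hf)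
          fun h => h5 (h.trans hs))
        fun h => h7 (h.trans hs))
      fun h => by
        rw [Nat.ModEq] at hs1; omega
  obtain ⟨k, hk, hk'⟩ := (Nat.dvd_prime_pow Nat.prime_two).1 hf'
  rw [hk', Nat.ModEq] at hs1
  rw [hk'] at hs hs5
  have hk4 : k < 4 := by
    by_contra! h
    exact h16 ((pow_dvd_pow 2 h).trans hs)
  interval_cases k <;> omega

omit [Fintype X] [MulAction G X] [IsSimpleGroup G] [IsPretransitive G X] in
theorem conj_zpow_eq_of_involutions {s t : G} (hs : s * s = 1) (ht : t * t = 1) (i : ℤ) :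
    s * (s * t) ^ i = (s * t) ^ (-i) * s := by
  have h : s * (s * t) * s⁻¹ = (s * t)⁻¹ := by
    rw [mul_inv_rev, inv_eq_of_mul_eq_one_right hs, inv_eq_of_mul_eq_one_right ht,
      ← mul_assoc s s t, hs, one_mul]
  rw [zpow_neg, ← inv_zpow, ← h, conj_zpow]
  group

omit [Fintype X] [MulAction G X] [IsSimpleGroup G] [IsPretransitive G X] in
theorem exists_zpow_of_mem_closure_involutions {s t : G} (hs : s * s = 1) (ht : t * t = 1) {k : G}
    (hk : k ∈ Subgroup.closure {s, t}) : ∃ i : ℤ, k = (s * t) ^ i ∨ k = (s * t) ^ i * s := by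
  have hs' := inv_eq_of_mul_eq_one_right hs
  have ht' := inv_eq_of_mul_eq_one_right ht
  have hmul (i : ℤ) := conj_zpow_eq_of_involutions hs ht i
  have htt : t = (s * t) ^ (-1 : ℤ) * s := by
    rw [zpow_neg_one, mul_inv_rev, hs', ht', mul_assoc, hs, mul_one]
  induction hk using Subgroup.closure_induction with
  | mem x hx =>
    rcases hx with rfl | rfl
    · exact ⟨0, Or.inr (by simp)⟩
    · exact ⟨-1, Or.inr htt⟩
  | one => exact ⟨0, Or.inl (by simp)⟩
  | mul x y _ _ hx hy =>
    obtain ⟨i, rfl | rfl⟩ := hx <;> obtain ⟨j, rfl | rfl⟩ := hy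
    · exact ⟨i + j, Or.inl (zpow_add _ _ _).symm⟩
    · exact ⟨i + j, Or.inr (by rw [zpow_add, mul_assoc])⟩
    · exact ⟨i - j, Or.inr (by rw [mul_assoc, hmul, sub_eq_add_neg, zpow_add, mul_assoc])⟩
    · refine ⟨i - j, Or.inl ?_⟩
      rw [mul_assoc, ← mul_assoc s, hmul, mul_assoc _ s s, hs, mul_one, sub_eq_add_neg, zpow_add]
  | inv x _ hx =>
    obtain ⟨i, rfl | rfl⟩ := hx
    · exact ⟨-i, Or.inl (zpow_neg _ _).symm⟩
    · refine ⟨i, Or.inr ?_⟩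
      rw [mul_inv_rev, hs', ← zpow_neg, hmul, neg_neg]

/-- Two involutions in distinct members of the class have a product of odd order. -/
theorem odd_orderOf_mul [Finite G] (C : SmallPrimeClass G X 2) {x y : X} {s t : G}
    (hs : s ∈ C.H x) (hs1 : s ≠ 1) (ht : t ∈ C.H y) (ht1 : t ≠ 1) : Odd (orderOf (s * t)) := by
  have hss : s * s = 1 := by rw [← pow_two]; exact C.pow_eq_one hs
  have htt : t * t = 1 := by rw [← pow_two]; exact C.pow_eq_one ht
  have hle {z : X} {u : G} (hu : u ∈ C.H z) (hu1 : u ≠ 1) (hm : u ∈ Subgroup.closure {s, t}) :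
      z ∈ C.below (Subgroup.closure {s, t}) := C.mem_below.2 fun l hl => by
    obtain ⟨i, -, rfl⟩ := C.eq_pow_of_mem hu hu1 hl
    exact pow_mem hm i
  obtain ⟨k, hk, rfl⟩ := C.exists_smul_eq_of_mem_below
    (hle hs hs1 (Subgroup.subset_closure (by simp)))
        (hle ht ht1 (Subgroup.subset_closure (by simp)))
  rw [C.mem_smul] at ht
  have hts : t = k * s * k⁻¹ := by
    obtain ⟨i, hi, h⟩ := C.eq_pow_of_mem hs hs1 ht
    interval_cases i
    · rw [pow_zero] at h
      exact absurd (by simpa [mul_assoc] using congrArg (fun g => k * g * k⁻¹) h) ht1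
    · rw [pow_one] at h
      rw [← h]
      group
  have key (i : ℤ) (h : t = (s * t) ^ i * s * ((s * t) ^ i)⁻¹) : Odd (orderOf (s * t)) := by
    have h2 : (s * t) ^ (2 * i + 1) = 1 := by
      rw [mul_assoc, ← zpow_neg, conj_zpow_eq_of_involutions hss htt, neg_neg, ← mul_assoc,
        ← zpow_add] at h
      have hst : s * t = s * (s * t) ^ (i + i) * s := by rw [mul_assoc, ← h]
      rw [conj_zpow_eq_of_involutions hss htt, mul_assoc, hss, mul_one] at hst
      rw [zpow_add, zpow_one, two_mul]
      nth_rw 2 [hst]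
      rw [zpow_neg, mul_inv_cancel]
    rw [← Nat.not_even_iff_odd, even_iff_two_dvd]
    intro hd
    have := (Int.natCast_dvd_natCast.2 hd).trans (orderOf_dvd_iff_zpow_eq_one.2 h2)
    omega
  obtain ⟨i, rfl | rfl⟩ := exists_zpow_of_mem_closure_involutions hss htt hk
  · exact key i hts
  · refine key i (hts.trans ?_)
    rw [mul_inv_rev, inv_eq_of_mul_eq_one_right hss, mul_assoc _ s s, hss, mul_one, mul_assoc]

theorem not_prime_card [Finite G] (C : SmallPrimeClass G X 2) (x : X) :
    ¬ (Fintype.card X).Prime := by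
  intro hn
  have := C.nontrivial_of_mem x
  have : Nonempty X := ⟨x⟩
  obtain ⟨y, hy⟩ := exists_ne x
  obtain ⟨s, hs, hs1⟩ := C.exists_mem_ne_one x
  obtain ⟨t, ht, ht1⟩ := C.exists_mem_ne_one y
  have hss : s * s = 1 := by rw [← pow_two]; exact C.pow_eq_one hs
  have htt : t * t = 1 := by rw [← pow_two]; exact C.pow_eq_one ht
  have hodd := C.odd_orderOf_mul hs hs1 ht ht1
  have hst : s * t ≠ 1 := fun h => hy <| (C.smul_eq_iff_eq hs hs1).1 <| by
    rw [eq_inv_of_mul_eq_one_left h, inv_eq_of_mul_eq_one_right htt]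
    exact (C.smul_eq_iff_eq ht ht1).2 rfl
  have hm1 : orderOf (s * t) ≠ 1 := mt orderOf_eq_one_iff.1 hst
  have hr := Nat.minFac_prime hm1
  have hrd := Nat.minFac_dvd (orderOf (s * t))
  generalize (orderOf (s * t)).minFac = r at hr hrd
  have hr2 : r ≠ 2 := by
    rintro rfl
    exact Nat.not_even_iff_odd.2 hodd (even_iff_two_dvd.2 hrd)
  obtain ⟨z, hz⟩ : ∃ z, z = (s * t) ^ (orderOf (s * t) / r) := ⟨_, rfl⟩
  have hzr : orderOf z = r := hz ▸ orderOf_pow_orderOf_div (orderOf_pos _).ne' hrd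
  have hsz : s * z = z⁻¹ * s := by
    rw [hz, ← zpow_natCast, conj_zpow_eq_of_involutions hss htt, zpow_neg]
  have htz : t * z = z⁻¹ * t := by
    have : t = s * (s * t) := by rw [← mul_assoc, hss, one_mul]
    rw [this, mul_assoc, ← mul_assoc z⁻¹, ← hsz, mul_assoc, mul_assoc]
    congr 1
    rw [hz, ← mul_assoc, ← pow_succ', ← pow_succ]
  by_cases hfix : (fixed X z).Nonempty
  · have hx : x ∈ fixed X z := by
      by_contra hx
      have hd := C.dvd_card_of_notMem (S := fixed X z) (x := x) (fun k hk w hw => by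
        rw [mem_fixed] at hw ⊢
        obtain ⟨i, hi, rfl⟩ := C.eq_pow_of_mem hs hs1 hk
        interval_cases i
        · rw [pow_zero, one_smul, hw]
        · rw [pow_one, smul_smul, show z * s = s * z⁻¹ by
            rw [eq_mul_inv_iff_mul_eq, mul_assoc, hsz, mul_inv_cancel_left], mul_smul,
            inv_smul_eq_iff.2 hw.symm]) hx
      obtain ⟨w, hw⟩ := hfix
      rw [C.fixed_eq_below (by simp)] at hd hw
      exact absurd (((C.card_below_modEq_one hw).dvd_iff dvd_rfl).1 hd) (by decide)
    have hc := Subgroup.mem_centralizer_iff.1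
      (C.mem_centralizer_of_coprime (mem_fixed.1 hx) (by simp)) s hs
    rw [hc, mul_left_inj, eq_inv_iff_mul_eq_one, ← pow_two] at hsz
    have := orderOf_dvd_of_pow_eq_one hsz
    rw [hzr] at this
    exact hr2 ((Nat.prime_dvd_prime_iff_eq hr Nat.prime_two).1 this)
  · rw [Finset.not_nonempty_iff_eq_empty] at hfix
    have hmod := card_modEq_card_fixed (X := X) hr hzr
    rw [hfix, Finset.card_empty, Nat.modEq_zero_iff_dvd, Nat.prime_dvd_prime_iff_eq hr hn] at hmod
    have := Fact.mk hn
    have horb := ncard_orbit_mul_card_inf_stabilizer (Subgroup.zpowers z) x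
    rw [Nat.card_zpowers, hzr, hmod] at horb
    have huniv : orbit (Subgroup.zpowers z) x = Set.univ := by
      rcases (Nat.dvd_prime hn).1 (Dvd.intro _ horb) with h | h
      · obtain ⟨w, hw⟩ := Set.ncard_eq_one.1 h
        have h1 : z • x ∈ orbit (Subgroup.zpowers z) x := ⟨⟨z, Subgroup.mem_zpowers z⟩, rfl⟩
        have h2 : x ∈ orbit (Subgroup.zpowers z) x := mem_orbit_self x
        rw [hw, Set.mem_singleton_iff] at h1 h2
        have : x ∈ fixed X z := mem_fixed.2 (h1.trans h2.symm)
        rw [hfix] at this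
        exact absurd this (Finset.notMem_empty _)
      · refine Set.eq_of_subset_of_ncard_le (Set.subset_univ _) ?_
        rw [h, Set.ncard_univ, Nat.card_eq_fintype_card (α := X)]
    have hzK : z ∈ Subgroup.closure {s, t} := hz ▸ pow_mem (mul_mem
      (Subgroup.subset_closure (by simp)) (Subgroup.subset_closure (by simp))) _
    have htop : Subgroup.closure {s, t} = ⊤ := by
      refine C.eq_top_of_forall_H_le fun w => C.mem_below.1 ?_
      obtain ⟨⟨k, hk⟩, rfl⟩ : w ∈ orbit (Subgroup.zpowers z) x := huniv ▸ Set.mem_univ w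
      refine C.smul_mem_below ((Subgroup.zpowers_le.2 hzK) hk) (C.mem_below.2 fun l hl => ?_)
      obtain ⟨i, -, rfl⟩ := C.eq_pow_of_mem hs hs1 hl
      exact pow_mem (Subgroup.subset_closure (by simp)) i
    have hnorm {u : G} (hu : u * z = z⁻¹ * u) :
        u ∈ Subgroup.normalizer (Subgroup.zpowers z : Set G) := by
      rw [Subgroup.mem_normalizer_iff_map_conj_eq, MonoidHom.map_zpowers]
      rw [MonoidHom.coe_coe, MulAut.conj_apply, hu, mul_inv_cancel_right, Subgroup.zpowers_inv]
    have hN : (Subgroup.zpowers z).Normal := by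
      rw [← Subgroup.normalizer_eq_top_iff, eq_top_iff, ← htop, Subgroup.closure_le]
      rintro _ (rfl | rfl)
      exacts [hnorm hsz, hnorm htz]
    have := Fact.mk hr
    rcases hN.eq_bot_or_eq_top with h | h
    · rw [Subgroup.zpowers_eq_bot] at h
      rw [h, orderOf_one] at hzr
      exact hr.ne_one hzr.symm
    · exact ne_top_of_isPGroup C.not_solvable
        (IsPGroup.of_card (n := 1) (by rw [Nat.card_zpowers, hzr, pow_one])) h

omit [IsSimpleGroup G] [IsPretransitive G X] [MulAction G X] [Group G] in
/-- Any two lines of a linear space on 13 points with 4 points on each line meet. -/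
theorem exists_mem_inter_of_linear_space (L : X → X → Finset X) (hX : Fintype.card X = 13)
    (hl : ∀ x y, x ∈ L x y) (hr : ∀ x y, y ∈ L x y) (hc : ∀ x y, x ≠ y → (L x y).card = 4)
    (hL : ∀ x y x' y', x ≠ y → x' ≠ y' → x' ∈ L x y → y' ∈ L x y → L x' y' = L x y)
    {v w y z : X} (hvw : v ≠ w) (hyz : y ≠ z) : ∃ p, p ∈ L v w ∧ p ∈ L y z := by
  by_cases hv : v ∈ L y z
  · exact ⟨v, hl v w, hv⟩
  have hne {p : X} (hp : p ∈ L y z) : v ≠ p := fun h => hv (h ▸ hp)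
  have hd : ∀ p ∈ L y z, ∀ p' ∈ L y z, p ≠ p' →
      Disjoint ((L v p).erase v) ((L v p').erase v) := by
    intro p hp p' hp' hpp
    rw [Finset.disjoint_left]
    intro u hu hu'
    rw [Finset.mem_erase] at hu hu'
    have h := (hL v p v u (hne hp) hu.1.symm (hl v p) hu.2).symm.trans
      (hL v p' v u (hne hp') hu.1.symm (hl v p') hu'.2)
    have h1 := hL v p p p' (hne hp) hpp (hr v p) (h ▸ hr v p')
    rw [hL y z p p' hyz hpp hp hp'] at h1
    exact hv (h1 ▸ hl v p)
  have hcard : ((L y z).biUnion fun p => (L v p).erase v).card = 12 := by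
    rw [Finset.card_biUnion hd, Finset.sum_congr rfl (g := fun _ => 3), Finset.sum_const,
      hc y z hyz, smul_eq_mul]
    intro p hp
    rw [Finset.card_erase_of_mem (hl v p), hc v p (hne hp)]
  have huniv : ((L y z).biUnion fun p => (L v p).erase v) = Finset.univ.erase v := by
    refine Finset.eq_of_subset_of_card_le (fun u hu => ?_) ?_
    · obtain ⟨p, -, hu⟩ := Finset.mem_biUnion.1 hu
      exact Finset.mem_erase.2 ⟨(Finset.mem_erase.1 hu).1, Finset.mem_univ u⟩
    · rw [hcard, Finset.card_erase_of_mem (Finset.mem_univ v), Finset.card_univ, hX]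
  have hw : w ∈ (L y z).biUnion fun p => (L v p).erase v :=
    huniv ▸ Finset.mem_erase.2 ⟨hvw.symm, Finset.mem_univ w⟩
  obtain ⟨p, hp, hw⟩ := Finset.mem_biUnion.1 hw
  refine ⟨p, ?_, hp⟩
  rw [hL v p v w (hne hp) hvw (hl v p) (Finset.mem_erase.1 hw).2]
  exact hr v p

omit [IsSimpleGroup G] [IsPretransitive G X] in
theorem smul_mem_below_sup_iff {g : G} {x y z : X} :
    g • z ∈ C.below (C.H (g • x) ⊔ C.H (g • y)) ↔ z ∈ C.below (C.H x ⊔ C.H y) := by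
  have h {g : G} {x y z : X} (hz : z ∈ C.below (C.H x ⊔ C.H y)) :
      g • z ∈ C.below (C.H (g • x) ⊔ C.H (g • y)) := by
    rw [mem_below] at hz ⊢
    have hM : C.H x ⊔ C.H y ≤
        (C.H (g • x) ⊔ C.H (g • y)).comap (MulAut.conj g).toMonoidHom := by
      have hc {u : X} {k : G} (hk : k ∈ C.H u) : g * k * g⁻¹ ∈ C.H (g • u) := by
        rw [C.mem_smul]
        simpa [mul_assoc] using hk
      exact sup_le (fun k hk => Subgroup.mem_sup_left (hc hk))
        (fun k hk => Subgroup.mem_sup_right (hc hk))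
    intro k hk
    rw [C.mem_smul] at hk
    simpa [mul_assoc] using hM (hz hk)
  refine ⟨fun hz => ?_, h⟩
  simpa using h (g := g⁻¹) hz

theorem card_ne_thirteen [Finite G] (C : SmallPrimeClass G X 3) (x : X) :
    Fintype.card X ≠ 13 := by
  intro h13
  have := C.nontrivial_of_mem x
  have : Nonempty X := ⟨x⟩
  have h5 := C.not_dvd_card h13 Nat.prime_five (by decide) (by decide) (by decide)
  have h7 := C.not_dvd_card h13 (r := 7) (by norm_num) (by decide) (by decide) (by decide)
  have hL (K : Subgroup G) (hK : K ≠ ⊤) (y z : X) (hy : y ∈ C.below K) (hz : z ∈ C.below K)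
      (hyz : y ≠ z) : (C.below K).card = 4 := by
    have hmod := C.card_below_modEq_one hy
    have hd := (Dvd.intro _ (C.card_below_mul_card_inf_stabilizer hy)).trans
      (Subgroup.card_subgroup_dvd_card _)
    have h1 := Finset.one_lt_card.2 ⟨y, hy, z, hz, hyz⟩
    have hlt : (C.below K).card < 13 :=
      h13 ▸ (Finset.card_le_univ _).lt_of_ne fun h => hK (C.eq_top_of_card_below_eq h)
    generalize (C.below K).card = m at *
    rw [Nat.ModEq] at hmod
    have h7' : m ≠ 7 := fun h => h7 (h ▸ hd)
    have h10 : m ≠ 10 := fun h => h5 ((h ▸ (by decide) : 5 ∣ m).trans hd)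
    omega
  obtain ⟨y, z, hyz, htop⟩ : ∃ y z : X, y ≠ z ∧ C.H y ⊔ C.H z = ⊤ := by
    by_contra! hno
    have hl (y z : X) : y ∈ C.below (C.H y ⊔ C.H z) := C.mem_below.2 le_sup_left
    have hr (y z : X) : z ∈ C.below (C.H y ⊔ C.H z) := C.mem_below.2 le_sup_right
    have hc (y z : X) (hyz : y ≠ z) := hL _ (hno y z hyz) y z (hl y z) (hr y z) hyz
    have hLL (y z y' z' : X) (hyz : y ≠ z) (hyz' : y' ≠ z') (hy' : y' ∈ C.below (C.H y ⊔ C.H z))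
        (hz' : z' ∈ C.below (C.H y ⊔ C.H z)) :
        C.below (C.H y' ⊔ C.H z') = C.below (C.H y ⊔ C.H z) := by
      refine Finset.eq_of_subset_of_card_le (fun w hw => ?_) (by rw [hc _ _ hyz, hc _ _ hyz'])
      rw [mem_below] at *
      exact hw.trans (sup_le hy' hz')
    obtain ⟨y, hy⟩ := exists_ne x
    obtain ⟨z, hz⟩ : ∃ z, z ∉ C.below (C.H x ⊔ C.H y) := by
      by_contra! h
      have := hc x y hy.symm
      rw [Finset.eq_univ_of_forall h, Finset.card_univ] at this
      omega
    have hyz : y ≠ z := fun h => hz (h ▸ hr x y)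
    have hx : x ∉ C.below (C.H y ⊔ C.H z) := fun hx => hz <| by
      rw [hLL y z x y hyz hy.symm hx (hl y z)]
      exact hr y z
    obtain ⟨h, hh, hh1⟩ := C.exists_mem_ne_one x
    obtain ⟨p, hp, hp'⟩ := exists_mem_inter_of_linear_space
      (fun y z => C.below (C.H y ⊔ C.H z)) h13 hl hr hc hLL
      ((MulAction.injective h).ne hyz) hyz
    obtain ⟨p, rfl⟩ := MulAction.surjective h p
    rw [smul_mem_below_sup_iff] at hp
    have hxp : x ≠ p := fun he => hx (he ▸ hp)
    have hph : p ≠ h • p := fun he => hxp ((C.smul_eq_iff_eq hh hh1).1 he.symm).symm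
    rw [← hLL y z p (h • p) hyz hph hp hp', hLL x p p (h • p) hxp hph (hr x p)
      (C.smul_mem_below (Subgroup.mem_sup_left hh) (hr x p))] at hx
    exact hx (hl x p)
  have hD : Subgroup.centralizer (C.H y : Set G) ⊓ (stabilizer G y ⊓ stabilizer G z) = ⊥ := by
    rw [← Subgroup.card_eq_one]
    by_contra h1
    obtain ⟨r, hr, hd⟩ := Nat.exists_prime_and_dvd h1
    have := Fact.mk hr
    obtain ⟨⟨g, hg⟩, hgr⟩ := exists_prime_orderOf_dvd_card' r hd
    rw [Subgroup.orderOf_mk] at hgr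
    obtain ⟨hgC, hgy, hgz⟩ := hg
    have hlt := card_fixed_lt (X := X) (g := g) fun h1 => hr.ne_one (by rw [← hgr, h1, orderOf_one])
    by_cases hr2 : r = 2
    · have h4 := C.four_dvd_card_sub_card_fixed (hgr.trans hr2)
      have hm := C.card_fixed_modEq_one hgC
      have h2 := Finset.one_lt_card.2 ⟨y, mem_fixed.2 hgy, z, mem_fixed.2 hgz, hyz⟩
      rw [Nat.ModEq] at hm
      omega
    · have hco : (orderOf g).Coprime (3 - 1) :=
        hgr ▸ (Nat.coprime_primes hr Nat.prime_two).2 hr2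
      have hy := mem_fixed.2 hgy
      have hz := mem_fixed.2 hgz
      rw [C.fixed_eq_below hco] at hlt hy hz
      rw [mem_below] at hy hz
      have hle := sup_le hy hz
      rw [htop, top_le_iff] at hle
      refine hlt.ne ?_
      rw [← Finset.card_univ]
      congr 1
      exact Finset.eq_univ_of_forall fun w => C.mem_below.2 (hle ▸ le_top)
  have hDcard : Nat.card (stabilizer G y ⊓ stabilizer G z : Subgroup G) ≤ 2 := by
    have hb := Subgroup.relIndex_mul_relIndex ⊥ _ _ bot_le (C.centralizer_le_stabilizer y)
    have hd := C.card_stabilizer_dvd y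
    rw [Subgroup.relIndex_bot_left, Subgroup.relIndex_bot_left] at hb
    rw [← hb, Nat.mul_dvd_mul_iff_left Nat.card_pos] at hd
    rw [← Subgroup.relIndex_bot_left, ← hD, Subgroup.inf_relIndex_right]
    exact (Subgroup.relIndex_le_of_le_right inf_le_left
      (Nat.pos_of_dvd_of_pos hd (by decide)).ne').trans (Nat.le_of_dvd (by decide) hd)
  have hN : Nat.card (stabilizer G y) ≤ 26 := by
    rw [← ncard_orbit_mul_card_inf_stabilizer _ z]
    exact Nat.mul_le_mul (h13 ▸ ncard_orbit_le (stabilizer G y) z) hDcard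
  have hf : Fact (Fintype.card X).Prime := ⟨h13 ▸ by norm_num⟩
  have hs := card_sylow_dvd_card_stabilizer (G := G) y
  have hs1 := card_sylow_modEq_one (Fintype.card X) G
  have hs5 := five_le_card_sylow C.not_solvable (r := Fintype.card X)
    (by rw [← card_mul_card_stabilizer (G := G) x]; exact Dvd.intro _ rfl)
  have hle := Nat.le_of_dvd Nat.card_pos hs
  refine h7 (Dvd.dvd.trans ?_ (hs.trans (Subgroup.card_subgroup_dvd_card _)))
  generalize Nat.card (Sylow (Fintype.card X) G) = s at *
  rw [h13, Nat.ModEq] at hs1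
  omega

/-- A rank function on the overgroups of `H` makes all maximal chains equally long. -/
theorem _root_.AllMaxChainsSameLength.of_rank {Γ : Type*} [Group Γ] {H : Subgroup Γ}
    (f : Subgroup Γ → ℕ) (hf : ∀ K K' : Subgroup Γ, H ≤ K → K ⋖ K' → f K' = f K + 1) :
    AllMaxChainsSameLength H := by
  have key : ∀ {A B : Subgroup Γ} {r : ℕ}, CovChain A B r → H ≤ A → f B = f A + r := by
    intro A B r h
    induction h with
    | refl => exact fun _ => rfl
    | step hab _ ih =>
      intro hA
      rw [ih (hA.trans hab.le), hf _ _ hA hab]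
      omega
  rw [allMaxChainsSameLength_iff]
  intro r s hr hs
  have := key hr le_rfl
  have := key hs le_rfl
  omega

theorem _root_.CovBy.prime_relIndex {Γ : Type*} [Group Γ] [Finite Γ] {K K' : Subgroup Γ}
    (h : K ⋖ K') (hn : K' ≤ Subgroup.normalizer (K : Set Γ)) : (K.relIndex K').Prime := by
  have hN : (K.subgroupOf K').Normal := Subgroup.normal_subgroupOf_of_le_normalizer hn
  have h1 : K.relIndex K' ≠ 1 := fun h1 => h.lt.not_ge (Subgroup.relIndex_eq_one.1 h1)
  have hp := Nat.minFac_prime h1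
  have hd := Nat.minFac_dvd (K.relIndex K')
  generalize (K.relIndex K').minFac = p at hp hd
  have := Fact.mk hp
  obtain ⟨g, hg⟩ := exists_prime_orderOf_dvd_card' (G := K' ⧸ K.subgroupOf K') p hd
  let M := ((Subgroup.zpowers g).comap (QuotientGroup.mk' (K.subgroupOf K'))).map K'.subtype
  have hKM : K ≤ M := fun k hk => ⟨⟨k, h.le hk⟩, by
    have : ((⟨k, h.le hk⟩ : K') : K' ⧸ K.subgroupOf K') = 1 :=
      (QuotientGroup.eq_one_iff _).2 (Subgroup.mem_subgroupOf.2 hk)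
    simp [this, one_mem], rfl⟩
  have hMK : M ≤ K' := by
    rintro _ ⟨k, -, rfl⟩
    exact k.2
  have hg1 : g ≠ 1 := fun h => hp.ne_one (by rw [← hg, h, orderOf_one])
  obtain ⟨γ, rfl⟩ := QuotientGroup.mk'_surjective _ g
  have hM : K < M := hKM.lt_of_not_ge fun hle => hg1 <| (QuotientGroup.eq_one_iff _).2 <|
    Subgroup.mem_subgroupOf.2 (hle ⟨γ, Subgroup.mem_zpowers _, rfl⟩)
  have hMe : M = K' := hMK.eq_of_not_lt fun hlt => h.2 hM hlt
  have htop : Subgroup.zpowers (QuotientGroup.mk' (K.subgroupOf K') γ) = ⊤ := by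
    rw [eq_top_iff]
    intro u _
    obtain ⟨k, rfl⟩ := QuotientGroup.mk'_surjective _ u
    obtain ⟨l, hl, hlk⟩ := hMe.ge k.2
    rwa [← Subtype.ext hlk]
  have hc : K.relIndex K' = p := by
    rw [← hg, ← Nat.card_zpowers, htop, Subgroup.card_top]
    rfl
  rwa [hc]

omit [IsSimpleGroup G] [IsPretransitive G X] in
/-- An overgroup of a member of the class lies in its normaliser as soon as it contains no other
member. -/
theorem le_stabilizer_of_card_below_eq_one {K : Subgroup G} {x : X} (hx : C.H x ≤ K)
    (h : (C.below K).card = 1) : K ≤ stabilizer G x := by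
  obtain ⟨z, hz⟩ := Finset.card_eq_one.1 h
  have hmem := C.mem_below.2 hx
  intro k hk
  have := C.smul_mem_below hk hmem
  rw [hz, Finset.mem_singleton] at this hmem
  rw [mem_stabilizer_iff, this, hmem]

omit [Fintype X] [IsSimpleGroup G] in
theorem stabilizer_ne_top [Nontrivial X] (x : X) : stabilizer G x ≠ ⊤ := by
  intro h
  obtain ⟨y, hy⟩ := exists_ne x
  obtain ⟨g, rfl⟩ := exists_smul_eq G x y
  exact hy (h.ge (Subgroup.mem_top g))

omit [IsSimpleGroup G] [IsPretransitive G X] in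
theorem H_le_stabilizer [Finite G] (x : X) : C.H x ≤ stabilizer G x :=
  fun _ hk => C.com_refl x _ hk

theorem centralizer_eq_of_card_eq_succ [Finite G] (hn : Fintype.card X = q + 1) (x : X) :
    Subgroup.centralizer (C.H x : Set G) = C.H x := by
  have := C.nontrivial_of_mem x
  obtain ⟨b, hb⟩ := exists_ne x
  have hab : IsMulCommutative (C.H x) := by
    have := Fact.mk C.prime
    have := isCyclic_of_prime_card (C.card_H x)
    exact IsCyclic.isMulCommutative
  have hbot : Subgroup.centralizer (C.H x : Set G) ⊓ stabilizer G b = ⊥ := by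
    rw [eq_bot_iff]
    rintro g ⟨hgC, hgb⟩
    by_contra h1
    have hlt := card_fixed_lt (X := X) h1
    have hm := (C.card_fixed_modEq_one hgC).symm
    have h2 := Finset.one_lt_card.2
      ⟨x, mem_fixed.2 (C.centralizer_le_stabilizer x hgC), b, mem_fixed.2 hgb, hb.symm⟩
    have := Nat.le_of_dvd (by omega) ((Nat.modEq_iff_dvd' h2.le).1 hm)
    omega
  have hle : C.H x ≤ Subgroup.centralizer (C.H x : Set G) := Subgroup.le_centralizer _
  refine (Subgroup.eq_of_le_of_card_ge hle ?_).symm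
  have h := ncard_orbit_mul_card_inf_stabilizer (Subgroup.centralizer (C.H x : Set G)) b
  rw [hbot, Subgroup.card_bot, mul_one] at h
  rw [← h, C.card_H]
  have hsub : orbit (Subgroup.centralizer (C.H x : Set G)) b ⊆ {x}ᶜ := by
    rintro _ ⟨k, rfl⟩ hk
    refine hb (smul_left_cancel k ?_)
    exact (show k • b = x from hk).trans (C.centralizer_le_stabilizer x k.2).symm
  refine (Set.ncard_le_ncard hsub).trans ?_
  rw [Set.ncard_compl, Set.ncard_singleton, Nat.card_eq_fintype_card (α := X), hn]
  omega

theorem allMaxChainsSameLength_of_card_eq_succ [Finite G] (hn : Fintype.card X = q + 1) (x : X) :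
    AllMaxChainsSameLength (C.H x) := by
  have := C.nontrivial_of_mem x
  have : Nonempty X := ⟨x⟩
  have hle (K : Subgroup G) (hK : C.H x ≤ K) (htop : K ≠ ⊤) : K ≤ stabilizer G x := by
    refine C.le_stabilizer_of_card_below_eq_one hK ?_
    have hmem := C.mem_below.2 hK
    have hm := (C.card_below_modEq_one hmem).symm
    have hpos := Finset.card_pos.2 ⟨x, hmem⟩
    have hlt : (C.below K).card < Fintype.card X :=
      (Finset.card_le_univ _).lt_of_ne fun h => htop (C.eq_top_of_card_below_eq h)
    obtain ⟨m, hm⟩ := (Nat.modEq_iff_dvd' hpos).1 hm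
    rcases m with - | m
    · omega
    · have := Nat.le_mul_of_pos_right q (by omega : 0 < m + 1)
      omega
  have hnorm (K K' : Subgroup G) (hK : C.H x ≤ K) (hKK : K ≤ K') (hK' : K' ≤ stabilizer G x) :
      K' ≤ Subgroup.normalizer (K : Set G) := by
    have hcyc : IsCyclic (C.H x) := by
      have := Fact.mk C.prime
      exact isCyclic_of_prime_card (C.card_H x)
    have hcom (a b : G) (ha : a ∈ stabilizer G x) (hb : b ∈ stabilizer G x) :
        a * b * a⁻¹ * b⁻¹ ∈ C.H x := by
      rw [← C.centralizer_eq_of_card_eq_succ hn x]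
      rw [stabilizer_eq_normalizer] at ha hb
      have h : (⟨a, ha⟩ * ⟨b, hb⟩ * ⟨a, ha⟩⁻¹ * ⟨b, hb⟩⁻¹ :
          Subgroup.normalizer (C.H x : Set G)) ∈ (C.H x).normalizerMonoidHom.ker := by
        rw [MonoidHom.mem_ker]
        simp only [map_mul, map_inv]
        refine (IsCyclic.mulAutMulEquiv (C.H x)).injective ?_
        simp only [map_mul, map_inv, map_one]
        rw [mul_inv_eq_one, mul_inv_eq_iff_eq_mul, mul_comm]
      rwa [Subgroup.normalizerMonoidHom_ker, Subgroup.mem_subgroupOf] at h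
    have hconj (k a : G) (hk : k ∈ K) (ha : a ∈ K') : a * k * a⁻¹ ∈ K := by
      have := mul_mem (hK (hcom a k (hK' ha) (hK' (hKK hk)))) hk
      simpa using this
    intro a ha
    rw [Subgroup.mem_normalizer_iff]
    refine fun k => ⟨fun hk => hconj k a hk ha, fun hk => ?_⟩
    have := hconj _ _ hk (inv_mem ha)
    simpa [mul_assoc] using this
  refine .of_rank (fun K => if K = ⊤ then
    ArithmeticFunction.cardFactors (Nat.card (stabilizer G x)) + 1 else
    ArithmeticFunction.cardFactors (Nat.card K)) fun K K' hK hcov => ?_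
  have hKtop : K ≠ ⊤ := (hcov.lt.trans_le le_top).ne
  rw [if_neg hKtop]
  by_cases htop : K' = ⊤
  · subst htop
    rw [if_pos rfl, (hle K hK hKtop).eq_of_not_lt fun hlt =>
      hcov.2 hlt (stabilizer_ne_top x).lt_top]
  · rw [if_neg htop]
    have hK' := hle K' (hK.trans hcov.le) htop
    have hp := hcov.prime_relIndex (hnorm K K' hK hcov.le hK')
    rw [← Subgroup.relIndex_bot_left K', ← Subgroup.relIndex_mul_relIndex ⊥ K K' bot_le hcov.le,
      Subgroup.relIndex_bot_left, ArithmeticFunction.cardFactors_mul Nat.card_pos.ne' hp.ne_zero,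
      ArithmeticFunction.cardFactors_apply_prime hp]

omit [Fintype X] [IsSimpleGroup G] [IsPretransitive G X] in
theorem ncard_orbit_add_two_le [Fintype X] {K : Subgroup G} {x y z : X} (hx : ∀ k ∈ K, k • x = x)
    (hy : ∀ k ∈ K, k • y = y) (hxy : x ≠ y) (hzx : z ≠ x) (hzy : z ≠ y) :
    (orbit K z).ncard + 2 ≤ Fintype.card X := by
  have hsub : orbit K z ⊆ {x, y}ᶜ := by
    rintro _ ⟨k, rfl⟩ hk
    have hk : (k : G) • z = x ∨ (k : G) • z = y := hk
    rcases hk with hk | hk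
    · exact hzx (smul_left_cancel (k : G) (hk.trans (hx k k.2).symm))
    · exact hzy (smul_left_cancel (k : G) (hk.trans (hy k k.2).symm))
  have h := Set.ncard_le_ncard hsub
  have h2 := Set.ncard_add_ncard_compl ({x, y} : Set X)
  rw [Set.ncard_pair hxy, Nat.card_eq_fintype_card (α := X)] at h2
  omega

theorem not_seven_dvd_card [Finite G] (C : SmallPrimeClass G X 3)
    (h10 : Fintype.card X = 10) (x : X) : ¬ 7 ∣ Nat.card G := by
  have : Nonempty X := ⟨x⟩
  exact C.not_dvd_card h10 (by norm_num) (by decide) (by decide) (by decide)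

theorem card_below_ne_seven [Finite G] (C : SmallPrimeClass G X 3)
    (h10 : Fintype.card X = 10) {K : Subgroup G} {x : X}
    (hx : x ∈ C.below K) : (C.below K).card ≠ 7 := fun h =>
  C.not_seven_dvd_card h10 x <| h ▸ (Dvd.intro _ (C.card_below_mul_card_inf_stabilizer hx)).trans
    (Subgroup.card_subgroup_dvd_card _)

theorem card_centralizer_dvd [Finite G] (C : SmallPrimeClass G X 3)
    (h10 : Fintype.card X = 10) (x : X) :
    Nat.card (Subgroup.centralizer (C.H x : Set G)) ∣ 27 := by
  have := C.nontrivial_of_mem x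
  have h2 := C.not_two_dvd_card_centralizer h10 (by decide) x
  have h5 := C.not_dvd_card_centralizer h10 Nat.prime_five (by decide) x
  have h7 := C.not_dvd_card_centralizer h10 (r := 7) (by norm_num) (by decide) x
  have h81 : Nat.card (Subgroup.centralizer (C.H x : Set G)) ∣ 3 ^ 4 :=
    Nat.dvd_of_dvd_mul_of_not_dvd (k := 1) (p := 7) (by norm_num)
      (Nat.dvd_of_dvd_mul_of_not_dvd (k := 1) Nat.prime_five
        (Nat.dvd_of_dvd_mul_of_not_dvd (k := 7) Nat.prime_two
          ((Subgroup.card_dvd_of_le (C.centralizer_le_stabilizer x)).trans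
            (card_stabilizer_dvd_factorial h10 x)) h2) h5) h7
  obtain ⟨i, hi, hcard⟩ := (Nat.dvd_prime_pow Nat.prime_three).1 h81
  rcases hi.lt_or_eq with hlt | rfl
  · exact hcard ▸ pow_dvd_pow 3 (by omega : i ≤ 3)
  obtain ⟨b, hb⟩ := exists_ne x
  have hfix {g : G} (hg : g ∈ Subgroup.centralizer (C.H x : Set G)) (hgb : g • b = b)
      (h1 : g ≠ 1) : (fixed X g).card = 4 := by
    have hx : x ∈ fixed X g := mem_fixed.2 (C.centralizer_le_stabilizer x hg)
    have hgt := Finset.one_lt_card.2 ⟨x, hx, b, mem_fixed.2 hgb, hb.symm⟩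
    have hlt := card_fixed_lt (X := X) h1
    have hm := C.card_fixed_modEq_one hg
    have h7 : (fixed X g).card ≠ 7 := by
      have hco : (orderOf g).Coprime (3 - 1) := by
        refine Nat.Coprime.of_dvd_left (a₂ := 3 ^ 4) ?_ (by decide)
        rw [← hcard, ← Subgroup.orderOf_mk g hg]
        exact orderOf_dvd_natCard _
      rw [C.fixed_eq_below hco] at hx ⊢
      exact C.card_below_ne_seven h10 hx
    rw [Nat.ModEq] at hm
    omega
  have hD := ncard_orbit_mul_card_inf_stabilizer (Subgroup.centralizer (C.H x : Set G)) b
  have hDd := Dvd.intro_left _ hD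
  rw [hcard] at hD hDd
  have hle := ncard_orbit_le (Subgroup.centralizer (C.H x : Set G)) b
  obtain ⟨j, hj, hDj⟩ := (Nat.dvd_prime_pow Nat.prime_three).1 hDd
  have hj2 : 2 ≤ j := by
    by_contra! h
    rw [hDj] at hD
    interval_cases j <;> omega
  set D := Subgroup.centralizer (C.H x : Set G) ⊓ stabilizer G b with hDdef
  have hDne : D ≠ ⊥ := fun h => by
    rw [h, Subgroup.card_bot] at hDj
    exact absurd hDj (Nat.one_lt_pow (by omega) (by norm_num)).ne
  obtain ⟨g, hg, hg1⟩ := D.bot_or_exists_ne_one.resolve_left hDne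
  obtain ⟨z, hz⟩ : ∃ z, z ∉ fixed X g := by
    by_contra! h
    have := hfix hg.1 hg.2 hg1
    rw [Finset.eq_univ_of_forall h, Finset.card_univ] at this
    omega
  have hbot : D ⊓ stabilizer G z = ⊥ := by
    rw [Subgroup.eq_bot_iff_forall]
    rintro l ⟨hl, hlz⟩
    by_contra hl1
    have h4 := hfix hl.1 hl.2 hl1
    have hg4 := hfix hg.1 hg.2 hg1
    have hx {k : G} (hk : k ∈ D) : x ∈ fixed X k :=
      mem_fixed.2 (C.centralizer_le_stabilizer x hk.1)
    have hinv {k : G} (hk : k ∈ D) : ∀ s ∈ C.H x, ∀ y ∈ fixed X k, s • y ∈ fixed X k := by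
      intro s hs y hy
      rw [mem_fixed] at hy ⊢
      rw [smul_smul, ← Subgroup.mem_centralizer_iff.1 hk.1 s hs, mul_smul, hy]
    have hm := C.card_modEq_one (S := fixed X g ∩ fixed X l) (x := x)
      (fun s hs y hy => Finset.mem_inter.2 ⟨hinv hg s hs y (Finset.mem_inter.1 hy).1,
        hinv hl s hs y (Finset.mem_inter.1 hy).2⟩) (Finset.mem_inter.2 ⟨hx hg, hx hl⟩)
    have hgt := Finset.one_lt_card.2 ⟨x, Finset.mem_inter.2 ⟨hx hg, hx hl⟩, b,
      Finset.mem_inter.2 ⟨mem_fixed.2 hg.2, mem_fixed.2 hl.2⟩, hb.symm⟩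
    rw [Nat.ModEq] at hm
    have heq := Finset.eq_of_subset_of_card_le
      (Finset.inter_subset_right : fixed X g ∩ fixed X l ⊆ fixed X l) (by omega)
    exact hz (Finset.inter_eq_right.1 heq (mem_fixed.2 hlz))
  have horb := ncard_orbit_mul_card_inf_stabilizer D z
  rw [hbot, Subgroup.card_bot, mul_one, hDj] at horb
  have hle := ncard_orbit_add_two_le (K := D) (x := x) (y := b) (z := z)
    (fun k hk => C.centralizer_le_stabilizer x hk.1) (fun k hk => hk.2) hb.symm
    (fun h => hz (h ▸ mem_fixed.2 (C.centralizer_le_stabilizer x hg.1)))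
    (fun h => hz (h ▸ mem_fixed.2 hg.2))
  have := Nat.pow_le_pow_right (n := 3) (by decide) hj2
  omega

theorem card_stabilizer_eq_six [Finite G] (C : SmallPrimeClass G X 3)
    (h10 : Fintype.card X = 10) (x : X) :
    Nat.card (stabilizer G x) = 6 := by
  have hN : Nat.card (stabilizer G x) ∣ 54 :=
    (C.card_stabilizer_dvd x).trans (Nat.mul_dvd_mul_right (C.card_centralizer_dvd h10 x) 2)
  have hG := card_mul_card_stabilizer (G := G) x
  rw [h10] at hG
  have := Fact.mk Nat.prime_five
  have h5 : 5 ∣ Nat.card G := hG ▸ Dvd.dvd.mul_right (by decide) _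
  have hN5 : ¬ 5 ∣ Nat.card (stabilizer G x) := fun h => absurd (h.trans hN) (by decide)
  let P : Sylow 5 G := default
  obtain ⟨m, hm⟩ := IsPGroup.iff_card.1 P.2
  have hP : Nat.card (P : Subgroup G) = 5 := by
    have hd := Subgroup.card_subgroup_dvd_card (P : Subgroup G)
    have h5P := P.dvd_card_of_dvd_card h5
    rw [← hG, hm] at hd
    have h10 := Nat.Coprime.dvd_of_dvd_mul_right
      (Nat.Coprime.pow_left m ((Nat.prime_five.coprime_iff_not_dvd).2 hN5)) hd
    rw [hm] at h5P ⊢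
    have hm2 : m < 2 := by
      by_contra! hm2
      exact absurd ((pow_dvd_pow 5 hm2).trans h10) (by decide)
    interval_cases m <;> omega
  have hfree : ∀ y : X, ¬ ∀ k ∈ (P : Subgroup G), k • y = y := by
    intro y hy
    have hle : (P : Subgroup G) ≤ stabilizer G y := fun k hk => hy k hk
    have h := Subgroup.card_dvd_of_le hle
    obtain ⟨g, rfl⟩ := exists_smul_eq G x y
    rw [hP] at h
    have h1 := card_mul_card_stabilizer (G := G) (g • x)
    rw [h10, ← hG] at h1
    exact hN5 (Nat.eq_of_mul_eq_mul_left (by decide) h1 ▸ h)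
  have h3 : ¬ 3 ∣ Nat.card (Subgroup.normalizer (P : Set G)) := by
    intro h3
    have := Fact.mk Nat.prime_three
    obtain ⟨⟨g, hg⟩, hgr⟩ := exists_prime_orderOf_dvd_card' 3 h3
    rw [Subgroup.orderOf_mk] at hgr
    have hgC := mem_centralizer_of_mem_normalizer (P := (P : Subgroup G))
      (by rw [hP]; decide) hg (by rw [hP, hgr]; decide)
    have hmod := card_modEq_card_fixed (X := X) Nat.prime_three hgr
    have h5 := card_modEq_card_filter (p := 5) (n := 1) (K := (P : Subgroup G))
        (by rw [hP, pow_one])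
      (fixed X g) (fun k hk y hy => by
        rw [mem_fixed] at hy ⊢
        rw [smul_smul, ← Subgroup.mem_centralizer_iff.1 hgC k hk, mul_smul, hy])
    rw [Finset.filter_false_of_mem fun y _ => hfree y, Finset.card_empty] at h5
    have : Nontrivial X := C.nontrivial_of_mem x
    have hlt := card_fixed_lt (X := X) (g := g) fun h1 => by simp [h1] at hgr
    rw [Nat.ModEq] at h5 hmod
    omega
  have hNP : Nat.card (Subgroup.normalizer (P : Set G)) ∣ 20 := by
    refine Nat.dvd_of_dvd_mul_of_not_dvd (k := 3) Nat.prime_three ?_ h3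
    refine (Subgroup.card_subgroup_dvd_card _).trans ?_
    rw [← hG]
    exact Nat.mul_dvd_mul_left 10 hN
  have h5NP : 5 ∣ Nat.card (Subgroup.normalizer (P : Set G)) :=
    (dvd_of_eq hP.symm).trans (Subgroup.card_dvd_of_le Subgroup.le_normalizer)
  have hne := card_normalizer_sylow_ne C.not_solvable h5 P
  have hs1 := card_sylow_modEq_one 5 G
  have hs5 := five_le_card_sylow C.not_solvable h5
  have hidx := Subgroup.index_mul_card (Subgroup.normalizer (P : Set G))
  rw [← Sylow.card_eq_index_normalizer, ← hG] at hidx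
  generalize Nat.card (Sylow 5 G) = s at *
  generalize Nat.card (Subgroup.normalizer (P : Set G)) = c at *
  generalize Nat.card (stabilizer G x) = n at *
  rw [Nat.ModEq] at hs1
  have hc : c = 10 ∨ c = 20 := by
    have := Nat.le_of_dvd (by decide) hNP
    interval_cases c <;> omega
  have hn := Nat.le_of_dvd (by decide) hN
  rcases hc with rfl | rfl
  · obtain rfl : s = n := by omega
    interval_cases s <;> omega
  · obtain rfl : n = 2 * s := by omega
    have : s ≤ 27 := by omega
    interval_cases s <;> omega

theorem allMaxChainsSameLength_of_card_eq_ten [Finite G] (C : SmallPrimeClass G X 3)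
    (h10 : Fintype.card X = 10) (x : X) :
    AllMaxChainsSameLength (C.H x) := by
  have := C.nontrivial_of_mem x
  have : Nonempty X := ⟨x⟩
  have hN := C.card_stabilizer_eq_six h10 x
  have hH : Nat.card (C.H x) = 3 := C.card_H x
  have hover (K : Subgroup G) (hK : C.H x ≤ K) (htop : K ≠ ⊤) :
      K = C.H x ∨ K = stabilizer G x ∨ Nat.card K = 12 ∧ ¬ stabilizer G x ≤ K := by
    have hmem := C.mem_below.2 hK
    have hm := C.card_below_modEq_one hmem
    have h7 := C.card_below_ne_seven h10 hmem
    have hpos := Finset.card_pos.2 ⟨x, hmem⟩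
    have hlt : (C.below K).card < Fintype.card X :=
      (Finset.card_le_univ _).lt_of_ne fun h => htop (C.eq_top_of_card_below_eq h)
    rw [Nat.ModEq] at hm
    by_cases h1 : (C.below K).card = 1
    · have hle := C.le_stabilizer_of_card_below_eq_one hK h1
      have hd := Subgroup.card_dvd_of_le hle
      have hd' := Subgroup.card_dvd_of_le hK
      rw [hN] at hd
      rw [hH] at hd'
      have hc : Nat.card K = 3 ∨ Nat.card K = 6 := by
        have := Nat.le_of_dvd (by decide) hd
        generalize Nat.card K = c at *
        interval_cases c <;> omega
      rcases hc with hc | hc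
      · exact .inl (Subgroup.eq_of_le_of_card_ge hK (by omega)).symm
      · exact .inr (.inl (Subgroup.eq_of_le_of_card_ge hle (by omega)))
    · have h4 : (C.below K).card = 4 := by omega
      have hcard := C.card_below_mul_card_inf_stabilizer hmem
      have hd := Subgroup.card_subgroup_dvd_card K
      have hd3 := Subgroup.card_dvd_of_le (le_inf hK (C.H_le_stabilizer x))
      have hd6 := Subgroup.card_dvd_of_le (inf_le_right : K ⊓ stabilizer G x ≤ _)
      have hle6 := Nat.le_of_dvd (by omega) hd6
      rw [h4] at hcard
      rw [← card_mul_card_stabilizer (G := G) x, h10, hN] at hd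
      rw [hH] at hd3
      rw [hN] at hd6 hle6
      have hc : Nat.card (K ⊓ stabilizer G x : Subgroup G) = 3 := by
        rw [← hcard] at hd
        have := Nat.card_pos (α := (K ⊓ stabilizer G x : Subgroup G))
        generalize Nat.card (K ⊓ stabilizer G x : Subgroup G) = c at *
        interval_cases c <;> omega
      refine .inr (.inr ⟨by omega, fun hle => ?_⟩)
      rw [inf_eq_right.2 hle] at hc
      omega
  have hHN : C.H x < stabilizer G x :=
    (C.H_le_stabilizer x).lt_of_ne fun h => by rw [h, hN] at hH; omega
  refine .of_rank (fun K => if K = ⊤ then 2 else if K = C.H x then 0 else 1)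
    fun K K' hK hcov => ?_
  have hKtop : K ≠ ⊤ := (hcov.lt.trans_le le_top).ne
  have hK'H : K' ≠ C.H x := (hK.trans_lt hcov.lt).ne'
  simp only [if_neg hKtop, if_neg hK'H]
  by_cases htop : K' = ⊤
  · rw [if_pos htop, if_neg]
    rintro rfl
    exact hcov.2 hHN (htop ▸ (stabilizer_ne_top x).lt_top)
  · rw [if_neg htop, if_pos]
    have hlt : Nat.card K < Nat.card K' := by
      by_contra! h
      exact hcov.lt.ne (Subgroup.eq_of_le_of_card_ge hcov.le h)
    rcases hover K hK hKtop with h | rfl | ⟨h, -⟩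
    · exact h
    · rcases hover K' (hK.trans hcov.le) htop with h | h | ⟨-, h⟩
      · exact absurd h hK'H
      · exact absurd h hcov.lt.ne'
      · exact absurd hcov.le h
    · rcases hover K' (hK.trans hcov.le) htop with h' | h' | ⟨h', -⟩
      · exact absurd h' hK'H
      · rw [h', hN] at hlt
        omega
      · omega

theorem allMaxChainsSameLength_H [Finite G] (x : X) : AllMaxChainsSameLength (C.H x) := by
  have : Nonempty X := ⟨x⟩
  have h5 := C.five_le_card
  have h14 := C.card_le
  have hdvd := C.dvd_card_compl x
  rw [C.card_Z_eq_one x] at hdvd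
  have hq := C.prime
  have hq14 : q < 14 := by
    have := Nat.le_of_dvd (by omega) hdvd
    omega
  interval_cases hc : q <;> try (revert hq; norm_num; done)
  · have h4 := C.four_dvd_card_compl x
    rw [C.card_Z_eq_one x] at h4
    have hn : Fintype.card X = 5 ∨ Fintype.card X = 9 ∨ Fintype.card X = 13 := by omega
    have hp := C.not_prime_card x
    rcases hn with h | h | h
    · exact absurd (h ▸ Nat.prime_five) hp
    · exact absurd h (C.card_ne_nine x)
    · exact absurd (h ▸ by norm_num) hp
  · have hn : Fintype.card X = 7 ∨ Fintype.card X = 10 ∨ Fintype.card X = 13 := by omega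
    rcases hn with h | h | h
    · exact absurd h (C.card_ne_seven x)
    · exact C.allMaxChainsSameLength_of_card_eq_ten h x
    · exact absurd h (C.card_ne_thirteen x)
  · have h11 := C.card_ne_eleven x
    exact C.allMaxChainsSameLength_of_card_eq_succ (by omega) x
  all_goals exact C.allMaxChainsSameLength_of_card_eq_succ (by omega) x

end General

end SmallPrimeClass

open scoped Pointwise in
theorem sixteen_le_delta {G : Type*} [Group G] [Finite G] [IsSimpleGroup G]
    (hns : ¬ Group.IsSolvable G) : 16 ≤ delta G := by
  by_contra! hlt
  obtain ⟨H, hH, hbad⟩ := exists_prime_card_not_allMaxChainsSameLength hns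
  let _ : MulAction G (Subgroup G) := MulAction.compHom (Subgroup G) (MulAut.conj (G := G))
  let X : Type _ := MulAction.orbit G H
  have hsmul : ∀ (g : G) (K : Subgroup G), g • K = K.map (MulAut.conj g).toMonoidHom :=
    fun _ _ => rfl
  have hmem : ∀ (g : G) (K : Subgroup G) (k : G), k ∈ g • K ↔ g⁻¹ * k * g ∈ K := by
    intro g K k
    rw [hsmul, Subgroup.mem_map]
    constructor
    · rintro ⟨l, hl, rfl⟩
      simpa [mul_assoc] using hl
    · exact fun h => ⟨_, h, by simp [mul_assoc]⟩
  have hcard : ∀ x : X, Nat.card (x.1 : Subgroup G) = Nat.card H := by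
    rintro ⟨_, g, rfl⟩
    exact Subgroup.card_map_of_injective (MulAut.conj g).injective
  have hX : ∀ x : X, ¬ AllMaxChainsSameLength x.1 := by
    rintro ⟨_, g, rfl⟩
    exact fun h => hbad ((allMaxChainsSameLength_conj_iff g).1 h)
  have _ : Fintype X := Fintype.ofFinite X
  have hle : Nat.card (Option X) ≤ delta G := by
    refine Nat.card_le_card_of_injective (fun o : Option X =>
      (⟨o.elim ⊥ Subtype.val, ?_⟩ : {K : Subgroup G // ¬ AllMaxChainsSameLength K})) ?_
    · cases o with
      | none => exact fun h => hbad (h.mono bot_le)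
      | some x => exact hX x
    · have hne : ∀ x : X, x.1 ≠ ⊥ := fun x h => hH.ne_one (by
        rw [← hcard x, h, Subgroup.card_bot])
      rintro (_ | x) (_ | y) h
      · rfl
      · exact absurd (congrArg Subtype.val h).symm (hne y)
      · exact absurd (congrArg Subtype.val h) (hne x)
      · have h' := congrArg Subtype.val h
        exact congrArg some (Subtype.ext h')
  rw [Finite.card_option, Nat.card_eq_fintype_card] at hle
  let C : SmallPrimeClass G X (Nat.card H) :=
    { H := fun x => x.1
      prime := hH
      card_H := hcard
      mem_smul := fun g x k => hmem g x.1 k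
      inj := fun _ _ => Subtype.ext
      not_solvable := hns
      card_le := by omega }
  let x : X := ⟨H, MulAction.mem_orbit_self H⟩
  exact hX x (C.allMaxChainsSameLength_H x)

theorem stmt_11 {G : Type*} [Group G] [Finite G] (h : delta G < 16) :
    IsSolvable G := by
  exact isSolvable_of_delta_lt (fun _ _ _ _ hns => sixteen_le_delta hns) G h
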